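/- Let ℓ be a prime and let G and H be subgroups of GL₂(ℤ/ℓℤ) with sig(G) = sig(H) and z(G) = z(H). Then G and H are locally conjugate in GL₂(ℓ) and are isomorphic as abstract groups. -/

import Mathlib

open Matrix

/-- `GL₂(ℤ/ℓℤ)`. -/
abbrev GL2 (ℓ : ℕ) := GL (Fin 2) (ZMod ℓ)

/-- The underlying matrix of an element of `GL₂(ℤ/ℓℤ)`. -/
def mat {ℓ : ℕ} (g : GL2 ℓ) : Matrix (Fin 2) (Fin 2) (ZMod ℓ) := g

/-- `dim₁ g`, the dimension of the eigenspace `ker(g − 1)` of `g` acting on `(ℤ/ℓℤ)²`. -/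
noncomputable def dimOne {ℓ : ℕ} (g : GL2 ℓ) : ℕ :=
  Module.finrank (ZMod ℓ) (LinearMap.ker (Matrix.toLin' (mat g - 1)))

/-- `sig(g) = (det g, tr g, dim₁ g)`. -/
noncomputable def sigOf {ℓ : ℕ} (g : GL2 ℓ) : ZMod ℓ × ZMod ℓ × ℕ :=
  ((mat g).det, (mat g).trace, dimOne g)

/-- The signature `sig(G) = {sig(g) : g ∈ G}` of a subgroup of `GL₂(ℤ/ℓℤ)`. -/
noncomputable def sigSet {ℓ : ℕ} (G : Subgroup (GL2 ℓ)) : Set (ZMod ℓ × ZMod ℓ × ℕ) :=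
  {s | ∃ g ∈ G, sigOf g = s}

/-- `z(G)`, the proportion of trace-zero elements of `G`, as a rational number. -/
noncomputable def zRatio {ℓ : ℕ} (G : Subgroup (GL2 ℓ)) : ℚ :=
  (Nat.card {g : G // (mat (g : GL2 ℓ)).trace = 0} : ℚ) / (Nat.card G : ℚ)

/-- Two subgroups of `GL₂(ℤ/ℓℤ)` are locally conjugate if there is a bijection between
them carrying each element to a `GL₂(ℤ/ℓℤ)`-conjugate of itself. -/
def LocallyConjugate {ℓ : ℕ} (G H : Subgroup (GL2 ℓ)) : Prop :=
  ∃ f : G ≃ H, ∀ g : G, IsConj (g : GL2 ℓ) ((f g : H) : GL2 ℓ)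

theorem exists_entries {R : Type*} (A : Matrix (Fin 2) (Fin 2) R) : ∃ a b c d, A = !![a, b; c, d] :=
  ⟨_, _, _, _, Matrix.eta_fin_two A⟩

section TwoByTwo

variable {E : Type*} [Field E]

/-- A matrix is scalar when it is a multiple of the identity. -/
def IsScal (A : Matrix (Fin 2) (Fin 2) E) : Prop := ∃ c : E, A = c • 1

theorem isScal_iff {A : Matrix (Fin 2) (Fin 2) E} :
    IsScal A ↔ A 0 1 = 0 ∧ A 1 0 = 0 ∧ A 0 0 = A 1 1 := by
  constructor
  · rintro ⟨c, rfl⟩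
    simp
  · rintro ⟨h1, h2, h3⟩
    refine ⟨A 0 0, ?_⟩
    ext i j
    fin_cases i <;> fin_cases j <;> simp [h1, h2, h3]

theorem mem_center_iff_isScal {g : GL (Fin 2) E} :
    g ∈ Subgroup.center (GL (Fin 2) E) ↔ IsScal (g : Matrix (Fin 2) (Fin 2) E) := by
  rw [Matrix.GeneralLinearGroup.mem_center_iff_val_mem_range_scalar]
  constructor
  · rintro ⟨c, hc⟩
    refine ⟨c, ?_⟩
    rw [← hc]
    ext i j
    fin_cases i <;> fin_cases j <;> simp
  · rintro ⟨c, hc⟩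
    refine ⟨c, ?_⟩
    rw [hc]
    ext i j
    fin_cases i <;> fin_cases j <;> simp

theorem mul_self_eq (A : Matrix (Fin 2) (Fin 2) E) : A * A = A.trace • A - A.det • 1 := by
  obtain ⟨a, b, c, d, rfl⟩ := exists_entries A
  ext i j
  fin_cases i <;> fin_cases j <;>
    simp [Matrix.mul_apply, Fin.sum_univ_two, Matrix.trace_fin_two, Matrix.det_fin_two] <;> ring

theorem exists_eq_add_smul_of_commute {A B : Matrix (Fin 2) (Fin 2) E} (hA : ¬ IsScal A)
    (h : A * B = B * A) : ∃ a b : E, B = a • 1 + b • A := by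
  rw [isScal_iff] at hA
  obtain ⟨a, b, c, d, rfl⟩ := exists_entries A
  obtain ⟨p, q, r, s, rfl⟩ := exists_entries B
  have h00 := congrFun (congrFun h 0) 0
  have h01 := congrFun (congrFun h 0) 1
  have h10 := congrFun (congrFun h 1) 0
  simp [Matrix.mul_apply, Fin.sum_univ_two] at h00 h01 h10 hA
  by_cases hb : b = 0
  · by_cases hc : c = 0
    · have had : a - d ≠ 0 := sub_ne_zero.2 (hA hb hc)
      subst hb hc
      have hq : q = 0 := by
        have : (a - d) * q = 0 := by linear_combination h01
        simpa [had] using this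
      have hr : r = 0 := by
        have : (a - d) * r = 0 := by linear_combination -h10
        simpa [had] using this
      refine ⟨p - (p - s) / (a - d) * a, (p - s) / (a - d), ?_⟩
      ext i j
      fin_cases i <;> fin_cases j <;> simp [hq, hr] <;> field_simp <;> ring
    · refine ⟨p - r / c * a, r / c, ?_⟩
      ext i j
      fin_cases i <;> fin_cases j <;> simp <;> field_simp
      · linear_combination -h00
      · linear_combination -h10
  · refine ⟨p - q / b * a, q / b, ?_⟩
    ext i j
    fin_cases i <;> fin_cases j <;> simp <;> field_simp
    · linear_combination h00
    · linear_combination h01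

theorem commute_of_commute {A B C : Matrix (Fin 2) (Fin 2) E} (hA : ¬ IsScal A)
    (hB : A * B = B * A) (hC : A * C = C * A) : B * C = C * B := by
  obtain ⟨a, b, rfl⟩ := exists_eq_add_smul_of_commute hA hB
  simp [add_mul, mul_add, hC]

/-- The companion matrix of a non-scalar matrix is conjugate to it. -/
theorem exists_mul_eq_mul_companion {A : Matrix (Fin 2) (Fin 2) E} (hA : ¬ IsScal A) :
    ∃ P : GL (Fin 2) E, A * P = P * !![0, -A.det; 1, A.trace] := by
  rw [isScal_iff] at hA
  obtain ⟨a, b, c, d, rfl⟩ := exists_entries A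
  have key : ∃ u v : E, u * (c * u + d * v) - v * (a * u + b * v) ≠ 0 := by
    by_contra! hcon
    have h1 := hcon 1 0
    have h2 := hcon 0 1
    have h3 := hcon 1 1
    simp at h1 h2
    refine hA ⟨by simpa using h2, by simpa using h1, ?_⟩
    simp
    linear_combination h1 + -h2 - h3
  obtain ⟨u, v, huv⟩ := key
  refine ⟨Matrix.GeneralLinearGroup.mkOfDetNeZero !![u, a * u + b * v; v, c * u + d * v] ?_, ?_⟩
  · rw [Matrix.det_fin_two_of]
    intro h
    exact huv (by linear_combination h)
  · ext i j
    fin_cases i <;> fin_cases j <;>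
      simp [Matrix.GeneralLinearGroup.mkOfDetNeZero, Matrix.mul_apply, Fin.sum_univ_two,
        Matrix.trace_fin_two, Matrix.det_fin_two] <;> ring

theorem isConj_of_trace_det {g h : GL (Fin 2) E} (hg : ¬ IsScal (g : Matrix (Fin 2) (Fin 2) E))
    (hh : ¬ IsScal (h : Matrix (Fin 2) (Fin 2) E))
    (ht : (g : Matrix (Fin 2) (Fin 2) E).trace = (h : Matrix (Fin 2) (Fin 2) E).trace)
    (hd : (g : Matrix (Fin 2) (Fin 2) E).det = (h : Matrix (Fin 2) (Fin 2) E).det) :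
    IsConj g h := by
  obtain ⟨P, hP⟩ := exists_mul_eq_mul_companion hg
  obtain ⟨Q, hQ⟩ := exists_mul_eq_mul_companion hh
  rw [ht, hd] at hP
  set C := !![0, -(h : Matrix (Fin 2) (Fin 2) E).det; 1, (h : Matrix (Fin 2) (Fin 2) E).trace]
  rw [isConj_iff]
  have hC : C = ((P⁻¹ : GL (Fin 2) E) : Matrix (Fin 2) (Fin 2) E) * (g * P) := by
    rw [hP, ← mul_assoc, Units.inv_mul, one_mul]
  have key : Q * (P⁻¹ * (g * P)) = h * Q := Units.ext (by rw [hC] at hQ; exact hQ.symm)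
  refine ⟨Q * P⁻¹, ?_⟩
  rw [show Q * P⁻¹ * g * (Q * P⁻¹)⁻¹ = Q * (P⁻¹ * (g * P)) * Q⁻¹ by group, key]
  group

theorem trace_one_sub {p : Matrix (Fin 2) (Fin 2) E} (ht : p.trace = 1) : (1 - p).trace = 1 := by
  rw [Matrix.trace_sub, ht, Matrix.trace_one]
  norm_num

theorem det_one_sub {p : Matrix (Fin 2) (Fin 2) E} (ht : p.trace = 1) (hd : p.det = 0) :
    (1 - p).det = 0 := by
  obtain ⟨a, b, c, d, rfl⟩ := exists_entries p
  simp [Matrix.trace_fin_two, Matrix.det_fin_two] at ht hd ⊢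
  linear_combination hd - ht

theorem not_isScal_of_trace_det {p : Matrix (Fin 2) (Fin 2) E} (ht : p.trace = 1)
    (hd : p.det = 0) : ¬ IsScal p := by
  rintro ⟨c, rfl⟩
  simp at ht hd
  simp [hd] at ht

theorem mul_self_of_trace_det {p : Matrix (Fin 2) (Fin 2) E} (ht : p.trace = 1)
    (hd : p.det = 0) : p * p = p := by
  rw [mul_self_eq, ht, hd]
  simp

theorem mul_mul_eq_trace_smul {p : Matrix (Fin 2) (Fin 2) E} (hd : p.det = 0)
    (B : Matrix (Fin 2) (Fin 2) E) : p * B * p = (B * p).trace • p := by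
  obtain ⟨a, b, c, d, rfl⟩ := exists_entries p
  obtain ⟨q, r, s, t, rfl⟩ := exists_entries B
  simp [Matrix.det_fin_two] at hd
  ext i j
  fin_cases i <;> fin_cases j <;> simp [Matrix.trace_fin_two, Matrix.mul_apply, Fin.sum_univ_two]
  · linear_combination -t * hd
  · linear_combination r * hd
  · linear_combination s * hd
  · linear_combination -q * hd

theorem mul_eq_trace_smul {p B : Matrix (Fin 2) (Fin 2) E} (ht : p.trace = 1) (hd : p.det = 0)
    (h : B * p = p * B) : B * p = (B * p).trace • p := by
  rw [← mul_mul_eq_trace_smul hd, ← h, mul_assoc, mul_self_of_trace_det ht hd]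

/-- A matrix with distinct eigenvalues commutes with exactly two rank one projections. -/
theorem exists_projection [IsAlgClosed E] {A : Matrix (Fin 2) (Fin 2) E}
    (hA : A.trace ^ 2 ≠ 4 * A.det) :
    ∃ q : Matrix (Fin 2) (Fin 2) E, q.trace = 1 ∧ q.det = 0 ∧ A * q = q * A ∧
      ∀ p : Matrix (Fin 2) (Fin 2) E, p.trace = 1 → p.det = 0 → A * p = p * A →
        p = q ∨ p = 1 - q := by
  obtain ⟨β, hβ⟩ : ∃ β : E, β ^ 2 - A.trace * β + A.det = 0 := by
    have hdeg : (Polynomial.X ^ 2 - Polynomial.C A.trace * Polynomial.X +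
        Polynomial.C A.det).degree ≠ 0 := by
      have : (Polynomial.X ^ 2 - Polynomial.C A.trace * Polynomial.X +
        Polynomial.C A.det).degree = 2 := by compute_degree!
      rw [this]
      norm_num
    obtain ⟨β, hβ⟩ := IsAlgClosed.exists_root _ hdeg
    exact ⟨β, by simpa [Polynomial.IsRoot] using hβ⟩
  have hne : A.trace - 2 * β ≠ 0 := by
    intro h
    exact hA (by linear_combination (A.trace - 2 * β) * h - 4 * hβ)
  set δ := A.trace - 2 * β with hδ
  have htq : (δ⁻¹ • (A - β • 1)).trace = 1 := by
    simp [Matrix.trace_smul, Matrix.trace_sub]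
    field_simp
    rw [hδ]
    ring
  have hdq : (δ⁻¹ • (A - β • 1)).det = 0 := by
    obtain ⟨a, b, c, d, rfl⟩ := exists_entries A
    simp [Matrix.trace_fin_two, Matrix.det_fin_two] at hβ ⊢
    right
    linear_combination hβ
  refine ⟨_, htq, hdq, by simp [mul_sub, sub_mul], ?_⟩
  set q := δ⁻¹ • (A - β • 1) with hq
  intro p hp hpd hpA
  have hqp : q * p = p * q := by simp [hq, mul_sub, sub_mul, hpA]
  obtain ⟨a, b, rfl⟩ := exists_eq_add_smul_of_commute (not_isScal_of_trace_det htq hdq) hqp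
  have h1 : 2 * a + b = 1 := by
    simpa [Matrix.trace_add, Matrix.trace_smul, htq, mul_comm] using hp
  have h2 : a * (a + b) = 0 := by
    obtain ⟨x, y, z, w, hxyz⟩ := exists_entries q
    rw [hxyz] at htq hdq hpd
    simp [Matrix.trace_fin_two, Matrix.det_fin_two] at htq hdq hpd
    linear_combination hpd - a * b * htq - b ^ 2 * hdq
  rcases mul_eq_zero.1 h2 with h | h
  · left
    simp [h] at h1 ⊢
    simp [h1]
  · right
    have ha : a = 1 := by linear_combination h1 - h
    have hb : b = -1 := by linear_combination h - ha
    simp [ha, hb, sub_eq_add_neg]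

theorem ne_one_sub {q : Matrix (Fin 2) (Fin 2) E} (ht : q.trace = 1) (hd : q.det = 0) :
    q ≠ 1 - q := by
  intro h
  have h2 : q * q = q * (1 - q) := by rw [← h]
  rw [mul_sub, mul_self_of_trace_det ht hd, mul_one, sub_self] at h2
  simp [h2] at ht

theorem exists_smul_of_traceless {A B : Matrix (Fin 2) (Fin 2) E} (hA : A.trace ^ 2 ≠ 4 * A.det)
    (hs : ¬ IsScal A) (hA0 : A.trace = 0) (hB0 : B.trace = 0) (h : A * B = B * A) :
    ∃ c : E, B = c • A := by
  obtain ⟨a, b, rfl⟩ := exists_eq_add_smul_of_commute hs h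
  have h2 : (2 : E) ≠ 0 := by
    intro h2
    exact hA (by rw [hA0]; linear_combination -2 * A.det * h2)
  have ha : a = 0 := by
    simpa [Matrix.trace_add, Matrix.trace_smul, hA0, h2] using hB0
  exact ⟨b, by simp [ha]⟩

theorem commute_of_traceless_orthogonal {x x' y y' : Matrix (Fin 2) (Fin 2) E}
    (hx : x * x' ≠ x' * x) (hy : y.trace = 0) (hy' : y'.trace = 0) (h1 : (x * y).trace = 0)
    (h2 : (x * y').trace = 0) (h3 : (x' * y).trace = 0) (h4 : (x' * y').trace = 0) :
    y * y' = y' * y := by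
  obtain ⟨a, b, c, d, rfl⟩ := exists_entries x
  obtain ⟨a', b', c', d', rfl⟩ := exists_entries x'
  obtain ⟨p, q, r, s, rfl⟩ := exists_entries y
  obtain ⟨p', q', r', s', rfl⟩ := exists_entries y'
  simp [Matrix.trace_fin_two] at hy hy' h1 h2 h3 h4
  obtain rfl : s = -p := by linear_combination hy
  obtain rfl : s' = -p' := by linear_combination hy'
  by_contra hne
  apply hx
  have hw : q * r' - r * q' ≠ 0 ∨ p * q' - q * p' ≠ 0 ∨ r * p' - p * r' ≠ 0 := by
    by_contra! hcon
    obtain ⟨e1, e2, e3⟩ := hcon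
    apply hne
    ext i j
    fin_cases i <;> fin_cases j <;> simp [Matrix.mul_apply, Fin.sum_univ_two]
    · linear_combination e1
    · linear_combination 2 * e2
    · linear_combination 2 * e3
    · linear_combination -e1
  have hz : b * c' - c * b' = 0 ∧ (a - d) * b' - b * (a' - d') = 0 ∧
      c * (a' - d') - (a - d) * c' = 0 := by
    have k : ∀ u v : E, u ≠ 0 → u * v = 0 → v = 0 := fun u v hu huv =>
      (mul_eq_zero.1 huv).resolve_left hu
    rcases hw with hw | hw | hw
    · refine ⟨k _ _ hw ?_, k _ _ hw ?_, k _ _ hw ?_⟩ <;> grind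
    · refine ⟨k _ _ hw ?_, k _ _ hw ?_, k _ _ hw ?_⟩ <;> grind
    · refine ⟨k _ _ hw ?_, k _ _ hw ?_, k _ _ hw ?_⟩ <;> grind
  obtain ⟨e1, e2, e3⟩ := hz
  ext i j
  fin_cases i <;> fin_cases j <;> simp [Matrix.mul_apply, Fin.sum_univ_two]
  · linear_combination e1
  · linear_combination e2
  · linear_combination e3
  · linear_combination -e1

theorem mul_add_mul_eq (A B : Matrix (Fin 2) (Fin 2) E) :
    A * B + B * A = A.trace • B + B.trace • A + ((A * B).trace - A.trace * B.trace) • 1 := by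
  obtain ⟨a, b, c, d, rfl⟩ := exists_entries A
  obtain ⟨p, q, r, s, rfl⟩ := exists_entries B
  ext i j
  fin_cases i <;> fin_cases j <;>
    simp [Matrix.trace_fin_two] <;> ring

/-- An element that normalizes, but does not centralize, the torus of `x` is antidiagonal with
respect to it. -/
theorem trace_eq_zero_of_normalizes {x x' B : Matrix (Fin 2) (Fin 2) E}
    (hx : x.trace ^ 2 ≠ 4 * x.det) (hs : ¬ IsScal x) (hB : B * x = x' * B)
    (hc : x * x' = x' * x) (ht : x'.trace = x.trace) (hd : x'.det = x.det)
    (hne : B * x ≠ x * B) : B.trace = 0 ∧ (x * B).trace = 0 := by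
  have hx' : x' = x.trace • 1 - x := by
    obtain ⟨a, b, rfl⟩ := exists_eq_add_smul_of_commute hs hc
    have h1 : 2 * a + b * x.trace = x.trace := by
      simpa [Matrix.trace_add, Matrix.trace_smul, mul_comm] using ht
    have h2 : a ^ 2 + a * b * x.trace + b ^ 2 * x.det = x.det := by
      refine Eq.trans ?_ hd
      obtain ⟨p, q, r, s, rfl⟩ := exists_entries x
      simp [Matrix.trace_fin_two, Matrix.det_fin_two]
      ring
    have hab : ¬ (a = 0 ∧ b = 1) := by
      rintro ⟨rfl, rfl⟩
      exact hne (by simpa using hB)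
    have h3 : (1 - b) * (1 + b) * (x.trace ^ 2 - 4 * x.det) = 0 := by
      linear_combination 4 * h2 - (2 * a + b * x.trace + x.trace) * h1
    have h4 := (mul_eq_zero.1 h3).resolve_right (sub_ne_zero.2 hx)
    have : a = x.trace ∧ b = -1 := by
      rcases mul_eq_zero.1 h4 with h | h
      · obtain rfl : b = 1 := by linear_combination -h
        have h5 : a * (a + x.trace) = 0 := by linear_combination h2
        have h6 := (mul_eq_zero.1 h5).resolve_left fun h => hab ⟨h, rfl⟩
        have h7 : (2 : E) * a = 0 := by linear_combination h1
        have h8 := (mul_eq_zero.1 h7).resolve_right fun h => hab ⟨h, rfl⟩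
        exact ⟨by linear_combination h6 - x.trace * h8, by linear_combination h8⟩
      · obtain rfl : b = -1 := by linear_combination h
        have h5 : a * (a - x.trace) = 0 := by linear_combination h2
        rcases mul_eq_zero.1 h5 with h6 | h6
        · subst h6
          have h7 : (2 : E) * x.trace = 0 := by linear_combination -h1
          rcases mul_eq_zero.1 h7 with h8 | h8
          · exact absurd ⟨rfl, by linear_combination -h8⟩ hab
          · exact ⟨h8.symm, rfl⟩
        · exact ⟨by linear_combination h6, rfl⟩
    rw [this.1, this.2]
    simp [sub_eq_add_neg]
  have h1 := mul_add_mul_eq B x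
  have h2 : B * x + x * B = x.trace • B := by
    rw [hB, hx', sub_mul, smul_mul_assoc, one_mul, sub_add_cancel]
  rw [h2] at h1
  generalize ht : (B * x).trace - B.trace * x.trace = t at h1
  have h3 : B.trace • x = (-t) • (1 : Matrix _ _ E) := by
    rw [neg_smul, eq_neg_iff_add_eq_zero]
    rw [add_assoc, add_comm (x.trace • B), ← add_assoc, eq_comm, add_eq_right] at h1
    exact h1
  have hB0 : B.trace = 0 := by
    by_contra hB0
    exact hs ⟨(B.trace)⁻¹ * (-t), by rw [← smul_smul, ← h3, inv_smul_smul₀ hB0]⟩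
  refine ⟨hB0, ?_⟩
  rw [hB0, zero_smul, eq_comm, smul_eq_zero, neg_eq_zero] at h3
  rw [Matrix.trace_mul_comm]
  simpa [hB0, h3.resolve_right one_ne_zero] using ht

theorem trace_eq_zero_of_isScal_sq {A : Matrix (Fin 2) (Fin 2) E} (hs : ¬ IsScal A)
    (h : IsScal (A ^ 2)) : A.trace = 0 := by
  rw [isScal_iff] at *
  obtain ⟨a, b, c, d, rfl⟩ := exists_entries A
  simp [pow_two, Matrix.mul_apply, Fin.sum_univ_two, Matrix.trace_fin_two] at h hs ⊢
  grind

theorem isScal_sq {A : Matrix (Fin 2) (Fin 2) E} (h : A.trace = 0) : IsScal (A ^ 2) :=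
  ⟨-A.det, by rw [pow_two, mul_self_eq, h]; simp⟩

theorem isScal_smul_add_iff {A : Matrix (Fin 2) (Fin 2) E} (hs : ¬ IsScal A) {a b : E}
    (h : IsScal (a • A + b • 1)) : a = 0 := by
  rw [isScal_iff] at *
  by_contra ha
  exact hs (by simpa [ha] using h)

theorem trace_sq_of_isScal_cube {A : Matrix (Fin 2) (Fin 2) E} (hs : ¬ IsScal A)
    (h : IsScal (A ^ 3)) : A.trace ^ 2 = A.det := by
  have : A ^ 3 = (A.trace ^ 2 - A.det) • A + (-A.trace * A.det) • 1 := by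
    rw [pow_succ, pow_two, mul_self_eq A, sub_mul, smul_mul_assoc, mul_self_eq A]
    simp only [smul_mul_assoc, one_mul]
    module
  rw [this] at h
  exact sub_eq_zero.1 (isScal_smul_add_iff hs h)

theorem trace_sq_of_isScal_pow_four {A : Matrix (Fin 2) (Fin 2) E} (hs : ¬ IsScal A)
    (h2 : ¬ IsScal (A ^ 2)) (h : IsScal (A ^ 4)) : A.trace ^ 2 = 2 * A.det := by
  have : A ^ 4 = (A.trace ^ 3 - 2 * A.trace * A.det) • A +
      (-A.trace ^ 2 * A.det + A.det ^ 2) • 1 := by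
    rw [show A ^ 4 = A * A * (A * A) by noncomm_ring, mul_self_eq A]
    simp only [sub_mul, mul_sub, smul_mul_assoc, mul_smul_comm, one_mul, mul_one]
    rw [mul_self_eq A]
    module
  rw [this] at h
  have h3 := isScal_smul_add_iff hs h
  have h4 : A.trace ≠ 0 := fun h => h2 (isScal_sq h)
  have h5 : A.trace * (A.trace ^ 2 - 2 * A.det) = 0 := by linear_combination h3
  exact sub_eq_zero.1 ((mul_eq_zero.1 h5).resolve_left h4)

theorem trace_pow_four_of_isScal_pow_five {A : Matrix (Fin 2) (Fin 2) E} (hs : ¬ IsScal A)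
    (h : IsScal (A ^ 5)) : A.trace ^ 4 = 3 * A.trace ^ 2 * A.det - A.det ^ 2 := by
  have : A ^ 5 = (A.trace ^ 4 - 3 * A.trace ^ 2 * A.det + A.det ^ 2) • A +
      (-A.trace ^ 3 * A.det + 2 * A.trace * A.det ^ 2) • 1 := by
    rw [show A ^ 5 = A * A * (A * A) * A by noncomm_ring, mul_self_eq A]
    simp only [sub_mul, mul_sub, smul_mul_assoc, mul_smul_comm, one_mul, mul_one]
    rw [mul_self_eq A]
    simp only [sub_mul, smul_mul_assoc, one_mul, smul_sub]
    rw [mul_self_eq A]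
    module
  rw [this] at h
  linear_combination isScal_smul_add_iff hs h

theorem trace_mul_conj_mul {y : Matrix (Fin 2) (Fin 2) E} (hy : y.trace = 0)
    (z : Matrix (Fin 2) (Fin 2) E) :
    (y * (z * y * (z.trace • 1 - z))).trace =
      -y.det * (z.trace ^ 2 - 2 * z.det) - (z * y).trace ^ 2 := by
  obtain ⟨p, q, r, s, rfl⟩ := exists_entries y
  obtain ⟨a, b, c, d, rfl⟩ := exists_entries z
  simp [Matrix.trace_fin_two] at hy
  obtain rfl : s = -p := by linear_combination hy
  have : (!![a, b; c, d] : Matrix (Fin 2) (Fin 2) E).trace • 1 - !![a, b; c, d] =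
      !![d, -b; -c, a] := by
    ext i j
    fin_cases i <;> fin_cases j <;> simp [Matrix.trace_fin_two]
  rw [this]
  simp [Matrix.trace_fin_two, Matrix.det_fin_two]
  ring

theorem coe_inv_eq (g : GL (Fin 2) E) : ((g⁻¹ : GL (Fin 2) E) : Matrix (Fin 2) (Fin 2) E) =
    (g : Matrix (Fin 2) (Fin 2) E).det⁻¹ •
      ((g : Matrix (Fin 2) (Fin 2) E).trace • 1 - (g : Matrix (Fin 2) (Fin 2) E)) := by
  rw [Matrix.coe_units_inv, Matrix.inv_def, Ring.inverse_eq_inv']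
  congr 1
  rw [Matrix.adjugate_fin_two]
  ext i j
  fin_cases i <;> fin_cases j <;> simp [Matrix.trace_fin_two]

theorem det_ne_zero (g : GL (Fin 2) E) : (g : Matrix (Fin 2) (Fin 2) E).det ≠ 0 :=
  ((Matrix.isUnit_iff_isUnit_det _).1 g.isUnit).ne_zero

theorem trace_conj (g h : GL (Fin 2) E) :
    ((g * h * g⁻¹ : GL (Fin 2) E) : Matrix (Fin 2) (Fin 2) E).trace =
      (h : Matrix (Fin 2) (Fin 2) E).trace := by
  rw [Units.val_mul, Units.val_mul, Matrix.trace_mul_comm, ← mul_assoc, Units.inv_mul, one_mul]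

theorem det_conj (g h : GL (Fin 2) E) :
    ((g * h * g⁻¹ : GL (Fin 2) E) : Matrix (Fin 2) (Fin 2) E).det =
      (h : Matrix (Fin 2) (Fin 2) E).det := by
  rw [Units.val_mul, Units.val_mul, Matrix.det_mul, Matrix.det_mul, mul_comm, ← mul_assoc,
    ← Matrix.det_mul]
  simp

end TwoByTwo

section ProjectiveOrder

variable {E : Type*} [Field E]

/-- The order of the image of `g` in the projective linear group. -/
noncomputable def projOrder (g : GL (Fin 2) E) : ℕ :=
  orderOf (g : GL (Fin 2) E ⧸ Subgroup.center (GL (Fin 2) E))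

theorem isScal_pow_iff {g : GL (Fin 2) E} {k : ℕ} :
    IsScal ((g : Matrix (Fin 2) (Fin 2) E) ^ k) ↔ projOrder g ∣ k := by
  rw [projOrder, orderOf_dvd_iff_pow_eq_one, ← QuotientGroup.mk_pow, QuotientGroup.eq_one_iff,
    mem_center_iff_isScal, Units.val_pow_eq_pow_val]

theorem isScal_iff_projOrder_eq_one {g : GL (Fin 2) E} :
    IsScal (g : Matrix (Fin 2) (Fin 2) E) ↔ projOrder g = 1 := by
  rw [← Nat.dvd_one, ← isScal_pow_iff, pow_one]

theorem projOrder_eq_of_isConj {g h : GL (Fin 2) E} (hgh : IsConj g h) :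
    projOrder g = projOrder h := by
  obtain ⟨c, rfl⟩ := isConj_iff.1 hgh
  refine Nat.dvd_right_iff_eq.1 fun k => ?_
  simp only [projOrder, orderOf_dvd_iff_pow_eq_one, ← QuotientGroup.mk_pow,
    QuotientGroup.eq_one_iff, conj_pow]
  exact ⟨fun h => (inferInstance : (Subgroup.center (GL (Fin 2) E)).Normal).conj_mem _ h c,
    fun h => by simpa [mul_assoc] using
      (inferInstance : (Subgroup.center (GL (Fin 2) E)).Normal).conj_mem _ h c⁻¹⟩

theorem IsScal.mul_comm {A : Matrix (Fin 2) (Fin 2) E} (hA : IsScal A)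
    (B : Matrix (Fin 2) (Fin 2) E) : A * B = B * A := by
  obtain ⟨c, rfl⟩ := hA
  simp

end ProjectiveOrder

section Points

variable {E : Type*} [Field E] (G : Subgroup (GL (Fin 2) E))

/-- The scalar elements of `G`. -/
def scalars : Subgroup G := (Subgroup.center (GL (Fin 2) E)).subgroupOf G

/-- The rank one projections commuting with some non-scalar element of `G`. -/
@[ext]
structure Points where
  /-- The underlying matrix. -/
  val : Matrix (Fin 2) (Fin 2) E
  trace_val : val.trace = 1
  det_val : val.det = 0
  exists_commute : ∃ g ∈ G, ¬ IsScal (g : Matrix (Fin 2) (Fin 2) E) ∧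
    (g : Matrix (Fin 2) (Fin 2) E) * val = val * (g : Matrix (Fin 2) (Fin 2) E)

variable {G}

theorem mem_scalars {g : G} :
    g ∈ scalars G ↔ IsScal ((g : GL (Fin 2) E) : Matrix (Fin 2) (Fin 2) E) := by
  rw [scalars, Subgroup.mem_subgroupOf, mem_center_iff_isScal]

theorem conj_mul_conj (g : GL (Fin 2) E) (A B : Matrix (Fin 2) (Fin 2) E) :
    (g : Matrix (Fin 2) (Fin 2) E) * A * (g⁻¹ : GL (Fin 2) E) * (g * B * (g⁻¹ : GL (Fin 2) E)) =
      g * (A * B) * (g⁻¹ : GL (Fin 2) E) := by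
  simp only [mul_assoc, Units.inv_mul_cancel_left]

theorem isScal_conj_iff {g : GL (Fin 2) E} {h : GL (Fin 2) E} :
    IsScal ((g * h * g⁻¹ : GL (Fin 2) E) : Matrix (Fin 2) (Fin 2) E) ↔
      IsScal (h : Matrix (Fin 2) (Fin 2) E) := by
  rw [isScal_iff_projOrder_eq_one, isScal_iff_projOrder_eq_one,
    ← projOrder_eq_of_isConj (isConj_iff.2 ⟨g, rfl⟩ : IsConj h _)]

instance : MulAction G (Points G) where
  smul g p :=
    { val := (g : GL (Fin 2) E) * p.val * ((g : GL (Fin 2) E)⁻¹ : GL (Fin 2) E)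
      trace_val := by
        rw [Matrix.trace_mul_comm, ← mul_assoc, Units.inv_mul, one_mul, p.trace_val]
      det_val := by
        rw [Matrix.det_mul, Matrix.det_mul, p.det_val]
        simp
      exists_commute := by
        obtain ⟨h, hG, hs, hc⟩ := p.exists_commute
        refine ⟨(g : GL (Fin 2) E) * h * (g : GL (Fin 2) E)⁻¹,
          G.mul_mem (G.mul_mem g.2 hG) (G.inv_mem g.2), fun h => hs (isScal_conj_iff.1 h), ?_⟩
        rw [Units.val_mul, Units.val_mul, conj_mul_conj, conj_mul_conj, hc] }
  one_smul p := Points.ext (by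
    change ((1 : GL (Fin 2) E) : Matrix (Fin 2) (Fin 2) E) * p.val * ((1 : GL (Fin 2) E)⁻¹ : GL (Fin 2) E)
        = p.val
    simp)
  mul_smul g h p := Points.ext (by
    change ((g * h : GL (Fin 2) E) : Matrix (Fin 2) (Fin 2) E) * p.val *
      ((g * h : GL (Fin 2) E)⁻¹ : GL (Fin 2) E) = (g : GL (Fin 2) E) * ((h : GL (Fin 2) E) * p.val *
        ((h : GL (Fin 2) E)⁻¹ : GL (Fin 2) E)) * ((g : GL (Fin 2) E)⁻¹ : GL (Fin 2) E)
    rw [_root_.mul_inv_rev, Units.val_mul, Units.val_mul]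
    simp only [mul_assoc])

theorem smul_val (g : G) (p : Points G) :
    (g • p).val = (g : GL (Fin 2) E) * p.val * ((g : GL (Fin 2) E)⁻¹ : GL (Fin 2) E) := rfl

theorem smul_eq_iff {g : G} {p q : Points G} : g • p = q ↔
    ((g : GL (Fin 2) E) : Matrix (Fin 2) (Fin 2) E) * p.val = q.val * (g : GL (Fin 2) E) := by
  rw [Points.ext_iff, smul_val]
  constructor
  · intro h
    rw [← h]
    simp [mul_assoc]
  · intro h
    rw [h]
    simp [mul_assoc]

theorem mem_stabilizer_iff {g : G} {p : Points G} : g ∈ MulAction.stabilizer G p ↔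
    ((g : GL (Fin 2) E) : Matrix (Fin 2) (Fin 2) E) * p.val = p.val * (g : GL (Fin 2) E) := by
  rw [MulAction.mem_stabilizer_iff, smul_eq_iff]

/-- The complementary projection. -/
def Points.compl (p : Points G) : Points G := ⟨1 - p.val, trace_one_sub p.trace_val,
  det_one_sub p.trace_val p.det_val, by
    obtain ⟨g, hg, hs, hc⟩ := p.exists_commute
    exact ⟨g, hg, hs, by rw [mul_sub, sub_mul, hc]; simp⟩⟩

theorem Points.compl_ne (p : Points G) : p.compl ≠ p := fun h =>
  ne_one_sub p.trace_val p.det_val (congrArg Points.val h).symm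

theorem stabilizer_points_compl (p : Points G) :
    MulAction.stabilizer G p.compl = MulAction.stabilizer G p := by
  ext g
  rw [mem_stabilizer_iff, mem_stabilizer_iff]
  simp [Points.compl, mul_sub, sub_mul]

/-- The eigenvalue of `g` on the image of `p`, divided by the one on the kernel of `p`. -/
noncomputable def eigenRatio (p : Points G) : MulAction.stabilizer G p →* E where
  toFun g := (((g : G) : GL (Fin 2) E) * p.val).trace /
      (((g : G) : GL (Fin 2) E) * (1 - p.val)).trace
  map_one' := by
    simp only [OneMemClass.coe_one, Units.val_one, one_mul, p.trace_val,
      trace_one_sub p.trace_val, div_one]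
  map_mul' g h := by
    have key : ∀ q : Points G, MulAction.stabilizer G q = MulAction.stabilizer G p →
        ((((g * h : MulAction.stabilizer G p) : G) : GL (Fin 2) E) * q.val).trace =
        (((g : G) : GL (Fin 2) E) * q.val).trace * (((h : G) : GL (Fin 2) E) * q.val).trace := by
      intro q hq
      have hh : (h : G) ∈ MulAction.stabilizer G q := by rw [hq]; exact h.2
      rw [Subgroup.coe_mul, Subgroup.coe_mul, Units.val_mul, mul_assoc,
        mul_eq_trace_smul q.trace_val q.det_val (mem_stabilizer_iff.1 hh)]
      rw [mul_smul_comm, Matrix.trace_smul, Matrix.trace_smul, q.trace_val, smul_eq_mul,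
          smul_eq_mul,
        mul_one, mul_comm]
    have h1 := key p rfl
    have h2 := key p.compl (stabilizer_points_compl p)
    simp only [Points.compl] at h2
    rw [h1, h2, mul_div_mul_comm]

theorem trace_mul_ne_zero {g : G} {p : Points G} (hg : g ∈ MulAction.stabilizer G p) :
    ((g : GL (Fin 2) E) * p.val).trace ≠ 0 := by
  intro h
  have h1 := mul_eq_trace_smul p.trace_val p.det_val (mem_stabilizer_iff.1 hg)
  rw [h, zero_smul] at h1
  have : p.val = 0 := by
    have := congrArg ((((g : GL (Fin 2) E)⁻¹ : GL (Fin 2) E) : Matrix (Fin 2) (Fin 2) E) * ·) h1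
    simpa [← mul_assoc] using this
  have h2 := p.trace_val
  rw [this] at h2
  simp at h2

theorem eigenRatio_eq_one_iff {p : Points G} {g : MulAction.stabilizer G p} :
    eigenRatio p g = 1 ↔ IsScal (((g : G) : GL (Fin 2) E) : Matrix (Fin 2) (Fin 2) E) := by
  have hc : (g : G) ∈ MulAction.stabilizer G p.compl := by
    rw [stabilizer_points_compl]
    exact g.2
  have h0 := trace_mul_ne_zero hc
  simp only [Points.compl] at h0
  change (((g : G) : GL (Fin 2) E) * p.val).trace /
      (((g : G) : GL (Fin 2) E) * (1 - p.val)).trace = 1 ↔ _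
  rw [div_eq_one_iff_eq h0]
  constructor
  · intro h
    refine ⟨(((g : G) : GL (Fin 2) E) * p.val).trace, ?_⟩
    have h1 := mul_eq_trace_smul p.trace_val p.det_val (mem_stabilizer_iff.1 g.2)
    have h2 := mul_eq_trace_smul p.compl.trace_val p.compl.det_val (mem_stabilizer_iff.1 hc)
    simp only [Points.compl] at h2
    rw [← h] at h2
    calc _ = (((g : G) : GL (Fin 2) E) : Matrix (Fin 2) (Fin 2) E) * p.val +
          (((g : G) : GL (Fin 2) E) : Matrix (Fin 2) (Fin 2) E) * (1 - p.val) := by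
            rw [mul_sub, mul_one]; abel
      _ = _ := by
        conv_lhs => rw [h1, h2]
        rw [← smul_add]; simp
  · rintro ⟨c, hc⟩
    rw [hc]
    simp only [smul_mul_assoc, one_mul, Matrix.trace_smul, p.trace_val, trace_one_sub p.trace_val]

theorem exists_stabilizer_generator [Finite G] (p : Points G) : ∃ x : G,
    x ∈ MulAction.stabilizer G p ∧ 2 ≤ projOrder (x : GL (Fin 2) E) ∧
    Nat.card (MulAction.stabilizer G p) =
      projOrder (x : GL (Fin 2) E) * Nat.card (scalars G) ∧
    ∀ g ∈ MulAction.stabilizer G p, ∃ k : ℕ, ∃ z ∈ scalars G, g = x ^ k * z := by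
  let χ := (eigenRatio p).toHomUnits
  have hker : ∀ g : MulAction.stabilizer G p, χ g = 1 ↔
      IsScal (((g : G) : GL (Fin 2) E) : Matrix (Fin 2) (Fin 2) E) := fun g => by
    rw [← eigenRatio_eq_one_iff, Units.ext_iff]
    rfl
  have : Finite χ.range := Finite.of_surjective _ χ.rangeRestrict_surjective
  obtain ⟨⟨_, x, rfl⟩, hx⟩ := IsCyclic.exists_generator (α := χ.range)
  have hpow : ∀ k : ℕ, χ x ^ k = 1 ↔ projOrder ((x : G) : GL (Fin 2) E) ∣ k := fun k => by
    rw [← map_pow, hker, ← isScal_pow_iff]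
    simp
  have hord : orderOf (χ x) = projOrder ((x : G) : GL (Fin 2) E) :=
    Nat.dvd_right_iff_eq.1 fun k => by rw [orderOf_dvd_iff_pow_eq_one, hpow]
  have hgen : ∀ g : MulAction.stabilizer G p, ∃ k : ℕ, χ g = χ x ^ k := fun g => by
    obtain ⟨k, hk⟩ := mem_powers_iff_mem_zpowers.2 (hx ⟨χ g, g, rfl⟩)
    exact ⟨k, (congrArg Subtype.val hk).symm⟩
  have hz : ∀ g : MulAction.stabilizer G p, ∃ k : ℕ, ∃ z ∈ scalars G,
      (g : G) = (x : G) ^ k * z := by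
    intro g
    obtain ⟨k, hk⟩ := hgen g
    refine ⟨k, ((x : G) ^ k)⁻¹ * g, ?_, by group⟩
    have : χ ((x ^ k)⁻¹ * g) = 1 := by rw [map_mul, map_inv, map_pow, hk, inv_mul_cancel]
    rw [mem_scalars]
    exact (hker _).1 this
  refine ⟨x, x.2, ?_, ?_, fun g hg => hz ⟨g, hg⟩⟩
  · have hpos : 0 < projOrder ((x : G) : GL (Fin 2) E) := 
      hord ▸ (MonoidHom.isOfFinOrder χ (isOfFinOrder_of_finite x)).orderOf_pos
    by_contra! h2
    have h1 : projOrder ((x : G) : GL (Fin 2) E) = 1 := by omega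
    obtain ⟨g, hg, hs, hc⟩ := p.exists_commute
    have hgm : (⟨g, hg⟩ : G) ∈ MulAction.stabilizer G p := mem_stabilizer_iff.2 hc
    obtain ⟨k, hk⟩ := hgen ⟨_, hgm⟩
    rw [(pow_eq_one_iff_modEq).2 ?_] at hk
    · exact hs ((hker _).1 hk)
    · rw [hord, h1]
      exact Nat.modEq_one
  · rw [← Subgroup.card_mul_index χ.ker, Subgroup.index_ker, mul_comm]
    congr 1
    · rw [← hord, ← Nat.card_zpowers]
      refine Nat.card_congr (Equiv.setCongr ?_)
      ext u
      constructor
      · rintro ⟨g, rfl⟩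
        obtain ⟨k, hk⟩ := hgen g
        exact ⟨k, by simp [hk]⟩
      · rintro ⟨k, rfl⟩
        exact ⟨x ^ k, by simp⟩
    · refine Nat.card_congr ⟨fun g => ⟨g.1.1, mem_scalars.2 ((hker _).1 g.2)⟩, fun z =>
        ⟨⟨z.1, mem_stabilizer_iff.2 ((mem_scalars.1 z.2).mul_comm _)⟩,
          (hker _).2 (mem_scalars.1 z.2)⟩, fun g => rfl, fun z => rfl⟩

end Points

section Burnside

variable {E : Type*} [Field E]

/-- Every element of `G` with a double eigenvalue is scalar. -/
def IsSemisimpleGroup (G : Subgroup (GL (Fin 2) E)) : Prop :=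
  ∀ g ∈ G, (g : Matrix (Fin 2) (Fin 2) E).trace ^ 2 = 4 * (g : Matrix (Fin 2) (Fin 2) E).det →
    IsScal (g : Matrix (Fin 2) (Fin 2) E)

variable {G : Subgroup (GL (Fin 2) E)}

theorem exists_point [IsAlgClosed E] (hG : IsSemisimpleGroup G) {g : G} (hg : g ∉ scalars G) :
    ∃ p : Points G, ∀ q : Points G, g ∈ MulAction.stabilizer G q ↔ q = p ∨ q = p.compl := by
  rw [mem_scalars] at hg
  obtain ⟨p, ht, hd, hc, h⟩ := exists_projection fun h => hg (hG g g.2 h)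
  refine ⟨⟨p, ht, hd, g, g.2, hg, hc⟩, fun q => ?_⟩
  rw [mem_stabilizer_iff, Points.ext_iff, Points.ext_iff]
  refine ⟨h q.val q.trace_val q.det_val, ?_⟩
  rintro (h | h)
  · rw [h]
    exact hc
  · rw [h]
    simp [Points.compl, mul_sub, sub_mul, hc]

theorem finite_points [IsAlgClosed E] [Finite G] (hG : IsSemisimpleGroup G) :
    Finite (Points G) := by
  choose f hf using fun g : {g : G // g ∉ scalars G} => exists_point hG g.2
  refine Finite.of_surjective (fun x : {g : G // g ∉ scalars G} × Bool =>
    if x.2 then f x.1 else (f x.1).compl) fun q => ?_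
  obtain ⟨g, hg, hs, hc⟩ := q.exists_commute
  have hs' : (⟨g, hg⟩ : G) ∉ scalars G := fun h => hs (mem_scalars.1 h)
  rcases (hf ⟨_, hs'⟩ q).1 (mem_stabilizer_iff.2 hc) with h | h
  · exact ⟨⟨⟨_, hs'⟩, true⟩, h.symm⟩
  · exact ⟨⟨⟨_, hs'⟩, false⟩, h.symm⟩

/-- A generator, modulo scalars, of the stabilizer of a point. -/
noncomputable def Points.gen [Finite G] (p : Points G) : G := (exists_stabilizer_generator p).choose

/-- The order, modulo scalars, of the stabilizer of a point. -/
noncomputable def Points.ord [Finite G] (p : Points G) : ℕ := projOrder (p.gen : GL (Fin 2) E)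

theorem Points.gen_mem [Finite G] (p : Points G) : p.gen ∈ MulAction.stabilizer G p :=
  (exists_stabilizer_generator p).choose_spec.1

theorem Points.two_le_ord [Finite G] (p : Points G) : 2 ≤ p.ord :=
  (exists_stabilizer_generator p).choose_spec.2.1

theorem Points.card_stabilizer [Finite G] (p : Points G) :
    Nat.card (MulAction.stabilizer G p) = p.ord * Nat.card (scalars G) :=
  (exists_stabilizer_generator p).choose_spec.2.2.1

theorem Points.exists_eq_gen_pow_mul [Finite G] (p : Points G) {g : G}
    (hg : g ∈ MulAction.stabilizer G p) : ∃ k : ℕ, ∃ z ∈ scalars G, g = p.gen ^ k * z :=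
  (exists_stabilizer_generator p).choose_spec.2.2.2 g hg

theorem card_scalars_pos [Finite G] : 0 < Nat.card (scalars G) := Nat.card_pos

theorem Points.ord_eq_of_mem_orbit [Finite G] {p q : Points G} (h : p ∈ MulAction.orbit G q) :
    p.ord = q.ord := by
  refine Nat.eq_of_mul_eq_mul_right (card_scalars_pos (G := G)) ?_
  rw [← p.card_stabilizer, ← q.card_stabilizer]
  obtain ⟨g, rfl⟩ := h
  exact Nat.card_congr (MulAction.stabilizerEquivStabilizer rfl).symm.toEquiv

theorem card_orbit_mul_ord [Finite G] (p : Points G) :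
    Nat.card (MulAction.orbit G p) * p.ord = (scalars G).index := by
  refine Nat.eq_of_mul_eq_mul_right (card_scalars_pos (G := G)) ?_
  rw [mul_comm (scalars G).index, Subgroup.card_mul_index, mul_assoc, ← p.card_stabilizer,
    ← Nat.card_prod, Nat.card_congr (MulAction.orbitProdStabilizerEquivGroup G p)]

theorem projOrder_dvd_ord [Finite G] {p : Points G} {g : G} (hg : g ∈ MulAction.stabilizer G p) :
    projOrder (g : GL (Fin 2) E) ∣ p.ord := by
  obtain ⟨k, z, hz, rfl⟩ := p.exists_eq_gen_pow_mul hg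
  rw [projOrder, Points.ord, projOrder, orderOf_dvd_iff_pow_eq_one]
  have : ((z : GL (Fin 2) E) : GL (Fin 2) E ⧸ Subgroup.center (GL (Fin 2) E)) = 1 := by
    rw [QuotientGroup.eq_one_iff]
    exact hz
  simp only [Subgroup.coe_mul, Subgroup.coe_pow, QuotientGroup.mk_mul, this, mul_one,
    QuotientGroup.mk_pow]
  rw [← pow_mul, mul_comm, pow_mul, pow_orderOf_eq_one, one_pow]

theorem mem_stabilizer_of_commute {p : Points G} {g h : G} (hg : g ∈ MulAction.stabilizer G p)
    (hs : g ∉ scalars G) (hc : g * h = h * g) : h ∈ MulAction.stabilizer G p := by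
  rw [mem_scalars] at hs
  rw [mem_stabilizer_iff] at *
  exact commute_of_commute hs (congrArg (fun x : G => ((x : GL (Fin 2) E) : Matrix (Fin 2) (Fin 2) E)) hc)
      hg

theorem commute_of_mem_stabilizer {p : Points G} {g h : G} (hg : g ∈ MulAction.stabilizer G p)
    (hh : h ∈ MulAction.stabilizer G p) : g * h = h * g := by
  rw [mem_stabilizer_iff] at *
  exact Subtype.ext (Units.ext (commute_of_commute (not_isScal_of_trace_det p.trace_val p.det_val)
    hg.symm hh.symm))

theorem sum_orbits [IsAlgClosed E] [Finite G] (hG : IsSemisimpleGroup G)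
    [Fintype (MulAction.orbitRel.Quotient G (Points G))] :
    ∑ ω : MulAction.orbitRel.Quotient G (Points G), (1 - 1 / (ω.out.ord : ℚ)) =
      2 * (1 - 1 / ((scalars G).index : ℚ)) := by
  classical
  have := finite_points hG
  have := Fintype.ofFinite G
  have := Fintype.ofFinite (Points G)
  have hζ : (Nat.card (scalars G) : ℚ) ≠ 0 := by exact_mod_cast card_scalars_pos.ne'
  have hN : ((scalars G).index : ℚ) ≠ 0 := by exact_mod_cast Subgroup.index_ne_zero_of_finite
  have hcard : (Nat.card G : ℚ) = Nat.card (scalars G) * (scalars G).index := by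
    exact_mod_cast (Subgroup.card_mul_index (scalars G)).symm
  have h1 := MulAction.sum_card_fixedBy_eq_card_orbits_mul_card_group G (Points G)
  have h2 := MulAction.card_eq_sum_card_group_div_card_stabilizer G (Points G)
  have h3 : (Fintype.card (Points G) : ℚ) =
      ∑ ω : MulAction.orbitRel.Quotient G (Points G), (scalars G).index / (ω.out.ord : ℚ) := by
    rw [h2, Nat.cast_sum]
    refine Finset.sum_congr rfl fun ω _ => ?_
    rw [← Nat.card_eq_fintype_card, ← Nat.card_eq_fintype_card,
      Nat.cast_div (Subgroup.card_subgroup_dvd_card _) (by exact_mod_cast Nat.card_pos.ne'),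
      Points.card_stabilizer, hcard, Nat.cast_mul, mul_comm, mul_div_mul_right _ _ hζ]
  have h4 : ∀ g : G, (Fintype.card (MulAction.fixedBy (Points G) g) : ℚ) =
      2 + if g ∈ scalars G then (Fintype.card (Points G) : ℚ) - 2 else 0 := by
    intro g
    split_ifs with hg
    · rw [add_sub_cancel]
      congr 1
      refine Fintype.card_congr (Equiv.subtypeUnivEquiv fun p => ?_)
      exact mem_stabilizer_iff.2 ((mem_scalars.1 hg).mul_comm _)
    · obtain ⟨p, hp⟩ := exists_point hG hg
      have : MulAction.fixedBy (Points G) g = {p, p.compl} := by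
        ext q
        exact hp q
      rw [← Nat.card_eq_fintype_card, Nat.card_coe_set_eq, this, Set.ncard_pair p.compl_ne.symm]
      norm_num
  have h5 : (∑ g : G, (Fintype.card (MulAction.fixedBy (Points G) g) : ℚ)) =
      2 * Nat.card G + Nat.card (scalars G) * ((Fintype.card (Points G) : ℚ) - 2) := by
    simp_rw [h4, Finset.sum_add_distrib, Finset.sum_ite, Finset.sum_const]
    simp [Nat.card_eq_fintype_card, Fintype.card_subtype]
    ring
  have h6 : (∑ g : G, (Fintype.card (MulAction.fixedBy (Points G) g) : ℚ)) =
      Fintype.card (MulAction.orbitRel.Quotient G (Points G)) * Nat.card G := by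
    rw [Nat.card_eq_fintype_card]
    exact_mod_cast h1
  rw [h6, hcard, h3] at h5
  simp_rw [div_eq_mul_inv, ← Finset.mul_sum] at h5
  rw [Finset.sum_sub_distrib]
  simp only [Finset.sum_const, Finset.card_univ, nsmul_eq_mul, mul_one, one_div]
  generalize ∑ ω : MulAction.orbitRel.Quotient G (Points G), (ω.out.ord : ℚ)⁻¹ = S at h5 ⊢
  field_simp
  refine mul_left_cancel₀ hζ ?_
  linear_combination h5

end Burnside

section Trichotomy

theorem eq_of_sum_three {a b c N : ℕ} (ha : 2 ≤ a) (hab : a ≤ b) (hbc : b ≤ c) (hN : 0 < N)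
    (h : (1 - 1 / (a : ℚ)) + (1 - 1 / (b : ℚ)) + (1 - 1 / (c : ℚ)) = 2 * (1 - 1 / (N : ℚ))) :
    (a = 2 ∧ b = 2 ∧ N = 2 * c) ∨
      (a = 2 ∧ b = 3 ∧ (c = 3 ∨ c = 4 ∨ c = 5) ∧ N * (6 - c) = 12 * c) := by
  have hb : 0 < b := by omega
  have hc : 0 < c := by omega
  have ha0 : 0 < a := by omega
  have key : N * (a * b + b * c + a * c) = a * b * c * (N + 2) := by
    have ha' : (a : ℚ) ≠ 0 := by positivity
    have hb' : (b : ℚ) ≠ 0 := by positivity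
    have hc' : (c : ℚ) ≠ 0 := by positivity
    have hN' : (N : ℚ) ≠ 0 := by positivity
    field_simp at h
    have : (N : ℚ) * (a * b + b * c + a * c) = a * b * c * (N + 2) := by linear_combination -h
    exact_mod_cast this
  have h2 : a = 2 := by
    by_contra hne
    have h3 : 3 ≤ a := by omega
    have e1 : a * b ≤ b * c := by nlinarith
    have e2 : a * c ≤ b * c := by nlinarith
    have e3 : 3 * (b * c) ≤ a * (b * c) := Nat.mul_le_mul_right _ h3
    have e4 : N * (a * b + b * c + a * c) ≤ N * (a * (b * c)) := Nat.mul_le_mul_left _ (by omega)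
    have e5 : 0 < a * b * c := by positivity
    nlinarith
  subst h2
  have hb4 : b < 4 := by
    by_contra! h4
    have e1 : 2 * b + 2 * c ≤ b * c := by nlinarith
    have e2 : N * (2 * b + 2 * c) ≤ N * (b * c) := Nat.mul_le_mul_left _ e1
    have e3 : 0 < b * c := by positivity
    nlinarith
  have : b = 2 ∨ b = 3 := by omega
  rcases this with rfl | rfl
  · left
    refine ⟨rfl, rfl, ?_⟩
    nlinarith
  · right
    have hc6 : c < 6 := by
      by_contra! h6
      nlinarith
    have : c = 3 ∨ c = 4 ∨ c = 5 := by omega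
    refine ⟨rfl, rfl, this, ?_⟩
    rcases this with rfl | rfl | rfl <;> omega

variable {E : Type*} [Field E] {G : Subgroup (GL (Fin 2) E)}

/-- The possible orbit structures of a finite semisimple group on its points. -/
theorem orbit_trichotomy [IsAlgClosed E] [Finite G] (hG : IsSemisimpleGroup G) :
    (∀ g : G, g ∈ scalars G) ∨ (∃ p : Points G, p.ord = (scalars G).index) ∨
    ∃ p₁ p₂ p₃ : Points G, (∀ p : Points G, p ∈ MulAction.orbit G p₁ ∨ p ∈ MulAction.orbit G p₂ ∨
        p ∈ MulAction.orbit G p₃) ∧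
      ((p₁.ord = 2 ∧ p₂.ord = 2 ∧ (scalars G).index = 2 * p₃.ord) ∨
        (p₁.ord = 2 ∧ p₂.ord = 3 ∧ (p₃.ord = 3 ∨ p₃.ord = 4 ∨ p₃.ord = 5) ∧
          (scalars G).index * (6 - p₃.ord) = 12 * p₃.ord)) := by
  classical
  have := finite_points hG
  have := Fintype.ofFinite (MulAction.orbitRel.Quotient G (Points G))
  have hsum := sum_orbits hG
  set N := (scalars G).index with hNdef
  have hN0 : 0 < N := Nat.pos_of_ne_zero Subgroup.index_ne_zero_of_finite
  rcases Nat.lt_or_ge 1 N with hN | hN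
  swap
  · left
    have h1 : N = 1 := by omega
    rw [hNdef, Subgroup.index_eq_one] at h1
    intro g
    rw [h1]
    trivial
  right
  have hNq : (2 : ℚ) ≤ N := by exact_mod_cast hN
  have hlo : ∀ p : Points G, (1 / 2 : ℚ) ≤ 1 - 1 / (p.ord : ℚ) := fun p => by
    have h2 : (2 : ℚ) ≤ p.ord := by exact_mod_cast p.two_le_ord
    have : 1 / (p.ord : ℚ) ≤ 1 / 2 := one_div_le_one_div_of_le (by norm_num) h2
    linarith
  have hhi : ∀ p : Points G, 1 - 1 / (p.ord : ℚ) < 1 := fun p => by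
    have h2 : (0 : ℚ) < p.ord := by exact_mod_cast (zero_lt_two.trans_le p.two_le_ord)
    have : 0 < 1 / (p.ord : ℚ) := by positivity
    linarith
  have hNinv : 0 < 1 / (N : ℚ) ∧ 1 / (N : ℚ) ≤ 1 / 2 :=
    ⟨by positivity, one_div_le_one_div_of_le (by norm_num) hNq⟩
  have hle : ∀ p : Points G, p.ord ≤ N := fun p =>
    Nat.le_of_dvd hN0 (Dvd.intro_left _ (card_orbit_mul_ord p))
  obtain ⟨k, ⟨e⟩⟩ : ∃ k, Nonempty (MulAction.orbitRel.Quotient G (Points G) ≃ Fin k) :=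
    ⟨_, ⟨Fintype.equivFin _⟩⟩
  have hcov : ∀ p : Points G, ∃ i, p ∈ MulAction.orbit G (e.symm i).out := fun p => by
    let := MulAction.orbitRel G (Points G)
    refine ⟨e (Quotient.mk'' p), ?_⟩
    rw [e.symm_apply_apply]
    exact (MulAction.orbitRel_apply).1 (Setoid.symm (Quotient.mk_out p))
  rw [← e.symm.sum_comp] at hsum
  have hk4 : k < 4 := by
    have h1 : ∑ i : Fin k, (1 / 2 : ℚ) ≤ ∑ i : Fin k, (1 - 1 / ((e.symm i).out.ord : ℚ)) :=
      Finset.sum_le_sum fun i _ => hlo _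
    rw [hsum] at h1
    simp at h1
    have : (k : ℚ) < 4 := by
      have := hNinv.1
      rw [one_div] at this
      linarith
    exact_mod_cast this
  interval_cases k
  · simp at hsum
    have := hNinv.2
    rw [one_div] at this
    linarith
  · rw [Fin.sum_univ_one] at hsum
    have := hhi (e.symm 0).out
    linarith [hNinv.2]
  · left
    rw [Fin.sum_univ_two] at hsum
    refine ⟨(e.symm 0).out, (hle _).antisymm ?_⟩
    have h1 : ∀ p : Points G, 1 / (N : ℚ) ≤ 1 / p.ord := fun p =>
      one_div_le_one_div_of_le (by exact_mod_cast (zero_lt_two.trans_le p.two_le_ord))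
        (by exact_mod_cast hle p)
    have h2 : 1 / ((e.symm 0).out.ord : ℚ) ≤ 1 / N := by linarith [h1 (e.symm 1).out]
    rw [one_div_le_one_div (by exact_mod_cast (zero_lt_two.trans_le (Points.two_le_ord _)))
      (by linarith)] at h2
    exact_mod_cast h2
  · right
    rw [Fin.sum_univ_three] at hsum
    have hcov' : ∀ p : Points G, p ∈ MulAction.orbit G (e.symm 0).out ∨
        p ∈ MulAction.orbit G (e.symm 1).out ∨ p ∈ MulAction.orbit G (e.symm 2).out := fun p => by
      obtain ⟨i, hi⟩ := hcov p
      fin_cases i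
      · exact Or.inl hi
      · exact Or.inr (Or.inl hi)
      · exact Or.inr (Or.inr hi)
    generalize (e.symm 0).out = a at *
    generalize (e.symm 1).out = b at *
    generalize (e.symm 2).out = c at *
    clear hlo hhi hle hNinv
    rcases le_total a.ord b.ord with h1 | h1 <;> rcases le_total b.ord c.ord with h2 | h2 <;>
      rcases le_total a.ord c.ord with h3 | h3
    · exact ⟨a, b, c, hcov', eq_of_sum_three a.two_le_ord h1 h2 hN0 hsum⟩
    · exact ⟨a, b, c, hcov', eq_of_sum_three a.two_le_ord h1 h2 hN0 hsum⟩
    · exact ⟨a, c, b, fun p => by rcases hcov' p with h | h | h <;> simp [h],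
        eq_of_sum_three a.two_le_ord h3 h2 hN0 (by rw [← hsum]; ring)⟩
    · exact ⟨c, a, b, fun p => by rcases hcov' p with h | h | h <;> simp [h],
        eq_of_sum_three c.two_le_ord h3 h1 hN0 (by rw [← hsum]; ring)⟩
    · exact ⟨b, a, c, fun p => by rcases hcov' p with h | h | h <;> simp [h],
        eq_of_sum_three b.two_le_ord h1 h3 hN0 (by rw [← hsum]; ring)⟩
    · exact ⟨b, c, a, fun p => by rcases hcov' p with h | h | h <;> simp [h],
        eq_of_sum_three b.two_le_ord h2 h3 hN0 (by rw [← hsum]; ring)⟩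
    · exact ⟨c, b, a, fun p => by rcases hcov' p with h | h | h <;> simp [h],
        eq_of_sum_three c.two_le_ord h2 h1 hN0 (by rw [← hsum]; ring)⟩
    · exact ⟨c, b, a, fun p => by rcases hcov' p with h | h | h <;> simp [h],
        eq_of_sum_three c.two_le_ord h2 h1 hN0 (by rw [← hsum]; ring)⟩

end Trichotomy

section Types

variable {E : Type*} [Field E]

/-- The number of traceless elements of `G`. -/
noncomputable def tracelessCard (G : Subgroup (GL (Fin 2) E)) : ℕ :=
  Nat.card {g : G // g.1.val.trace = 0}

/-- `G` is generated by a single element and scalars. -/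
def IsCyclicType (G : Subgroup (GL (Fin 2) E)) : Prop :=
  ∃ x ∈ G, ∀ g ∈ G, ∃ k : ℕ, ∃ z ∈ G, IsScal z.val ∧ g = x ^ k * z

/-- The image of `G` in the projective linear group is dihedral of order `2 * n`. -/
structure IsDihedralType (G : Subgroup (GL (Fin 2) E)) (n : ℕ) : Prop where
  two_le : 2 ≤ n
  card_eq : Nat.card G = 2 * n * Nat.card (scalars G)
  exists_gen : ∃ x ∈ G, projOrder x = n ∧
    ∀ g ∈ G, x * g = g * x → ∃ k : ℕ, ∃ z ∈ G, IsScal z.val ∧ g = x ^ k * z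
  projOrder_eq : ∀ g ∈ G, projOrder g = 2 ∨ projOrder g ∣ n
  trace_eq_zero : ∀ x ∈ G, 3 ≤ projOrder x → ∀ y ∈ G, x * y ≠ y * x →
    y.val.trace = 0 ∧ (x.val * y.val).trace = 0
  le_tracelessCard : n * Nat.card (scalars G) ≤ tracelessCard G
  three_mul_le_tracelessCard : n = 2 → 3 * Nat.card (scalars G) ≤ tracelessCard G

/-- The image of `G` in the projective linear group is tetrahedral, octahedral or icosahedral,
for `m = 3, 4, 5`. -/
structure IsExceptionalType (G : Subgroup (GL (Fin 2) E)) (m : ℕ) : Prop where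
  eq_or : m = 3 ∨ m = 4 ∨ m = 5
  card_eq : Nat.card G * (6 - m) = 12 * m * Nat.card (scalars G)
  projOrder_eq : ∀ g ∈ G, projOrder g = 1 ∨ projOrder g = 2 ∨ projOrder g = 3 ∨ projOrder g = m
  exists_two : ∃ g ∈ G, projOrder g = 2
  exists_three : ∃ g ∈ G, projOrder g = 3
  exists_max : ∃ g ∈ G, projOrder g = m
  exists_traceless : ∀ x ∈ G, projOrder x = m → ∃ y ∈ G, y.val.trace = 0 ∧ x * y ≠ y * x ∧
    (x.val * y.val).trace ≠ 0 ∧ ∀ w ∈ G, w.val.trace = 0 → ¬ IsScal w.val →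
      ∃ z ∈ G, IsScal z.val ∧ (w.val.det = z.val.det * y.val.det ∨
        m = 4 ∧ w.val.det = z.val.det * x.val.det ^ 2)
  two_mul_tracelessCard_lt : m = 3 → 2 * tracelessCard G < Nat.card G

variable {G : Subgroup (GL (Fin 2) E)}

theorem card_eq_of_gen [Finite G] {x : GL (Fin 2) E} (hx : x ∈ G)
    (h : ∀ g ∈ G, ∃ k : ℕ, ∃ z ∈ G, IsScal z.val ∧ g = x ^ k * z) :
    Nat.card G = projOrder x * Nat.card (scalars G) := by
  rw [← Subgroup.card_mul_index (scalars G), mul_comm]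
  congr 1
  have : (scalars G).Normal := inferInstanceAs ((Subgroup.center _).subgroupOf G).Normal
  have hz : ∀ q : G ⧸ scalars G, q ∈ Subgroup.zpowers ((⟨x, hx⟩ : G) : G ⧸ scalars G) := by
    intro q
    obtain ⟨g, rfl⟩ := QuotientGroup.mk_surjective q
    obtain ⟨k, z, hzG, hzs, hg⟩ := h g g.2
    refine ⟨k, ?_⟩
    have : g = ⟨x, hx⟩ ^ k * ⟨z, hzG⟩ := Subtype.ext hg
    have h1 : ((⟨z, hzG⟩ : G) : G ⧸ scalars G) = 1 :=
      (QuotientGroup.eq_one_iff _).2 (mem_scalars.2 hzs)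
    rw [this, QuotientGroup.mk_mul, h1, mul_one, QuotientGroup.mk_pow]
    exact zpow_natCast _ _
  rw [Subgroup.index, ← orderOf_eq_card_of_forall_mem_zpowers hz]
  refine Nat.dvd_right_iff_eq.1 fun k => ?_
  rw [← isScal_pow_iff, orderOf_dvd_iff_pow_eq_one, ← QuotientGroup.mk_pow,
    QuotientGroup.eq_one_iff, mem_scalars]
  simp

theorem trace_eq_zero_of_projOrder_eq_two {g : GL (Fin 2) E} (h : projOrder g = 2) :
    g.val.trace = 0 := by
  refine trace_eq_zero_of_isScal_sq ?_ (isScal_pow_iff.2 h.dvd)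
  rw [isScal_iff_projOrder_eq_one, h]
  norm_num

theorem projOrder_eq_two {g : GL (Fin 2) E} (hs : ¬ IsScal g.val) (h : g.val.trace = 0) :
    projOrder g = 2 := by
  have h1 : projOrder g ∣ 2 := isScal_pow_iff.1 (isScal_sq h)
  rcases (Nat.dvd_prime Nat.prime_two).1 h1 with h2 | h2
  · exact absurd (isScal_iff_projOrder_eq_one.2 h2) hs
  · exact h2

theorem isScal_mul_inv_of_traceless {g h : GL (Fin 2) E}
    (hd : h.val.trace ^ 2 = 4 * h.val.det → IsScal h.val) (hs : ¬ IsScal h.val)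
    (hg0 : g.val.trace = 0) (hh0 : h.val.trace = 0) (hc : g * h = h * g) :
    IsScal (g * h⁻¹).val := by
  obtain ⟨c, hc⟩ := exists_smul_of_traceless (fun h => hs (hd h)) hs hh0 hg0
    (congrArg Units.val hc.symm)
  refine ⟨c, ?_⟩
  rw [Units.val_mul, hc, smul_mul_assoc, Units.mul_inv]

theorem tracelessCard_le_of_comm [Finite G] (hG : IsSemisimpleGroup G)
    (hc : ∀ g ∈ G, ∀ h ∈ G, g * h = h * g) : tracelessCard G ≤ Nat.card (scalars G) := by
  by_cases hw : ∃ w ∈ G, w.val.trace = 0 ∧ ¬ IsScal w.val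
  · obtain ⟨w, hwG, hw0, hws⟩ := hw
    refine Nat.card_le_card_of_injective (fun g => ⟨g.1 * (⟨w, hwG⟩ : G)⁻¹, mem_scalars.2
      (isScal_mul_inv_of_traceless (hG w hwG) hws g.2 hw0 (hc _ g.1.2 _ hwG))⟩) fun g g' h => ?_
    exact Subtype.ext (mul_right_cancel (congrArg Subtype.val h))
  · push Not at hw
    exact Nat.card_le_card_of_injective
      (fun g => ⟨g.1, mem_scalars.2 (hw g.1 g.1.2 g.2)⟩) fun g g' h =>
        Subtype.ext (congrArg (fun a : scalars G => a.1) h)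

theorem commute_of_gen {x : GL (Fin 2) E}
    (h : ∀ g ∈ G, ∃ k : ℕ, ∃ z ∈ G, IsScal z.val ∧ g = x ^ k * z) :
    ∀ g ∈ G, ∀ h ∈ G, g * h = h * g := by
  intro g hg h' hh'
  obtain ⟨k, z, -, hz, rfl⟩ := h g hg
  obtain ⟨l, w, -, hw, rfl⟩ := h h' hh'
  have hz' : ∀ a, z * a = a * z := fun a => Units.ext (hz.mul_comm _)
  have hw' : ∀ a, w * a = a * w := fun a => Units.ext (hw.mul_comm _)
  have h1 : x ^ k * x ^ l = x ^ l * x ^ k := by rw [← pow_add, ← pow_add, add_comm]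
  calc x ^ k * z * (x ^ l * w) = x ^ k * (z * (x ^ l * w)) := mul_assoc _ _ _
    _ = x ^ k * x ^ l * w * z := by rw [hz']; simp only [mul_assoc]
    _ = x ^ l * (w * x ^ k) * z := by rw [h1, hw' (x ^ k)]; simp only [mul_assoc]
    _ = _ := by simp only [mul_assoc]

theorem card_orbit_le_two [Finite G] [IsAlgClosed E] (hG : IsSemisimpleGroup G) {p : Points G}
    {g : G} (hg : g ∈ MulAction.stabilizer G p) (hs : g ∉ scalars G)
    (hc : ∀ h : G, g * (h * g * h⁻¹) = h * g * h⁻¹ * g) : Nat.card (MulAction.orbit G p) ≤ 2 := by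
  obtain ⟨q, hq⟩ := exists_point hG hs
  have : MulAction.orbit G p ⊆ {q, q.compl} := by
    rintro _ ⟨h, rfl⟩
    refine (hq _).1 ?_
    have h1 : h * g * h⁻¹ ∈ MulAction.stabilizer G (h • p) := by
      rw [MulAction.mem_stabilizer_iff, mul_smul, mul_smul, inv_smul_smul,
        MulAction.mem_stabilizer_iff.1 hg]
    refine mem_stabilizer_of_commute h1 ?_ (hc h).symm
    rw [mem_scalars] at hs ⊢
    exact fun h2 => hs (isScal_conj_iff.1 h2)
  have h2 := Set.ncard_le_ncard this (Set.toFinite _)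
  rw [Nat.card_coe_set_eq]
  exact h2.trans ((Set.ncard_insert_le _ _).trans (by simp))

theorem isCyclicType_of_ord_eq [Finite G] {p : Points G} (hp : p.ord = (scalars G).index) :
    IsCyclicType G := by
  have htop : MulAction.stabilizer G p = ⊤ := by
    rw [← Subgroup.card_eq_iff_eq_top, p.card_stabilizer, hp, mul_comm, Subgroup.card_mul_index]
  refine ⟨p.gen, p.gen.2, fun g hg => ?_⟩
  obtain ⟨k, z, hz, h⟩ := p.exists_eq_gen_pow_mul (g := ⟨g, hg⟩) (htop ▸ Subgroup.mem_top _)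
  exact ⟨k, z, z.2, mem_scalars.1 hz, congrArg Subtype.val h⟩

theorem isCyclicType_of_forall_mem_scalars (h : ∀ g : G, g ∈ scalars G) : IsCyclicType G :=
  ⟨1, G.one_mem, fun g hg => ⟨0, g, hg, mem_scalars.1 (h ⟨g, hg⟩), by simp⟩⟩

theorem projOrder_gen_not_scalar [Finite G] (p : Points G) : p.gen ∉ scalars G := by
  rw [mem_scalars, isScal_iff_projOrder_eq_one]
  have := p.two_le_ord
  rw [Points.ord] at this
  omega

theorem not_mem_scalars_of_mul_ne {x y : G} (h : x * y ≠ y * x) : x ∉ scalars G := fun hx =>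
  h (Subtype.ext (Units.ext ((mem_scalars.1 hx).mul_comm _)))

theorem exists_ord_dvd [IsAlgClosed E] [Finite G] (hG : IsSemisimpleGroup G) {g : G}
    (hg : g ∉ scalars G) : ∃ p : Points G, g ∈ MulAction.stabilizer G p := by
  obtain ⟨p, hp⟩ := exists_point hG hg
  exact ⟨p, (hp p).2 (Or.inl rfl)⟩

theorem isDihedralType_of_points [IsAlgClosed E] [Finite G] (hG : IsSemisimpleGroup G)
    {p₁ p₂ p₃ : Points G} (hcov : ∀ p : Points G, p ∈ MulAction.orbit G p₁ ∨
      p ∈ MulAction.orbit G p₂ ∨ p ∈ MulAction.orbit G p₃)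
    (h₁ : p₁.ord = 2) (h₂ : p₂.ord = 2) (hN : (scalars G).index = 2 * p₃.ord) :
    IsDihedralType G p₃.ord := by
  have hcard : Nat.card G = 2 * p₃.ord * Nat.card (scalars G) := by
    rw [← hN, mul_comm, Subgroup.card_mul_index]
  have hpos := card_scalars_pos (G := G)
  have hord : ∀ p : Points G, p.ord = 2 ∨ p.ord = p₃.ord := fun p => by
    rcases hcov p with h | h | h
    · exact Or.inl ((Points.ord_eq_of_mem_orbit h).trans h₁)
    · exact Or.inl ((Points.ord_eq_of_mem_orbit h).trans h₂)
    · exact Or.inr (Points.ord_eq_of_mem_orbit h)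
  have hpo : ∀ g ∈ G, projOrder g = 2 ∨ projOrder g ∣ p₃.ord := by
    intro g hg
    by_cases hs : (⟨g, hg⟩ : G) ∈ scalars G
    · rw [mem_scalars, isScal_iff_projOrder_eq_one] at hs
      exact Or.inr (hs ▸ one_dvd _)
    · obtain ⟨p, hp⟩ := exists_ord_dvd hG hs
      have hd := projOrder_dvd_ord hp
      rcases hord p with h | h
      · rw [h] at hd
        rcases (Nat.dvd_prime Nat.prime_two).1 hd with h1 | h1
        · exact Or.inr (h1 ▸ one_dvd _)
        · exact Or.inl h1
      · exact Or.inr (h ▸ hd)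
  have htr : ∀ x ∈ G, 3 ≤ projOrder x → ∀ y ∈ G, x * y ≠ y * x →
      y.val.trace = 0 ∧ (x.val * y.val).trace = 0 := by
    intro x hx hx3 y hy hxy
    have hxy' : (⟨x, hx⟩ : G) * ⟨y, hy⟩ ≠ ⟨y, hy⟩ * ⟨x, hx⟩ := fun h => hxy (congrArg Subtype.val h)
    have hs := not_mem_scalars_of_mul_ne hxy'
    obtain ⟨p, hp⟩ := exists_ord_dvd hG hs
    have hp3 : p.ord = p₃.ord := by
      refine (hord p).resolve_left fun h => ?_
      have := Nat.le_of_dvd (by norm_num) (h ▸ projOrder_dvd_ord hp)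
      change projOrder x ≤ 2 at this
      omega
    have hindex : (MulAction.stabilizer G p).index = 2 := by
      have := Subgroup.card_mul_index (MulAction.stabilizer G p)
      rw [p.card_stabilizer, hcard, hp3] at this
      have h3 : 0 < p₃.ord * Nat.card (scalars G) :=
        Nat.mul_pos (zero_lt_two.trans_le p₃.two_le_ord) hpos
      exact Nat.eq_of_mul_eq_mul_left h3 (this.trans (by ring))
    have hnor := Subgroup.normal_of_index_eq_two hindex
    have hcomm := commute_of_mem_stabilizer hp (hnor.conj_mem _ hp ⟨y, hy⟩)
    rw [mem_scalars] at hs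
    refine trace_eq_zero_of_normalizes (x' := (y * x * y⁻¹).val) (fun h => hs (hG x hx h)) hs ?_
      (congrArg (fun g : G => g.1.val) hcomm) (trace_conj y x) (det_conj y x) fun h =>
        hxy (Units.ext h.symm)
    rw [← Units.val_mul, ← Units.val_mul]
    congr 1
    group
  have hinj : ∀ S : Subgroup G, (∀ y : G, y ∉ S → y.1.val.trace = 0) →
      Nat.card G ≤ tracelessCard G + Nat.card S := by
    classical
    intro S hS
    rw [← Nat.card_congr (Equiv.sumCompl fun g : G => g ∉ S), Nat.card_sum]
    refine Nat.add_le_add ?_ ?_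
    · exact Nat.card_le_card_of_injective (fun g => ⟨g.1, hS g.1 g.2⟩) fun g g' h =>
        Subtype.ext (congrArg (fun a : {g : G // g.1.val.trace = 0} => a.1) h)
    · exact Nat.card_le_card_of_injective (fun g => ⟨g.1, not_not.1 g.2⟩) fun g g' h =>
        Subtype.ext (congrArg (fun a : S => a.1) h)
  have hcount2 : p₃.ord = 2 → 3 * Nat.card (scalars G) ≤ tracelessCard G := by
    intro h
    have := hinj (scalars G) fun y hy => by
      refine trace_eq_zero_of_projOrder_eq_two ?_
      rw [mem_scalars, isScal_iff_projOrder_eq_one] at hy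
      refine (hpo y y.2).elim id fun h1 => ?_
      rw [h] at h1
      exact ((Nat.dvd_prime Nat.prime_two).1 h1).resolve_left hy
    rw [hcard, h] at this
    omega
  refine ⟨p₃.two_le_ord, hcard, ⟨p₃.gen, p₃.gen.2, rfl, ?_⟩, hpo, htr, ?_, hcount2⟩
  · intro g hg hc
    obtain ⟨k, z, hz, h⟩ := p₃.exists_eq_gen_pow_mul (mem_stabilizer_of_commute p₃.gen_mem
      (projOrder_gen_not_scalar p₃) (h := ⟨g, hg⟩) (Subtype.ext hc))
    exact ⟨k, z, z.2, mem_scalars.1 hz, congrArg Subtype.val h⟩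
  · rcases eq_or_lt_of_le p₃.two_le_ord with h | h
    · have := hcount2 h.symm
      rw [← h]
      omega
    · have := hinj (MulAction.stabilizer G p₃) fun y hy => by
        refine (htr p₃.gen p₃.gen.2 h y y.2 fun hc => hy ?_).1
        exact mem_stabilizer_of_commute p₃.gen_mem (projOrder_gen_not_scalar p₃) (Subtype.ext hc)
      rw [hcard, p₃.card_stabilizer] at this
      linarith

theorem exists_eq_smul_of_mem_stabilizer {p : Points G} (hG : IsSemisimpleGroup G) {g h : G}
    (hg : g ∈ MulAction.stabilizer G p) (hh : h ∈ MulAction.stabilizer G p)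
    (hs : h ∉ scalars G) (hg0 : g.1.val.trace = 0) (hh0 : h.1.val.trace = 0) :
    g * h⁻¹ ∈ scalars G :=
  mem_scalars.2 (isScal_mul_inv_of_traceless (hG h h.2) (fun h' => hs (mem_scalars.2 h')) hg0 hh0
    (congrArg Subtype.val (commute_of_mem_stabilizer hg hh)))

theorem conj_mem_stabilizer {p : Points G} {g : G} (h : G) (hg : g ∈ MulAction.stabilizer G p) :
    h * g * h⁻¹ ∈ MulAction.stabilizer G (h • p) := by
  rw [MulAction.mem_stabilizer_iff, mul_smul, mul_smul, inv_smul_smul,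
    MulAction.mem_stabilizer_iff.1 hg]

theorem conj_mem_scalars_iff {g h : G} : h * g * h⁻¹ ∈ scalars G ↔ g ∈ scalars G := by
  rw [mem_scalars, mem_scalars]
  exact isScal_conj_iff

/-- If `w` is traceless and fixes a point in the orbit of `p`, then its determinant agrees with
that of a traceless element fixing `p`, up to the determinant of a scalar. -/
theorem exists_det_eq_of_mem_orbit {p q : Points G} (hG : IsSemisimpleGroup G) {g w : G}
    (hq : q ∈ MulAction.orbit G p) (hg : g ∈ MulAction.stabilizer G p)
    (hw : w ∈ MulAction.stabilizer G q) (hs : g ∉ scalars G) (hg0 : g.1.val.trace = 0)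
    (hw0 : w.1.val.trace = 0) :
    ∃ z ∈ G, IsScal z.val ∧ w.1.val.det = z.val.det * g.1.val.det := by
  obtain ⟨h, rfl⟩ := hq
  have h1 := exists_eq_smul_of_mem_stabilizer hG hw (conj_mem_stabilizer h hg)
    (fun hc => hs (conj_mem_scalars_iff.1 hc)) hw0 ((trace_conj h.1 g.1).trans hg0)
  refine ⟨_, (w * (h * g * h⁻¹)⁻¹).2, mem_scalars.1 h1, ?_⟩
  rw [← _root_.det_conj h.1 g.1, ← Matrix.det_mul, ← Units.val_mul]
  exact congrArg (fun a : G => a.1.val.det) (inv_mul_cancel_right w (h * g * h⁻¹)).symm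

theorem exists_traceless_of_points [IsAlgClosed E] [Finite G] (hG : IsSemisimpleGroup G)
    {p₁ p₂ p₃ : Points G} (hcov : ∀ p : Points G, p ∈ MulAction.orbit G p₁ ∨
      p ∈ MulAction.orbit G p₂ ∨ p ∈ MulAction.orbit G p₃)
    (h₁ : p₁.ord = 2) (h₂ : p₂.ord = 3) (h₃ : p₃.ord = 3 ∨ p₃.ord = 4 ∨ p₃.ord = 5)
    (hN : (scalars G).index * (6 - p₃.ord) = 12 * p₃.ord) {x : G}
    (hx : projOrder x.1 = p₃.ord) : ∃ y : G, y.1.val.trace = 0 ∧ x * y ≠ y * x ∧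
    (x.1.val * y.1.val).trace ≠ 0 ∧ ∀ w : G, w.1.val.trace = 0 → w ∉ scalars G →
      ∃ z ∈ G, IsScal z.val ∧ (w.1.val.det = z.val.det * y.1.val.det ∨
        p₃.ord = 4 ∧ w.1.val.det = z.val.det * x.1.val.det ^ 2) := by
  obtain ⟨y₀, hy₀s, hy₀t, hy₀m⟩ : ∃ y₀ : G, y₀ ∉ scalars G ∧ y₀.1.val.trace = 0 ∧
      y₀ ∈ MulAction.stabilizer G p₁ :=
    ⟨p₁.gen, projOrder_gen_not_scalar p₁, trace_eq_zero_of_projOrder_eq_two h₁, p₁.gen_mem⟩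
  have key : ∀ g h k : G, k = g⁻¹ * h →
      ((g * x * g⁻¹).1.val * (h * y₀ * h⁻¹).1.val).trace =
        (x.1.val * (k * y₀ * k⁻¹).1.val).trace := by
    rintro g h k rfl
    refine Eq.trans (congrArg (fun a : G => a.1.val.trace) (?_ : g * x * g⁻¹ * (h * y₀ * h⁻¹) =
      g * (x * (g⁻¹ * h * y₀ * (g⁻¹ * h)⁻¹)) * g⁻¹)) (trace_conj g.1 (x * _ : G).1)
    group
  have hxs : x ∉ scalars G := by
    rw [mem_scalars, isScal_iff_projOrder_eq_one, hx]
    omega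
  obtain ⟨q, hq⟩ := exists_ord_dvd hG hxs
  have hq3 : p₃.ord ∣ q.ord := hx ▸ projOrder_dvd_ord hq
  have hqord : q.ord = p₃.ord := by
    rcases hcov q with h | h | h
    · rw [Points.ord_eq_of_mem_orbit h, h₁] at hq3
      rcases h₃ with h | h | h <;> rw [h] at hq3 <;> omega
    · rw [Points.ord_eq_of_mem_orbit h, h₂] at hq3 ⊢
      rcases h₃ with h | h | h <;> rw [h] at hq3 <;> omega
    · exact Points.ord_eq_of_mem_orbit h
  have hconj_comm : ∀ h : G, x * (h * y₀ * h⁻¹) ≠ h * y₀ * h⁻¹ * x := by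
    intro h hc
    have h1 := mem_stabilizer_of_commute (conj_mem_stabilizer h hy₀m)
      (fun h' => hy₀s (conj_mem_scalars_iff.1 h')) hc.symm
    have h2 := projOrder_dvd_ord h1
    rw [Points.ord_eq_of_mem_orbit ⟨h, rfl⟩, h₁, hx] at h2
    have := Nat.le_of_dvd (by norm_num) h2
    omega
  have hex : ∃ h : G, (x.1.val * (h * y₀ * h⁻¹).1.val).trace ≠ 0 := by
    by_contra! hcon
    obtain ⟨g, hg⟩ : ∃ g : G, x * (g * x * g⁻¹) ≠ g * x * g⁻¹ * x := by
      by_contra! hall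
      have h1 := card_orbit_le_two hG hq hxs hall
      have h2 := card_orbit_mul_ord q
      have h3 : Nat.card (MulAction.orbit G q) * q.ord ≤ 2 * q.ord := Nat.mul_le_mul_right _ h1
      rw [h2, hqord] at h3
      rcases h₃ with h | h | h <;> rw [h] at hN h3 <;> omega
    have h1 := card_orbit_le_two hG hy₀m hy₀s fun h => by
      refine Subtype.ext (Units.ext ?_)
      refine commute_of_traceless_orthogonal (x := x.1.val) (x' := (g * x * g⁻¹).1.val)
        (fun h => hg (Subtype.ext (Units.ext h))) hy₀t ((trace_conj h.1 y₀.1).trans hy₀t)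
        ?_ (hcon h) ?_ ?_
      · simpa using hcon 1
      · simpa using (key g 1 _ rfl).trans (hcon _)
      · exact (key g h _ rfl).trans (hcon _)
    have h2 := card_orbit_mul_ord p₁
    rw [h₁] at h2
    rcases h₃ with h | h | h <;> rw [h] at hN <;> omega
  obtain ⟨h, hh⟩ := hex
  refine ⟨h * y₀ * h⁻¹, (trace_conj h.1 y₀.1).trans hy₀t, hconj_comm h, hh, fun w hw0 hws => ?_⟩
  obtain ⟨r, hr⟩ := exists_ord_dvd hG hws
  have hr2 := projOrder_dvd_ord hr
  rw [projOrder_eq_two (fun h => hws (mem_scalars.2 h)) hw0] at hr2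
  rcases hcov r with hr' | hr' | hr'
  · obtain ⟨z, hz, hzs, h⟩ := exists_det_eq_of_mem_orbit hG hr' hy₀m hr hy₀s hy₀t hw0
    exact ⟨z, hz, hzs, Or.inl (h.trans (congrArg _ (_root_.det_conj _ _).symm))⟩
  · rw [Points.ord_eq_of_mem_orbit hr', h₂] at hr2
    omega
  · rw [Points.ord_eq_of_mem_orbit hr'] at hr2
    have h4 : p₃.ord = 4 := by omega
    have hq' : r ∈ MulAction.orbit G q := by
      rcases hcov q with h | h | h
      · have := Points.ord_eq_of_mem_orbit h
        omega
      · have := Points.ord_eq_of_mem_orbit h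
        omega
      · rw [MulAction.orbit_eq_iff.2 h]
        exact hr'
    have hx2 : x ^ 2 ∉ scalars G := by
      rw [mem_scalars]
      change ¬ IsScal (x.1.val ^ 2)
      rw [isScal_pow_iff, hx, h4]
      norm_num
    obtain ⟨z, hz, hzs, h⟩ := exists_det_eq_of_mem_orbit hG hq' (pow_mem hq 2) hr hx2 (by
      refine trace_eq_zero_of_isScal_sq (fun h => hx2 (mem_scalars.2 h)) ?_
      change IsScal ((x.1.val ^ 2) ^ 2)
      rw [← pow_mul, isScal_pow_iff, hx, h4]) hw0
    refine ⟨z, hz, hzs, Or.inr ⟨h4, h.trans (congrArg _ ?_)⟩⟩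
    exact Matrix.det_pow _ _

theorem two_mul_tracelessCard_lt [IsAlgClosed E] [Finite G] (hG : IsSemisimpleGroup G)
    {p₁ : Points G} (h₁ : p₁.ord = 2)
    (hall : ∀ p : Points G, p ∈ MulAction.orbit G p₁ ∨ p.ord = 3)
    (hN : (scalars G).index = 12) : 2 * tracelessCard G < Nat.card G := by
  have := finite_points hG
  have hcard := Subgroup.card_mul_index (scalars G)
  have horb := card_orbit_mul_ord p₁
  have hpos := card_scalars_pos (G := G)
  rw [h₁, hN] at horb
  rw [hN] at hcard
  by_cases h2 : (2 : E) = 0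
  · have : tracelessCard G ≤ Nat.card (scalars G) :=
      Nat.card_le_card_of_injective (fun g => ⟨g.1, mem_scalars.2 (hG _ g.1.2 (by
        rw [g.2]
        linear_combination (-2 * g.1.1.val.det) * h2))⟩) fun g g' h =>
        Subtype.ext (congrArg (fun a : scalars G => a.1) h)
    omega
  have hpt : ∀ w : {g : G // g.1.val.trace = 0}, ∃ p : MulAction.orbit G p₁, p.1 ≠ p₁ ∧
      w.1 ∈ MulAction.stabilizer G p.1 := by
    rintro ⟨w, hw⟩
    have hws : w ∉ scalars G := by
      intro h
      obtain ⟨c, hc⟩ := mem_scalars.1 h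
      rw [hc, Matrix.trace_smul, Matrix.trace_one] at hw
      have hc0 : c = 0 := by
        rcases mul_eq_zero.1 hw with h | h
        · exact h
        · exact absurd (by simpa using h) h2
      exact det_ne_zero w.1 (by rw [hc, hc0]; simp)
    obtain ⟨p, hp⟩ := exists_point hG hws
    have horb : ∀ q : Points G, w ∈ MulAction.stabilizer G q → q ∈ MulAction.orbit G p₁ := by
      intro q hq
      refine (hall q).resolve_right fun h => ?_
      have := projOrder_dvd_ord hq
      rw [projOrder_eq_two (fun h => hws (mem_scalars.2 h)) hw, h] at this
      omega
    have hp1 := (hp p).2 (Or.inl rfl)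
    have hp2 := (hp p.compl).2 (Or.inr rfl)
    by_cases h : p = p₁
    · exact ⟨⟨p.compl, horb _ hp2⟩, fun h' => p.compl_ne (h'.trans h.symm), hp2⟩
    · exact ⟨⟨p, horb _ hp1⟩, h, hp1⟩
  choose f hf1 hf2 using hpt
  have hgen : ∀ p : MulAction.orbit G p₁, p.1.gen.1.val.trace = 0 := fun p =>
    trace_eq_zero_of_projOrder_eq_two ((Points.ord_eq_of_mem_orbit p.2).trans h₁)
  let F : {g : G // g.1.val.trace = 0} → MulAction.orbit G p₁ × scalars G := fun w =>
    ⟨f w, w.1 * (f w).1.gen⁻¹, exists_eq_smul_of_mem_stabilizer hG (hf2 w) (f w).1.gen_mem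
      (projOrder_gen_not_scalar _) w.2 (hgen _)⟩
  have hF : Function.Injective F := by
    intro w w' h
    have h1 : f w = f w' := congrArg Prod.fst h
    have h2 : w.1 * (f w).1.gen⁻¹ = w'.1 * (f w').1.gen⁻¹ := congrArg (fun a => a.2.1) h
    rw [h1] at h2
    exact Subtype.ext (mul_right_cancel h2)
  have hlt : tracelessCard G < Nat.card (MulAction.orbit G p₁ × scalars G) := by
    have := Fintype.ofFinite {g : G // g.1.val.trace = 0}
    have := Fintype.ofFinite (MulAction.orbit G p₁ × scalars G)
    rw [tracelessCard, Nat.card_eq_fintype_card, Nat.card_eq_fintype_card]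
    refine Fintype.card_lt_of_injective_of_notMem F hF
      (b := (⟨p₁, MulAction.mem_orbit_self _⟩, 1)) ?_
    rintro ⟨w, hw⟩
    exact hf1 w (congrArg (fun a => a.1.1) hw)
  rw [Nat.card_prod, show Nat.card (MulAction.orbit G p₁) = 6 by omega] at hlt
  omega

theorem eq_or_of_dvd {d m : ℕ} (hm : m = 3 ∨ m = 4 ∨ m = 5) (hd1 : d ≠ 1)
    (hd : d ∣ 2 ∨ d ∣ 3 ∨ d ∣ m) : d = 1 ∨ d = 2 ∨ d = 3 ∨ d = m := by
  rcases hd with hd | hd | hd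
  · have := (Nat.dvd_prime Nat.prime_two).1 hd
    omega
  · have := (Nat.dvd_prime Nat.prime_three).1 hd
    omega
  · have h1 := Nat.le_of_dvd (by omega) hd
    have h2 : d ≤ 5 := by omega
    rcases hm with rfl | rfl | rfl <;> interval_cases d <;> omega

/-- Classification of finite semisimple groups. -/
theorem classification [IsAlgClosed E] [Finite G] (hG : IsSemisimpleGroup G) :
    IsCyclicType G ∨ (∃ n, IsDihedralType G n) ∨ ∃ m, IsExceptionalType G m := by
  rcases orbit_trichotomy hG with h | ⟨p, hp⟩ | ⟨p₁, p₂, p₃, hcov, ⟨h₁, h₂, hN⟩ | ⟨h₁, h₂, h₃, hN⟩⟩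
  · exact Or.inl (isCyclicType_of_forall_mem_scalars h)
  · exact Or.inl (isCyclicType_of_ord_eq hp)
  · exact Or.inr (Or.inl ⟨_, isDihedralType_of_points hG hcov h₁ h₂ hN⟩)
  refine Or.inr (Or.inr ⟨p₃.ord, h₃, ?_, ?_, ⟨p₁.gen, p₁.gen.2, h₁⟩, ⟨p₂.gen, p₂.gen.2, h₂⟩,
    ⟨p₃.gen, p₃.gen.2, rfl⟩, ?_, ?_⟩)
  · rw [← Subgroup.card_mul_index (scalars G), mul_assoc, hN, mul_comm]
  · intro g hg
    by_cases hs : (⟨g, hg⟩ : G) ∈ scalars G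
    · rw [mem_scalars, isScal_iff_projOrder_eq_one] at hs
      exact Or.inl hs
    obtain ⟨p, hp⟩ := exists_ord_dvd hG hs
    have hd := projOrder_dvd_ord hp
    refine eq_or_of_dvd h₃ (by rwa [mem_scalars, isScal_iff_projOrder_eq_one] at hs) ?_
    rcases hcov p with h | h | h <;> rw [Points.ord_eq_of_mem_orbit h] at hd
    · exact Or.inl (h₁ ▸ hd)
    · exact Or.inr (Or.inl (h₂ ▸ hd))
    · exact Or.inr (Or.inr hd)
  · intro x hx hxm
    obtain ⟨y, hy0, hxy, hxy0, hw⟩ := exists_traceless_of_points hG hcov h₁ h₂ h₃ hN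
      (x := ⟨x, hx⟩) hxm
    refine ⟨y, y.2, hy0, fun h => hxy (Subtype.ext h), hxy0, fun w hwG hw0 hws => ?_⟩
    exact hw ⟨w, hwG⟩ hw0 fun h => hws (mem_scalars.1 h)
  · intro h3
    rw [h3] at hN
    refine two_mul_tracelessCard_lt hG h₁ (fun p => ?_) (by omega)
    rcases hcov p with h | h | h
    · exact Or.inl h
    · exact Or.inr ((Points.ord_eq_of_mem_orbit h).trans h₂)
    · exact Or.inr ((Points.ord_eq_of_mem_orbit h).trans h3)

end Types

section Pairs

variable {E : Type*} [Field E]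

theorem det_mul_sub_mul (A B : Matrix (Fin 2) (Fin 2) E) : (A * B - B * A).det =
    4 * A.det * B.det - A.trace ^ 2 * B.det - B.trace ^ 2 * A.det - (A * B).trace ^ 2 +
      A.trace * B.trace * (A * B).trace := by
  obtain ⟨a, b, c, d, rfl⟩ := exists_entries A
  obtain ⟨a', b', c', d', rfl⟩ := exists_entries B
  simp [Matrix.det_fin_two, Matrix.trace_fin_two]
  ring

/-- A pair of matrices without common eigenvector has a normal form depending only on traces and
determinants. -/
theorem exists_mul_eq_of_pair {A B : Matrix (Fin 2) (Fin 2) E} {α : E}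
    (hα : (A - α • 1).det = 0) (hne : (A * B - B * A).det ≠ 0) : ∃ Q : GL (Fin 2) E,
      A * Q.val = Q.val * !![α, (A * B).trace - (A.trace - α) * B.trace; 0, A.trace - α] ∧
        B * Q.val = Q.val * !![0, -B.det; 1, B.trace] := by
  obtain ⟨v, hv0, hv⟩ := Matrix.exists_mulVec_eq_zero_iff.2 hα
  obtain ⟨a, b, c, d, rfl⟩ := exists_entries A
  obtain ⟨a', b', c', d', rfl⟩ := exists_entries B
  have h0 := congrFun hv 0
  have h1 := congrFun hv 1
  simp [Matrix.mulVec, dotProduct, Fin.sum_univ_two] at h0 h1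
  set p := v 0
  set q := v 1
  have hdet : !![p, a' * p + b' * q; q, c' * p + d' * q].det ≠ 0 := by
    intro hd
    refine hne ?_
    rw [Matrix.det_fin_two_of] at hd
    refine Matrix.exists_mulVec_eq_zero_iff.1 ⟨v, hv0, ?_⟩
    have hp : p ≠ 0 ∨ q ≠ 0 := by
      by_contra! h
      exact hv0 (funext fun i => by fin_cases i; exacts [h.1, h.2])
    obtain ⟨t, ht0, ht1⟩ : ∃ t, a' * p + b' * q = t * p ∧ c' * p + d' * q = t * q := by
      rcases hp with hp | hp
      · refine ⟨(a' * p + b' * q) / p, by field_simp, ?_⟩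
        field_simp
        linear_combination hd
      · refine ⟨(c' * p + d' * q) / q, ?_, by field_simp⟩
        field_simp
        linear_combination -hd
    funext i
    fin_cases i
    · simp [Matrix.mulVec, dotProduct, Fin.sum_univ_two]
      change _ * p + _ * q = 0
      linear_combination a * ht0 + b * ht1 - a' * h0 - b' * h1 + t * h0 - α * ht0
    · simp [Matrix.mulVec, dotProduct, Fin.sum_univ_two]
      change _ * p + _ * q = 0
      linear_combination c * ht0 + d * ht1 - c' * h0 - d' * h1 + t * h1 - α * ht1
  refine ⟨Matrix.GeneralLinearGroup.mkOfDetNeZero _ hdet, ?_, ?_⟩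
  · change _ * !![p, a' * p + b' * q; q, c' * p + d' * q] =
      !![p, a' * p + b' * q; q, c' * p + d' * q] * _
    ext i j
    fin_cases i <;> fin_cases j <;> simp [Matrix.trace_fin_two]
    · linear_combination h0
    · linear_combination d' * h0 - b' * h1
    · linear_combination h1
    · linear_combination a' * h1 - c' * h0
  · change _ * !![p, a' * p + b' * q; q, c' * p + d' * q] =
      !![p, a' * p + b' * q; q, c' * p + d' * q] * _
    ext i j
    fin_cases i <;> fin_cases j <;> simp [Matrix.trace_fin_two, Matrix.det_fin_two] <;> ring

theorem exists_conj_pair [IsAlgClosed E] {x y x' y' : GL (Fin 2) E}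
    (htx : x'.val.trace = x.val.trace) (hdx : x'.val.det = x.val.det)
    (hty : y'.val.trace = y.val.trace) (hdy : y'.val.det = y.val.det)
    (htxy : (x'.val * y'.val).trace = (x.val * y.val).trace)
    (hne : (x.val * y.val - y.val * x.val).det ≠ 0) :
    ∃ P : GL (Fin 2) E, P * x * P⁻¹ = x' ∧ P * y * P⁻¹ = y' := by
  have hne' : (x'.val * y'.val - y'.val * x'.val).det ≠ 0 := by
    rwa [det_mul_sub_mul, htx, hdx, hty, hdy, htxy, ← det_mul_sub_mul]
  obtain ⟨α, hα⟩ := IsAlgClosed.exists_root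
    (Polynomial.X ^ 2 - Polynomial.C x.val.trace * Polynomial.X + Polynomial.C x.val.det) (by
      have : (Polynomial.X ^ 2 - Polynomial.C x.val.trace * Polynomial.X +
        Polynomial.C x.val.det).degree = 2 := by compute_degree!
      rw [this]
      norm_num)
  have hα' : α ^ 2 - x.val.trace * α + x.val.det = 0 := by
    simpa using hα
  have hroot : ∀ A : Matrix (Fin 2) (Fin 2) E, A.trace = x.val.trace → A.det = x.val.det →
      (A - α • 1).det = 0 := by
    intro A h1 h2
    rw [← h1, ← h2] at hα'
    obtain ⟨a, b, c, d, rfl⟩ := exists_entries A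
    simp [Matrix.det_fin_two, Matrix.trace_fin_two] at hα' ⊢
    linear_combination hα'
  obtain ⟨Q, hQ1, hQ2⟩ := exists_mul_eq_of_pair (hroot _ rfl rfl) hne
  obtain ⟨R, hR1, hR2⟩ := exists_mul_eq_of_pair (hroot _ htx hdx) hne'
  rw [htx, hty, htxy] at hR1
  rw [hdy, hty] at hR2
  have key : ∀ (g g' : GL (Fin 2) E) (M : Matrix (Fin 2) (Fin 2) E), g.val * Q.val = Q.val * M →
      g'.val * R.val = R.val * M → R * Q⁻¹ * g * (R * Q⁻¹)⁻¹ = g' := by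
    intro g g' M h h'
    have hM : M = (Q⁻¹ * g * Q).val := by
      rw [Units.val_mul, Units.val_mul, mul_assoc, h, ← mul_assoc, ← Units.val_mul]
      simp
    rw [hM, ← Units.val_mul, ← Units.val_mul] at h'
    rw [_root_.mul_inv_rev, inv_inv, ← mul_assoc, mul_inv_eq_iff_eq_mul, Units.ext h']
    group
  exact ⟨R * Q⁻¹, key _ _ _ hQ1 hR1, key _ _ _ hQ2 hR2⟩

variable {G H : Subgroup (GL (Fin 2) E)}

theorem det_mul_sub_mul_ne_zero (hG : IsSemisimpleGroup G) {x y : GL (Fin 2) E} (hx : x ∈ G)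
    (hy : y ∈ G) (hxy : x * y ≠ y * x) : (x.val * y.val - y.val * x.val).det ≠ 0 := by
  intro h
  set c := x * y * (y * x)⁻¹ with hc
  have hcG : c ∈ G := G.mul_mem (G.mul_mem hx hy) (G.inv_mem (G.mul_mem hy hx))
  have hcv : c.val * (y.val * x.val) = x.val * y.val := by
    rw [← Units.val_mul, ← Units.val_mul, ← Units.val_mul, hc, inv_mul_cancel_right]
  clear_value c
  have hd1 : (c.val - 1).det = 0 := by
    have h1 : ((c.val - 1) * (y * x).val).det = 0 := by
      rw [Units.val_mul, sub_mul, hcv, one_mul, h]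
    rw [Matrix.det_mul] at h1
    exact (mul_eq_zero.1 h1).resolve_right (det_ne_zero _)
  have hd : c.val.det = 1 := by
    have h1 := congrArg Matrix.det hcv
    rw [Matrix.det_mul, Matrix.det_mul, Matrix.det_mul, mul_comm y.val.det] at h1
    exact mul_right_cancel₀ (mul_ne_zero (det_ne_zero x) (det_ne_zero y))
        (h1.trans (one_mul _).symm)
  have ht : c.val.trace = 2 := by
    obtain ⟨a, b, a', b', he⟩ := exists_entries c.val
    rw [he] at hd hd1 ⊢
    simp [Matrix.det_fin_two, Matrix.trace_fin_two] at hd hd1 ⊢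
    linear_combination hd - hd1
  obtain ⟨t, ht'⟩ := hG c hcG (by rw [ht, hd]; norm_num)
  have ht1 : t = 1 := by
    rw [ht'] at hd ht
    rw [Matrix.det_smul, Matrix.det_one, Fintype.card_fin, mul_one] at hd
    rw [Matrix.trace_smul, Matrix.trace_one, Fintype.card_fin, smul_eq_mul] at ht
    push_cast at ht
    have : (t - 1) ^ 2 = 0 := by linear_combination hd - ht
    exact sub_eq_zero.1 (pow_eq_zero_iff (two_ne_zero) |>.1 this)
  have hc1 : c = 1 := Units.ext (by rw [ht', ht1]; simp)
  exact hxy (mul_inv_eq_one.1 (hc ▸ hc1))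

theorem map_conj_eq_of_pair [IsAlgClosed E] [Finite G] [Finite H] (hG : IsSemisimpleGroup G)
    (hcard : Nat.card G = Nat.card H) (hscal : ∀ z ∈ G, IsScal z.val → z ∈ H)
    {x y x' y' : GL (Fin 2) E} (hx : x ∈ G) (hy : y ∈ G) (hx' : x' ∈ H) (hy' : y' ∈ H)
    (hxy : x * y ≠ y * x)
    (htx : x'.val.trace = x.val.trace) (hdx : x'.val.det = x.val.det)
    (hty : y'.val.trace = y.val.trace) (hdy : y'.val.det = y.val.det)
    (htxy : (x'.val * y'.val).trace = (x.val * y.val).trace)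
    (hK : ∀ K : Subgroup (GL (Fin 2) E), K ≤ G → (∀ z ∈ G, IsScal z.val → z ∈ K) → x ∈ K →
      y ∈ K → Nat.card K = Nat.card G) :
    ∃ P : GL (Fin 2) E, G.map (MulAut.conj P).toMonoidHom = H := by
  obtain ⟨P, hPx, hPy⟩ := exists_conj_pair htx hdx hty hdy htxy
    (det_mul_sub_mul_ne_zero hG hx hy hxy)
  set K := G ⊓ H.comap (MulAut.conj P).toMonoidHom with hKdef
  have hKcard := hK K inf_le_left (fun z hz hzs => ⟨hz, by
      change P * z * P⁻¹ ∈ H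
      have h1 : P * z = z * P := (Units.ext (hzs.mul_comm P.val)).symm
      rw [h1, mul_inv_cancel_right]
      exact hscal z hz hzs⟩)
    ⟨hx, by change P * x * P⁻¹ ∈ H; rwa [hPx]⟩ ⟨hy, by change P * y * P⁻¹ ∈ H; rwa [hPy]⟩
  have hKG : K = G := Subgroup.eq_of_le_of_card_ge inf_le_left hKcard.ge
  refine ⟨P, Subgroup.eq_of_le_of_card_ge ?_ ?_⟩
  · rw [Subgroup.map_le_iff_le_comap]
    exact hKG ▸ inf_le_right
  · rw [← hcard]
    exact (Nat.card_congr
      (G.equivMapOfInjective _ (MulAut.conj P).injective).toEquiv).le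

end Pairs

section Comparison

variable {E : Type*} [Field E]

/-- `G` and `H` consist of the same conjugacy classes and have the same proportion of traceless
elements. -/
structure IsMatching (G H : Subgroup (GL (Fin 2) E)) : Prop where
  exists_right : ∀ g ∈ G, ∃ h ∈ H, IsConj g h
  exists_left : ∀ h ∈ H, ∃ g ∈ G, IsConj h g
  tracelessCard_mul : tracelessCard G * Nat.card H = tracelessCard H * Nat.card G

variable {G H : Subgroup (GL (Fin 2) E)}

theorem IsMatching.symm (h : IsMatching G H) : IsMatching H G :=
  ⟨h.exists_left, h.exists_right, h.tracelessCard_mul.symm⟩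

theorem trace_eq_of_isConj {g h : GL (Fin 2) E} (hgh : IsConj g h) : h.val.trace = g.val.trace := by
  obtain ⟨c, rfl⟩ := isConj_iff.1 hgh
  exact trace_conj c g

theorem det_eq_of_isConj {g h : GL (Fin 2) E} (hgh : IsConj g h) : h.val.det = g.val.det := by
  obtain ⟨c, rfl⟩ := isConj_iff.1 hgh
  exact _root_.det_conj c g

theorem eq_of_isConj_of_isScal {z h : GL (Fin 2) E} (hz : IsScal z.val) (hzh : IsConj z h) :
    h = z := by
  obtain ⟨c, rfl⟩ := isConj_iff.1 hzh
  rw [mul_inv_eq_iff_eq_mul]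
  exact (Units.ext (hz.mul_comm c.val)).symm

theorem IsMatching.scalar_mem (h : IsMatching G H) : ∀ z ∈ G, IsScal z.val → z ∈ H := by
  intro z hz hzs
  obtain ⟨w, hw, hzw⟩ := h.exists_right z hz
  rwa [eq_of_isConj_of_isScal hzs hzw] at hw

theorem card_scalars_eq (h₁ : ∀ z ∈ G, IsScal z.val → z ∈ H) (h₂ : ∀ z ∈ H, IsScal z.val → z ∈ G) :
    Nat.card (scalars G) = Nat.card (scalars H) :=
  Nat.card_congr
    { toFun := fun z => ⟨⟨z.1.1, h₁ _ z.1.2 (mem_scalars.1 z.2)⟩, mem_scalars.2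
        (mem_scalars.1 z.2)⟩
      invFun := fun z => ⟨⟨z.1.1, h₂ _ z.1.2 (mem_scalars.1 z.2)⟩, mem_scalars.2
        (mem_scalars.1 z.2)⟩
      left_inv := fun _ => rfl
      right_inv := fun _ => rfl }

theorem IsMatching.exists_projOrder (h : IsMatching G H) {g : GL (Fin 2) E} (hg : g ∈ G) :
    ∃ g' ∈ H, projOrder g' = projOrder g := by
  obtain ⟨w, hw, hgw⟩ := h.exists_right g hg
  exact ⟨w, hw, (projOrder_eq_of_isConj hgw).symm⟩

theorem projOrder_dvd_of_gen {x : GL (Fin 2) E}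
    (h : ∀ g ∈ G, ∃ k : ℕ, ∃ z ∈ G, IsScal z.val ∧ g = x ^ k * z) {g : GL (Fin 2) E}
    (hg : g ∈ G) : projOrder g ∣ projOrder x := by
  obtain ⟨k, z, -, ⟨c, hc⟩, rfl⟩ := h g hg
  obtain ⟨d, hd⟩ : IsScal (x.val ^ projOrder x) := isScal_pow_iff.2 dvd_rfl
  rw [← isScal_pow_iff]
  refine ⟨d ^ k * c ^ projOrder x, ?_⟩
  rw [Units.val_mul, hc, mul_smul_comm, mul_one, _root_.smul_pow, Units.val_pow_eq_pow_val,
    pow_right_comm, hd, _root_.smul_pow, one_pow, smul_smul, mul_comm]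

theorem not_isExceptionalType_of_isCyclicType (hM : IsMatching G H) (hG : IsCyclicType G) {m : ℕ} :
    ¬ IsExceptionalType H m := by
  intro hH
  obtain ⟨x, hx, hgen⟩ := hG
  have hdvd : ∀ h ∈ H, projOrder h ∣ projOrder x := by
    intro h hh
    obtain ⟨g, hg, he⟩ := hM.symm.exists_projOrder hh
    exact he ▸ projOrder_dvd_of_gen hgen hg
  obtain ⟨a, ha, ha2⟩ := hH.exists_two
  obtain ⟨b, hb, hb3⟩ := hH.exists_three
  have h2 := hdvd a ha
  have h3 := hdvd b hb
  rw [ha2] at h2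
  rw [hb3] at h3
  obtain ⟨x', hx', he⟩ := hM.exists_projOrder hx
  have h4 := hH.projOrder_eq x' hx'
  rw [he] at h4
  have := hH.eq_or
  generalize projOrder x = N at *
  omega

theorem not_isDihedralType_of_isCyclicType [Finite G] [Finite H] (hSG : IsSemisimpleGroup G)
    (hM : IsMatching G H) (hG : IsCyclicType G) {n : ℕ} : ¬ IsDihedralType H n := by
  intro hH
  obtain ⟨x, hx, hgen⟩ := hG
  obtain ⟨y, hy, hyn, -⟩ := hH.exists_gen
  obtain ⟨g, hg, he⟩ := hM.symm.exists_projOrder hy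
  have h1 := projOrder_dvd_of_gen hgen hg
  rw [he, hyn] at h1
  obtain ⟨x', hx', he'⟩ := hM.exists_projOrder hx
  have h2 := hH.projOrder_eq x' hx'
  rw [he'] at h2
  have hn2 := hH.two_le
  have hN : projOrder x = n := by
    rcases h2 with h2 | h2
    · rw [h2] at h1 ⊢
      have := Nat.le_of_dvd (by norm_num) h1
      omega
    · exact Nat.dvd_antisymm h2 h1
  have hcG := card_eq_of_gen hx hgen
  have hcH := hH.card_eq
  rw [← card_scalars_eq hM.scalar_mem hM.symm.scalar_mem] at hcH
  have hT := tracelessCard_le_of_comm hSG (commute_of_gen hgen)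
  have hz := hM.tracelessCard_mul
  have hl := hH.le_tracelessCard
  have hl' := hH.three_mul_le_tracelessCard
  rw [← card_scalars_eq hM.scalar_mem hM.symm.scalar_mem] at hl hl'
  have hpos := card_scalars_pos (G := G)
  rw [hcG, hcH, hN] at hz
  have hz' : 2 * tracelessCard G = tracelessCard H := by
    refine Nat.eq_of_mul_eq_mul_right (Nat.mul_pos (by omega : 0 < n) hpos) ?_
    rw [← hz]
    ring
  rcases Nat.lt_or_ge n 3 with h | h
  · have := hl' (by omega)
    omega
  · have : 3 * Nat.card (scalars G) ≤ n * Nat.card (scalars G) := Nat.mul_le_mul_right _ h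
    omega

theorem not_isExceptionalType_of_isDihedralType [Finite G] [Finite H]
    (hM : IsMatching G H) {n m : ℕ} (hG : IsDihedralType G n) : ¬ IsExceptionalType H m := by
  intro hH
  obtain ⟨x, hx, hxn, -⟩ := hG.exists_gen
  obtain ⟨x', hx', he⟩ := hM.exists_projOrder hx
  have h1 := hH.projOrder_eq x' hx'
  rw [he, hxn] at h1
  obtain ⟨b, hb, hb3⟩ := hH.exists_three
  obtain ⟨b', hb', heb⟩ := hM.symm.exists_projOrder hb
  have h3 := hG.projOrder_eq b' hb'
  rw [heb, hb3] at h3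
  obtain ⟨c, hc, hcm⟩ := hH.exists_max
  obtain ⟨c', hc', hec⟩ := hM.symm.exists_projOrder hc
  have hm := hG.projOrder_eq c' hc'
  rw [hec, hcm] at hm
  have hn2 := hG.two_le
  have heq : n = 3 ∧ m = 3 := by
    rcases hH.eq_or with rfl | rfl | rfl <;> omega
  obtain ⟨rfl, rfl⟩ := heq
  have hcG := hG.card_eq
  have hcH := hH.card_eq
  have hT := hG.le_tracelessCard
  have hT' := hH.two_mul_tracelessCard_lt rfl
  rw [← card_scalars_eq hM.scalar_mem hM.symm.scalar_mem] at hcH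
  have hz := hM.tracelessCard_mul
  have hpos := card_scalars_pos (G := G)
  have hcH' : Nat.card H = 12 * Nat.card (scalars G) := by omega
  rw [hcG, hcH'] at hz
  have hz' : 2 * tracelessCard G = tracelessCard H := by
    refine Nat.eq_of_mul_eq_mul_right (Nat.mul_pos (by omega : 0 < 6) hpos) ?_
    linarith
  omega

theorem isDihedralType_eq (hM : IsMatching G H) {n n' : ℕ} (hG : IsDihedralType G n)
    (hH : IsDihedralType H n') : n = n' := by
  obtain ⟨x, hx, hxn, -⟩ := hG.exists_gen
  obtain ⟨x', hx', he⟩ := hM.exists_projOrder hx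
  have h1 := hH.projOrder_eq x' hx'
  obtain ⟨y, hy, hyn, -⟩ := hH.exists_gen
  obtain ⟨y', hy', he'⟩ := hM.symm.exists_projOrder hy
  have h2 := hG.projOrder_eq y' hy'
  rw [he, hxn] at h1
  rw [he', hyn] at h2
  have h3 := hG.two_le
  have h4 := hH.two_le
  rcases h1 with rfl | h1
  · rcases h2 with h2 | h2
    · exact h2.symm
    · have := Nat.le_of_dvd (by norm_num) h2
      omega
  · rcases h2 with rfl | h2
    · have := Nat.le_of_dvd (by norm_num) h1
      omega
    · exact Nat.dvd_antisymm h1 h2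

theorem isExceptionalType_eq (hM : IsMatching G H) {m m' : ℕ} (hG : IsExceptionalType G m)
    (hH : IsExceptionalType H m') : m = m' := by
  obtain ⟨x, hx, hxn⟩ := hG.exists_max
  obtain ⟨x', hx', he⟩ := hM.exists_projOrder hx
  have h1 := hH.projOrder_eq x' hx'
  obtain ⟨y, hy, hyn⟩ := hH.exists_max
  obtain ⟨y', hy', he'⟩ := hM.symm.exists_projOrder hy
  have h2 := hG.projOrder_eq y' hy'
  have := hG.eq_or
  have := hH.eq_or
  omega

theorem exists_map_conj_eq_of_isCyclicType (hM : IsMatching G H)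
    (hG : IsCyclicType G) (hcard : Nat.card G = Nat.card H) [Finite H] :
    ∃ P : GL (Fin 2) E, G.map (MulAut.conj P).toMonoidHom = H := by
  obtain ⟨x, hx, hgen⟩ := hG
  obtain ⟨x', hx', hxx'⟩ := hM.exists_right x hx
  obtain ⟨P, hP⟩ := isConj_iff.1 hxx'
  refine ⟨P, Subgroup.eq_of_le_of_card_ge ?_ ?_⟩
  · rintro - ⟨g, hg, rfl⟩
    obtain ⟨k, z, hz, hzs, rfl⟩ := hgen g hg
    change P * (x ^ k * z) * P⁻¹ ∈ H
    have h1 : P * z = z * P := (Units.ext (hzs.mul_comm P.val)).symm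
    have h2 : P * (x ^ k * z) * P⁻¹ = (P * x * P⁻¹) ^ k * z := by
      have h3 : P * (x ^ k * z) * P⁻¹ = P * x ^ k * P⁻¹ * (P * z * P⁻¹) := by group
      rw [h3, h1, mul_inv_cancel_right, conj_pow]
    rw [h2, hP]
    exact H.mul_mem (H.pow_mem hx' k) (hM.scalar_mem z hz hzs)
  · rw [← hcard]
    exact (Nat.card_congr
      (G.equivMapOfInjective _ (MulAut.conj P).injective).toEquiv).le

theorem IsSemisimpleGroup.mono (hG : IsSemisimpleGroup G) {K : Subgroup (GL (Fin 2) E)}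
    (hK : K ≤ G) : IsSemisimpleGroup K :=
  fun g hg => hG g (hK hg)

theorem not_isCyclicType_of_mul_ne {x y : GL (Fin 2) E} (hx : x ∈ G) (hy : y ∈ G)
    (hxy : x * y ≠ y * x) : ¬ IsCyclicType G := by
  rintro ⟨g, -, hgen⟩
  exact hxy (commute_of_gen hgen x hx y hy)

theorem IsDihedralType.card_eq_of_le [IsAlgClosed E] [Finite G] (hSG : IsSemisimpleGroup G) {n : ℕ}
    (hG : IsDihedralType G n) {x y : GL (Fin 2) E} (hxn : projOrder x = n)
    (hxy : x * y ≠ y * x) {K : Subgroup (GL (Fin 2) E)} (hKG : K ≤ G)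
    (hKs : ∀ z ∈ G, IsScal z.val → z ∈ K) (hx : x ∈ K) (hy : y ∈ K) :
    Nat.card K = Nat.card G := by
  have : Finite K := Finite.of_injective _ (Subgroup.inclusion_injective hKG)
  have hs := card_scalars_eq (fun z hz _ => hKG hz) hKs
  have hn2 := hG.two_le
  rcases classification (hSG.mono hKG) with h | ⟨n', h⟩ | ⟨m, h⟩
  · exact absurd h (not_isCyclicType_of_mul_ne hx hy hxy)
  · rw [h.card_eq, hG.card_eq, hs]
    congr 2
    have h1 := h.projOrder_eq x hx
    rw [hxn] at h1
    obtain ⟨w, hw, hwn, -⟩ := h.exists_gen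
    have h2 := hG.projOrder_eq w (hKG hw)
    rw [hwn] at h2
    have h3 := h.two_le
    rcases h2 with rfl | h2
    · rcases h1 with rfl | h1
      · rfl
      · have := Nat.le_of_dvd (by norm_num) h1
        omega
    · rcases h1 with rfl | h1
      · have := Nat.le_of_dvd (by norm_num) h2
        omega
      · exact Nat.dvd_antisymm h2 h1
  · exfalso
    have h1 := h.projOrder_eq x hx
    rw [hxn] at h1
    obtain ⟨b, hb, hb3⟩ := h.exists_three
    have h3 := hG.projOrder_eq b (hKG hb)
    rw [hb3] at h3
    obtain ⟨c, hc, hcm⟩ := h.exists_max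
    have hm := hG.projOrder_eq c (hKG hc)
    rw [hcm] at hm
    have heq : n = 3 ∧ m = 3 := by
      rcases h.eq_or with rfl | rfl | rfl <;> omega
    obtain ⟨rfl, rfl⟩ := heq
    obtain ⟨w, hw, -, hxw, htr, -⟩ := h.exists_traceless x hx hxn
    exact htr (hG.trace_eq_zero x (hKG hx) hxn.ge w (hKG hw) hxw).2

theorem IsExceptionalType.card_eq_of_le [IsAlgClosed E] [Finite G] (hSG : IsSemisimpleGroup G)
    {m : ℕ} (hG : IsExceptionalType G m) {x y : GL (Fin 2) E} (hxm : projOrder x = m)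
    (hxy : x * y ≠ y * x) (htr : (x.val * y.val).trace ≠ 0) {K : Subgroup (GL (Fin 2) E)}
    (hKG : K ≤ G) (hKs : ∀ z ∈ G, IsScal z.val → z ∈ K) (hx : x ∈ K) (hy : y ∈ K) :
    Nat.card K = Nat.card G := by
  have : Finite K := Finite.of_injective _ (Subgroup.inclusion_injective hKG)
  have hs := card_scalars_eq (fun z hz _ => hKG hz) hKs
  have hm := hG.eq_or
  rcases classification (hSG.mono hKG) with h | ⟨n', h⟩ | ⟨m', h⟩
  · exact absurd h (not_isCyclicType_of_mul_ne hx hy hxy)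
  · exact absurd (h.trace_eq_zero x hx (by omega) y hy hxy).2 htr
  · have h1 := h.projOrder_eq x hx
    obtain ⟨c, hc, hcm⟩ := h.exists_max
    have h2 := hG.projOrder_eq c (hKG hc)
    have h3 := h.eq_or
    obtain rfl : m' = m := by omega
    have h4 := h.card_eq
    have h5 := hG.card_eq
    rw [hs, ← h5] at h4
    exact Nat.eq_of_mul_eq_mul_right (by omega) h4

end Comparison

section Dihedral

variable {E : Type*} [Field E] {G H : Subgroup (GL (Fin 2) E)}

theorem IsDihedralType.exists_not_commute [Finite G] {n : ℕ} (hG : IsDihedralType G n)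
    {x : GL (Fin 2) E} (hs : ¬ IsScal x.val) : ∃ w ∈ G, x * w ≠ w * x := by
  by_contra! hc
  obtain ⟨g, hg, hgn, hgen⟩ := hG.exists_gen
  have h1 := card_eq_of_gen hg fun h hh => hgen h hh (Units.ext
    (commute_of_commute hs (congrArg Units.val (hc g hg)) (congrArg Units.val (hc h hh))))
  have h2 := hG.card_eq
  have h3 : 0 < n * Nat.card (scalars G) :=
    Nat.mul_pos (by have := hG.two_le; omega) card_scalars_pos
  rw [h1, hgn, mul_assoc] at h2
  omega

theorem det_eq_of_scalar_mul_inv {g h : GL (Fin 2) E} :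
    g.val.det = (g * h⁻¹).val.det * h.val.det := by
  rw [← Matrix.det_mul, ← Units.val_mul, inv_mul_cancel_right]

theorem scalar_mul_not_commute {x y z : GL (Fin 2) E} (hz : IsScal z.val)
    (hxy : x * y ≠ y * x) : x * (z * y) ≠ z * y * x := by
  intro h
  have h1 : z * x = x * z := Units.ext (hz.mul_comm _)
  rw [← mul_assoc, ← h1, mul_assoc, mul_assoc] at h
  exact hxy (mul_left_cancel h)

theorem not_isScal_of_not_commute {x y : GL (Fin 2) E} (hxy : x * y ≠ y * x) :
    ¬ IsScal x.val := fun h => hxy (Units.ext (h.mul_comm _))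

theorem exists_map_conj_eq_of_isDihedralType [IsAlgClosed E] [Finite G] [Finite H]
    (hSG : IsSemisimpleGroup G) (hSH : IsSemisimpleGroup H) (hM : IsMatching G H) {n : ℕ}
    (hG : IsDihedralType G n) (hH : IsDihedralType H n) :
    ∃ P : GL (Fin 2) E, G.map (MulAut.conj P).toMonoidHom = H := by
  have hcard : Nat.card G = Nat.card H := by
    rw [hG.card_eq, hH.card_eq, card_scalars_eq hM.scalar_mem hM.symm.scalar_mem]
  suffices h : ∃ x ∈ G, projOrder x = n ∧ ∃ x' ∈ H, IsConj x x' ∧ ∃ y ∈ G, ∃ y' ∈ H,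
      x * y ≠ y * x ∧ y.val.trace = 0 ∧ (x.val * y.val).trace = 0 ∧ y'.val.trace = 0 ∧
        (x'.val * y'.val).trace = 0 ∧ y'.val.det = y.val.det by
    obtain ⟨x, hx, hxn, x', hx', hxx', y, hy, y', hy', hxy, h1, h2, h3, h4, h5⟩ := h
    exact map_conj_eq_of_pair hSG hcard hM.scalar_mem hx hy hx' hy' hxy (trace_eq_of_isConj hxx')
      (det_eq_of_isConj hxx') (h3.trans h1.symm) h5 (h4.trans h2.symm)
      fun K hK hs hxK hyK => hG.card_eq_of_le hSG hxn hxy hK hs hxK hyK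
  have hn2 := hG.two_le
  obtain ⟨x, hx, hxn, hgen⟩ := hG.exists_gen
  obtain ⟨x', hx', hxx'⟩ := hM.exists_right x hx
  have hxn' : projOrder x' = n := by rw [← projOrder_eq_of_isConj hxx', hxn]
  have hxs : ¬ IsScal x.val := by
    rw [isScal_iff_projOrder_eq_one]
    omega
  have hxs' : ¬ IsScal x'.val := by
    rw [isScal_iff_projOrder_eq_one]
    omega
  obtain ⟨w, hw, hxw⟩ := hG.exists_not_commute hxs
  obtain ⟨w', hw', hxw'⟩ := hH.exists_not_commute hxs'
  obtain ⟨h, hh, hwh⟩ := hM.exists_right w hw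
  obtain ⟨g, hg, hwg⟩ := hM.exists_left w' hw'
  rcases Nat.lt_or_ge n 3 with hn3 | hn3
  · obtain rfl : n = 2 := by omega
    have htr : ∀ {K : Subgroup (GL (Fin 2) E)}, IsDihedralType K 2 → ∀ g ∈ K, ¬ IsScal g.val →
        g.val.trace = 0 := by
      intro K hK g hg hs
      refine trace_eq_zero_of_projOrder_eq_two ?_
      rw [isScal_iff_projOrder_eq_one] at hs
      rcases hK.projOrder_eq g hg with h | h
      · exact h
      · exact ((Nat.dvd_prime Nat.prime_two).1 h).resolve_left hs
    have htr2 : ∀ {K : Subgroup (GL (Fin 2) E)}, IsDihedralType K 2 → ∀ a ∈ K, ∀ b ∈ K,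
        a * b ≠ b * a → b.val.trace = 0 ∧ (a.val * b.val).trace = 0 := by
      intro K hK a ha b hb hab
      refine ⟨htr hK b hb (not_isScal_of_not_commute hab.symm), ?_⟩
      rw [← Units.val_mul]
      refine htr hK _ (K.mul_mem ha hb) fun hs => hab ?_
      have h1 : (a * b) * a = a * (a * b) := Units.ext (hs.mul_comm _)
      rw [mul_assoc] at h1
      exact (mul_left_cancel h1).symm
    by_cases hA : ∃ a ∈ G, ∃ b ∈ G, a * b ≠ b * a ∧
        ∀ z ∈ G, IsScal z.val → a.val.det ≠ z.val.det * b.val.det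
    · obtain ⟨a, ha, b, hb, hab, hdet⟩ := hA
      obtain ⟨a', ha', haa'⟩ := hM.exists_right a ha
      obtain ⟨b', hb', hbb'⟩ := hM.exists_right b hb
      have hab2 := htr2 hG a ha b hb hab
      have has := not_isScal_of_not_commute hab
      have hbs := not_isScal_of_not_commute hab.symm
      have hta := htr hG a ha has
      have hbs' : ¬ IsScal b'.val := by
        rwa [isScal_iff_projOrder_eq_one, ← projOrder_eq_of_isConj hbb',
          ← isScal_iff_projOrder_eq_one]
      have hab' : a' * b' ≠ b' * a' := by
        intro hc
        have hs := isScal_mul_inv_of_traceless (hSH b' hb') hbs'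
          ((trace_eq_of_isConj haa').trans hta) ((trace_eq_of_isConj hbb').trans hab2.1) hc
        refine hdet _ (hM.symm.scalar_mem _ (H.mul_mem ha' (H.inv_mem hb')) hs) hs ?_
        rw [← det_eq_of_isConj haa', ← det_eq_of_isConj hbb']
        exact det_eq_of_scalar_mul_inv
      have hab2' := htr2 hH a' ha' b' hb' hab'
      exact ⟨a, ha, projOrder_eq_two has hta, a', ha', haa', b, hb, b', hb', hab, hab2.1, hab2.2,
        hab2'.1, hab2'.2, det_eq_of_isConj hbb'⟩
    · push Not at hA
      have hgs : ¬ IsScal g.val := by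
        rw [isScal_iff_projOrder_eq_one, ← projOrder_eq_of_isConj hwg,
          ← isScal_iff_projOrder_eq_one]
        exact not_isScal_of_not_commute hxw'.symm
      obtain ⟨u, hu, hus, hdu⟩ : ∃ z ∈ G, IsScal z.val ∧ g.val.det = z.val.det * w.val.det := by
        by_cases hc : g * w = w * g
        · have hs := isScal_mul_inv_of_traceless (hSG w hw) (not_isScal_of_not_commute hxw.symm)
            (htr hG g hg hgs) (htr2 hG x hx w hw hxw).1 hc
          exact ⟨_, G.mul_mem hg (G.inv_mem hw), hs, det_eq_of_scalar_mul_inv⟩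
        · exact hA g hg w hw hc
      have hui : IsScal (u⁻¹).val := by
        rw [← mem_center_iff_isScal] at hus ⊢
        exact inv_mem hus
      have huw : u⁻¹ * w' ∈ H := H.mul_mem (hM.scalar_mem _ (G.inv_mem hu) hui) hw'
      have hxy' := htr2 hH x' hx' _ huw (scalar_mul_not_commute hui hxw')
      refine ⟨x, hx, hxn, x', hx', hxx', w, hw, u⁻¹ * w', huw, hxw, (htr2 hG x hx w hw hxw).1,
        (htr2 hG x hx w hw hxw).2, hxy'.1, hxy'.2, ?_⟩
      rw [Units.val_mul, Matrix.det_mul, ← det_eq_of_isConj hwg, hdu, ← mul_assoc,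
        ← Matrix.det_mul, ← Units.val_mul, inv_mul_cancel, Units.val_one, Matrix.det_one, one_mul]
  have hxw2 := hG.trace_eq_zero x hx (hxn ▸ hn3) w hw hxw
  have hxw2' := hH.trace_eq_zero x' hx' (hxn' ▸ hn3) w' hw' hxw'
  by_cases hxh : x' * h ≠ h * x'
  · have h2 := hH.trace_eq_zero x' hx' (hxn' ▸ hn3) h hh hxh
    exact ⟨x, hx, hxn, x', hx', hxx', w, hw, h, hh, hxw, hxw2.1, hxw2.2, h2.1, h2.2,
      det_eq_of_isConj hwh⟩
  by_cases hxg : x * g ≠ g * x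
  · have h2 := hG.trace_eq_zero x hx (hxn ▸ hn3) g hg hxg
    exact ⟨x, hx, hxn, x', hx', hxx', g, hg, w', hw', hxg, h2.1, h2.2, hxw2'.1, hxw2'.2,
      (det_eq_of_isConj hwg).symm⟩
  push Not at hxh hxg
  obtain ⟨P, hP⟩ := isConj_iff.1 hxx'
  obtain ⟨k, z, hz, hzs, hgz⟩ := hgen g hg hxg
  have hk : P * g * P⁻¹ = x' ^ k * z := by
    have h1 : P * z = z * P := (Units.ext (hzs.mul_comm P.val)).symm
    have h3 : P * (x ^ k * z) * P⁻¹ = P * x ^ k * P⁻¹ * (P * z * P⁻¹) := by group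
    rw [hgz, h3, h1, mul_inv_cancel_right, ← conj_pow, hP]
  set g' := P * g * P⁻¹ with hg'
  have hg'H : g' ∈ H := hk ▸ H.mul_mem (H.pow_mem hx' k) (hM.scalar_mem z hz hzs)
  have hxg' : x' * g' = g' * x' := by
    rw [hg', ← hP]
    calc P * x * P⁻¹ * (P * g * P⁻¹) = P * (x * g) * P⁻¹ := by group
      _ = P * g * P⁻¹ * (P * x * P⁻¹) := by rw [hxg]; group
  have htg : g.val.trace = 0 := (trace_eq_of_isConj hwg).trans hxw2'.1
  have hg's : ¬ IsScal g'.val := by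
    rw [hg', isScal_conj_iff, isScal_iff_projOrder_eq_one, ← projOrder_eq_of_isConj hwg,
      ← isScal_iff_projOrder_eq_one]
    exact not_isScal_of_not_commute hxw'.symm
  have hs := isScal_mul_inv_of_traceless (hSH g' hg'H) hg's
    ((trace_eq_of_isConj hwh).trans hxw2.1) ((trace_conj P g).trans htg)
    (Units.ext (commute_of_commute hxs' (congrArg Units.val hxh) (congrArg Units.val hxg')))
  have huw : h * g'⁻¹ * w' ∈ H := H.mul_mem (H.mul_mem hh (H.inv_mem hg'H)) hw'
  have hxy' := hH.trace_eq_zero x' hx' (hxn' ▸ hn3) _ huw (scalar_mul_not_commute hs hxw')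
  refine ⟨x, hx, hxn, x', hx', hxx', w, hw, _, huw, hxw, hxw2.1, hxw2.2, hxy'.1, hxy'.2, ?_⟩
  rw [Units.val_mul, Matrix.det_mul, ← det_eq_of_isConj hwg, ← _root_.det_conj P g,
    ← det_eq_of_scalar_mul_inv, det_eq_of_isConj hwh]

end Dihedral

section Exceptional

variable {E : Type*} [Field E] {G H : Subgroup (GL (Fin 2) E)}

theorem trace_mul_self_mul (X Y : Matrix (Fin 2) (Fin 2) E) :
    (X * X * Y).trace = X.trace * (X * Y).trace - X.det * Y.trace := by
  rw [mul_self_eq, sub_mul, smul_mul_assoc, smul_mul_assoc, one_mul, Matrix.trace_sub,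
    Matrix.trace_smul, Matrix.trace_smul, smul_eq_mul, smul_eq_mul]

theorem smul_one_sub_of (t a b c d : E) :
    t • (1 : Matrix (Fin 2) (Fin 2) E) - !![a, b; c, d] = !![t - a, -b; -c, t - d] := by
  ext i j
  fin_cases i <;> fin_cases j <;> simp

theorem trace_mul_triple_conj {X Y : Matrix (Fin 2) (Fin 2) E} (hY : Y.trace = 0) :
    (X * (Y * (X * X) * Y * ((Y * (X * X)).trace • 1 - Y * (X * X)))).trace =
      -(X * Y).trace * (-Y.det * ((X.trace ^ 2 - 2 * X.det) ^ 2 - 2 * X.det ^ 2) -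
        X.trace ^ 2 * (X * Y).trace ^ 2 + Y.det * X.det ^ 2) := by
  obtain ⟨a, b, c, d, rfl⟩ := exists_entries X
  obtain ⟨p, q, r, s, rfl⟩ := exists_entries Y
  obtain rfl : s = -p := by
    rw [Matrix.trace_fin_two_of] at hY
    linear_combination hY
  simp only [Matrix.mul_fin_two, smul_one_sub_of, Matrix.det_fin_two_of, Matrix.trace_fin_two_of]
  ring

theorem trace_mul_self_mul_mul {X Y : Matrix (Fin 2) (Fin 2) E} (hY : Y.trace = 0) :
    (X * X * Y * (X.trace • 1 - X) * Y).trace =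
      -Y.det * X.trace * (X.trace ^ 2 - 2 * X.det) - X.trace * (X * Y).trace ^ 2 +
        X.det * Y.det * X.trace := by
  obtain ⟨a, b, c, d, rfl⟩ := exists_entries X
  obtain ⟨p, q, r, s, rfl⟩ := exists_entries Y
  obtain rfl : s = -p := by
    rw [Matrix.trace_fin_two_of] at hY
    linear_combination hY
  simp only [Matrix.mul_fin_two, smul_one_sub_of, Matrix.det_fin_two_of, Matrix.trace_fin_two_of]
  ring

theorem trace_mul_conj (A : Matrix (Fin 2) (Fin 2) E) (g y : GL (Fin 2) E) :
    (A * (g * y * g⁻¹).val).trace =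
      g.val.det⁻¹ * (A * (g.val * y.val * (g.val.trace • 1 - g.val))).trace := by
  rw [Units.val_mul, Units.val_mul, coe_inv_eq, mul_smul_comm, mul_smul_comm, Matrix.trace_smul,
    smul_eq_mul]

theorem not_isScal_mul_of_not_commute {x y : GL (Fin 2) E} (hxy : x * y ≠ y * x) :
    ¬ IsScal (x * y).val := by
  intro hs
  have h1 : (x * y) * x = x * (x * y) := Units.ext (hs.mul_comm _)
  rw [mul_assoc] at h1
  exact hxy (mul_left_cancel h1).symm

theorem neg_one_mem_of_traceless {a b : GL (Fin 2) E} (ha : a ∈ G) (hb : b ∈ G)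
    (hta : a.val.trace = 0) (htb : b.val.trace = 0) (htab : (a.val * b.val).trace = 0) :
    -1 ∈ G := by
  have h1 : a * b * (b * a)⁻¹ = -1 := by
    rw [mul_inv_eq_iff_eq_mul]
    refine Units.ext ?_
    have h2 := mul_add_mul_eq a.val b.val
    rw [hta, htb, htab] at h2
    simp only [Units.val_mul, Units.val_neg, neg_mul, one_mul]
    simpa [add_eq_zero_iff_eq_neg] using h2
  exact h1 ▸ G.mul_mem (G.mul_mem ha hb) (G.inv_mem (G.mul_mem hb ha))

theorem trace_sq_of_projOrder_three {g : GL (Fin 2) E} (h : projOrder g = 3) :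
    g.val.trace ^ 2 = g.val.det := by
  refine trace_sq_of_isScal_cube ?_ (isScal_pow_iff.2 h.dvd)
  rw [isScal_iff_projOrder_eq_one]
  omega

theorem trace_sq_of_projOrder_four {g : GL (Fin 2) E} (h : projOrder g = 4) :
    g.val.trace ^ 2 = 2 * g.val.det := by
  refine trace_sq_of_isScal_pow_four ?_ ?_ (isScal_pow_iff.2 h.dvd)
  · rw [isScal_iff_projOrder_eq_one]
    omega
  · rw [isScal_pow_iff, h]
    norm_num

theorem trace_pow_four_of_projOrder_five {g : GL (Fin 2) E} (h : projOrder g = 5) :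
    g.val.trace ^ 4 = 3 * g.val.trace ^ 2 * g.val.det - g.val.det ^ 2 := by
  refine trace_pow_four_of_isScal_pow_five ?_ (isScal_pow_iff.2 h.dvd)
  rw [isScal_iff_projOrder_eq_one]
  omega

theorem not_isScal_sq_mul {x y : GL (Fin 2) E} (hxy : x * y ≠ y * x)
    (hx : x.val.trace ≠ 0) : ¬ IsScal (x * x * y).val := by
  intro hs
  have hx2 : ¬ IsScal (x * x).val := by
    intro h
    refine hx (trace_eq_zero_of_isScal_sq (not_isScal_of_not_commute hxy) ?_)
    rwa [pow_two, ← Units.val_mul]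
  have h1 : (x * x) * y = y * (x * x) := by
    have h2 : (x * x * y) * (x * x) = (x * x) * (x * x * y) := Units.ext (hs.mul_comm _)
    rw [mul_assoc] at h2
    exact (mul_left_cancel h2).symm
  exact hxy (Units.ext (commute_of_commute hx2 (congrArg Units.val (mul_assoc x x x))
    (congrArg Units.val h1)))

theorem IsExceptionalType.trace_ne_zero {m : ℕ} (hG : IsExceptionalType G m)
    {x : GL (Fin 2) E} (hxm : projOrder x = m) : x.val.trace ≠ 0 := by
  intro h
  have hm := hG.eq_or
  have := projOrder_eq_two (g := x) (by rw [isScal_iff_projOrder_eq_one]; omega) h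
  omega

theorem IsExceptionalType.trace_sq_or {m : ℕ} (hG : IsExceptionalType G m) {g : GL (Fin 2) E}
    (hg : g ∈ G) (hs : ¬ IsScal g.val) (ht : g.val.trace ≠ 0) :
    g.val.trace ^ 2 = g.val.det ∨ projOrder g = m := by
  rw [isScal_iff_projOrder_eq_one] at hs
  rcases hG.projOrder_eq g hg with h | h | h | h
  · exact absurd h hs
  · exact absurd (trace_eq_zero_of_projOrder_eq_two h) ht
  · exact Or.inl (trace_sq_of_projOrder_three h)
  · exact Or.inr h

theorem eq_or_mul_eq_of_icosahedral {d e τ t : E} (hd : d ≠ 0) (he : e ≠ 0) (h2 : (2 : E) ≠ 0)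
    (hx : τ ^ 4 = 3 * τ ^ 2 * d - d ^ 2)
    (ht : t ^ 2 = d * e ∨ t ^ 4 = 3 * t ^ 2 * (d * e) - (d * e) ^ 2)
    (hτt : (τ * t) ^ 2 = d ^ 2 * e ∨
      (τ * t) ^ 4 = 3 * (τ * t) ^ 2 * (d ^ 2 * e) - (d ^ 2 * e) ^ 2) :
    t ^ 2 = d * e ∨ τ ^ 2 * t ^ 2 = d ^ 2 * e := by
  obtain ⟨u, hu⟩ : ∃ u, u = τ ^ 2 / d := ⟨_, rfl⟩
  obtain ⟨v, hv⟩ : ∃ v, v = t ^ 2 / (d * e) := ⟨_, rfl⟩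
  have hu' : τ ^ 2 = u * d := by rw [hu]; field_simp
  have hv' : t ^ 2 = v * (d * e) := by rw [hv]; field_simp
  have hde := mul_ne_zero hd he
  have hu1 : u ^ 2 = 3 * u - 1 := by
    refine mul_right_cancel₀ (pow_ne_zero 2 hd) ?_
    linear_combination hx - (τ ^ 2 + u * d - 3 * d) * hu'
  have hv1 : v = 1 ∨ v ^ 2 = 3 * v - 1 := by
    rcases ht with ht | ht
    · refine Or.inl (mul_right_cancel₀ hde ?_)
      linear_combination ht - hv'
    · refine Or.inr (mul_right_cancel₀ (pow_ne_zero 2 hde) ?_)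
      linear_combination ht - (t ^ 2 + v * (d * e) - 3 * (d * e)) * hv'
  have hp : (τ * t) ^ 2 = u * v * (d ^ 2 * e) := by
    rw [mul_pow, hu', hv']
    ring
  have hdde : d ^ 2 * e ≠ 0 := mul_ne_zero (pow_ne_zero 2 hd) he
  have huv1 : u * v = 1 ∨ (u * v) ^ 2 = 3 * (u * v) - 1 := by
    rcases hτt with ht | ht
    · refine Or.inl (mul_right_cancel₀ hdde ?_)
      linear_combination ht - hp
    · refine Or.inr (mul_right_cancel₀ (pow_ne_zero 2 hdde) ?_)
      linear_combination ht - ((τ * t) ^ 2 + u * v * (d ^ 2 * e) - 3 * (d ^ 2 * e)) * hp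
  have main : v = 1 ∨ u * v = 1 := by
    rcases hv1 with h | hv1
    · exact Or.inl h
    refine Or.inr ?_
    have h3 : (u - v) * (u * v - 1) = 0 := by
      have h4 : (u - v) * (u + v - 3) = 0 := by linear_combination hu1 - hv1
      rcases mul_eq_zero.1 h4 with h | h
      · rw [h, zero_mul]
      · have : v = 3 - u := by linear_combination h
        rw [this]
        linear_combination (3 - 2 * u) * hu1
    rcases mul_eq_zero.1 h3 with h | h
    · obtain rfl : u = v := sub_eq_zero.1 h
      rcases huv1 with h | h
      · exact h
      exfalso
      have h6 : 12 * u = 4 := by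
        have : u * u = 3 * u - 1 := by rw [← hu1, pow_two]
        rw [this] at h
        linear_combination h - 9 * hu1
      have h7 : (2 : E) * 2 * (3 * u - 1) = 0 := by linear_combination h6
      have h8 : 3 * u - 1 = 0 := by
        simpa [h2] using h7
      rw [h8] at hu1
      have h9 : u = 0 := by simpa using hu1
      rw [h9] at h8
      norm_num at h8
    · exact sub_eq_zero.1 h
  rcases main with h | h
  · left; rw [hv', h, one_mul]
  · right; rw [← mul_pow, hp, h, one_mul]

theorem two_ne_zero_of_traceless (hG : IsSemisimpleGroup G) {y : GL (Fin 2) E} (hy : y ∈ G)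
    (hs : ¬ IsScal y.val) (hy0 : y.val.trace = 0) : (2 : E) ≠ 0 := by
  intro h
  refine hs (hG y hy ?_)
  rw [hy0]
  linear_combination (-2 * y.val.det) * h

/-- A traceless `y ∈ G` such that `x * y` has projective order `3`, in the form in which traces
determine the pair `(x, y)` up to conjugation and sign. -/
theorem IsExceptionalType.exists_traceless_trace_sq (hSG : IsSemisimpleGroup G) {m : ℕ}
    (hG : IsExceptionalType G m) {x : GL (Fin 2) E} (hx : x ∈ G) (hxm : projOrder x = m) :
    ∃ y ∈ G, y.val.trace = 0 ∧ x * y ≠ y * x ∧ (x.val * y.val).trace ≠ 0 ∧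
      (x.val * y.val).trace ^ 2 = x.val.det * y.val.det ∧
      ∀ w ∈ G, w.val.trace = 0 → ¬ IsScal w.val → ∃ z ∈ G, IsScal z.val ∧
        (w.val.det = z.val.det * y.val.det ∨ m = 4 ∧ w.val.det = z.val.det * x.val.det ^ 2) := by
  obtain ⟨y, hy, hy0, hxy, hxy0, hw⟩ := hG.exists_traceless x hx hxm
  have hτ0 := hG.trace_ne_zero hxm
  have hys := not_isScal_of_not_commute hxy.symm
  have h2 := two_ne_zero_of_traceless hSG hy hys hy0
  have hvxy : (x * y).val = x.val * y.val := Units.val_mul _ _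
  have hor := hG.trace_sq_or (G.mul_mem hx hy) (not_isScal_mul_of_not_commute hxy)
    (by rwa [hvxy])
  rw [hvxy, Matrix.det_mul] at hor
  have ht2 : (x * x * y).val.trace = x.val.trace * (x.val * y.val).trace := by
    rw [Units.val_mul, Units.val_mul, trace_mul_self_mul, hy0, mul_zero, sub_zero]
  have hd2 : (x * x * y).val.det = x.val.det ^ 2 * y.val.det := by
    rw [Units.val_mul, Units.val_mul, Matrix.det_mul, Matrix.det_mul]
    ring
  have hs2 := not_isScal_sq_mul hxy hτ0
  have hG2 : x * x * y ∈ G := G.mul_mem (G.mul_mem hx hx) hy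
  rcases hor with h | h
  · exact ⟨y, hy, hy0, hxy, hxy0, h, hw⟩
  rcases hG.eq_or with rfl | rfl | rfl
  · have := trace_sq_of_projOrder_three h
    rw [hvxy, Matrix.det_mul] at this
    exact ⟨y, hy, hy0, hxy, hxy0, this, hw⟩
  · exfalso
    have h4 := trace_sq_of_projOrder_four h
    have h4' := trace_sq_of_projOrder_four hxm
    rw [hvxy, Matrix.det_mul] at h4
    refine hs2 (hSG _ hG2 ?_)
    rw [ht2, hd2, mul_pow, h4, h4']
    ring
  have h5 := trace_pow_four_of_projOrder_five h
  have h5' := trace_pow_four_of_projOrder_five hxm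
  rw [hvxy, Matrix.det_mul] at h5
  have h5'' := hG.trace_sq_or hG2 hs2 (by rw [ht2]; exact mul_ne_zero hτ0 hxy0)
  replace h5'' := h5''.imp id trace_pow_four_of_projOrder_five
  rw [ht2, hd2] at h5''
  have hd := det_ne_zero x
  have he := det_ne_zero y
  rcases eq_or_mul_eq_of_icosahedral hd he h2 h5' (Or.inr h5) h5'' with h6 | h6
  · exact ⟨y, hy, hy0, hxy, hxy0, h6, hw⟩
  set g := y * (x * x) with hg
  have hgG : g ∈ G := G.mul_mem hy (G.mul_mem hx hx)
  have hdg : g.val.det = y.val.det * x.val.det ^ 2 := by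
    rw [hg, Units.val_mul, Units.val_mul, Matrix.det_mul, Matrix.det_mul, pow_two]
  have htr : (x.val * (g * y * g⁻¹).val).trace * x.val.det =
      -(x.val * y.val).trace * (x.val.trace ^ 2 - x.val.det) := by
    rw [trace_mul_conj, hdg, hg, Units.val_mul, Units.val_mul, trace_mul_triple_conj hy0]
    field_simp
    linear_combination y.val.det * h5' + h6
  have hsq : (x.val * (g * y * g⁻¹).val).trace ^ 2 = x.val.det * y.val.det := by
    refine mul_right_cancel₀ (pow_ne_zero 2 hd) ?_
    rw [← mul_pow, htr]
    linear_combination (x.val * y.val).trace ^ 2 * h5' + x.val.det * h6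
  have hy'0 := (trace_conj g y).trans hy0
  have hy'd := _root_.det_conj g y
  refine ⟨g * y * g⁻¹, G.mul_mem (G.mul_mem hgG hy) (G.inv_mem hgG), hy'0, ?_, ?_,
    hsq.trans (by rw [hy'd]), ?_⟩
  · intro hc
    have hc' : x.val * (g * y * g⁻¹).val = (g * y * g⁻¹).val * x.val := congrArg Units.val hc
    have h7 := det_mul_sub_mul x.val (g * y * g⁻¹).val
    rw [sub_eq_zero.2 hc', hy'0, hsq, hy'd] at h7
    have h8 : y.val.det * (3 * x.val.det - x.val.trace ^ 2) = 0 := by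
      simp at h7
      linear_combination -h7
    have h9 : x.val.trace ^ 2 = 3 * x.val.det := by
      linear_combination -(mul_eq_zero.1 h8).resolve_left he
    refine pow_ne_zero 2 hd ?_
    linear_combination h5' - (x.val.trace ^ 2) * h9
  · intro h0
    rw [h0] at hsq
    exact mul_ne_zero hd he (by rw [← hsq]; ring)
  · rwa [hy'd]

theorem IsExceptionalType.neg_one_mem {m : ℕ}
    (hG : IsExceptionalType G m) {x y : GL (Fin 2) E} (hx : x ∈ G) (hxm : projOrder x = m)
    (hy : y ∈ G) (hy0 : y.val.trace = 0)
    (ht : (x.val * y.val).trace ^ 2 = x.val.det * y.val.det) : -1 ∈ G := by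
  have hd := det_ne_zero x
  have he := det_ne_zero y
  have hconj : ∀ g ∈ G, ∀ w ∈ G, g * w * g⁻¹ ∈ G := fun g hg w hw =>
    G.mul_mem (G.mul_mem hg hw) (G.inv_mem hg)
  rcases hG.eq_or with rfl | rfl | rfl
  · have h3 := trace_sq_of_projOrder_three hxm
    refine neg_one_mem_of_traceless hy (hconj x hx y hy) hy0 ((trace_conj x y).trans hy0) ?_
    rw [trace_mul_conj, trace_mul_conj_mul hy0, ht, h3]
    ring
  · have h4 := trace_sq_of_projOrder_four hxm
    have hx2 : (x * x).val.trace = 0 := by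
      rw [Units.val_mul, mul_self_eq]
      simp [Matrix.trace_smul, Matrix.trace_one]
      linear_combination h4
    refine neg_one_mem_of_traceless (G.mul_mem hx hx) (hconj y hy _ (G.mul_mem hx hx)) hx2
      ((trace_conj y (x * x)).trans hx2) ?_
    rw [trace_mul_conj, trace_mul_conj_mul hx2, hy0, Units.val_mul, Matrix.trace_mul_comm,
      trace_mul_self_mul, Matrix.det_mul, hy0]
    have : (x.val.trace * (x.val * y.val).trace) ^ 2 = 2 * x.val.det * (x.val.det * y.val.det) := by
      rw [mul_pow, h4, ht]
    rw [mul_zero, sub_zero, this]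
    ring
  · have h5 := trace_pow_four_of_projOrder_five hxm
    set g := x * x * y * x⁻¹ with hg
    have hgG : g ∈ G := G.mul_mem (G.mul_mem (G.mul_mem hx hx) hy) (G.inv_mem hx)
    have hgt : g.val.trace = (x.val * y.val).trace := by
      rw [← Units.val_mul, ← trace_conj x (x * y), hg, ← mul_assoc x x y]
    have hgd : g.val.det = x.val.det * y.val.det := by
      rw [← Matrix.det_mul, ← Units.val_mul, ← _root_.det_conj x (x * y), hg, ← mul_assoc x x y]
    have hgy : (g.val * y.val).trace * x.val.det =
        x.val.trace * y.val.det * (2 * x.val.det - x.val.trace ^ 2) := by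
      have h1 := trace_mul_self_mul_mul (X := x.val) hy0
      rw [hg, Units.val_mul, Units.val_mul, Units.val_mul, coe_inv_eq, mul_smul_comm,
        smul_mul_assoc, Matrix.trace_smul, h1, ht, smul_eq_mul]
      field_simp
      ring
    refine neg_one_mem_of_traceless hy (hconj g hgG y hy) hy0 ((trace_conj g y).trans hy0) ?_
    rw [trace_mul_conj, trace_mul_conj_mul hy0, hgt, hgd, ht]
    refine mul_eq_zero_of_right _ (mul_right_cancel₀ (pow_ne_zero 2 hd) ?_)
    rw [sub_mul, ← mul_pow, hgy]
    linear_combination (-y.val.det ^ 2 * (x.val.trace ^ 2 - x.val.det)) * h5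

theorem exists_map_conj_eq_of_isExceptionalType [IsAlgClosed E] [Finite G] [Finite H]
    (hSG : IsSemisimpleGroup G) (hSH : IsSemisimpleGroup H) (hM : IsMatching G H) {m : ℕ}
    (hG : IsExceptionalType G m) (hH : IsExceptionalType H m) :
    ∃ P : GL (Fin 2) E, G.map (MulAut.conj P).toMonoidHom = H := by
  have hm := hG.eq_or
  have hcard : Nat.card G = Nat.card H := by
    refine Nat.eq_of_mul_eq_mul_right (by omega : 0 < 6 - m) ?_
    rw [hG.card_eq, hH.card_eq, card_scalars_eq hM.scalar_mem hM.symm.scalar_mem]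
  obtain ⟨x, hx, hxm⟩ := hG.exists_max
  obtain ⟨x', hx', hxx'⟩ := hM.exists_right x hx
  have hxm' : projOrder x' = m := by rw [← projOrder_eq_of_isConj hxx', hxm]
  obtain ⟨y, hy, hy0, hxy, hxy0, hsq, hw⟩ := hG.exists_traceless_trace_sq hSG hx hxm
  obtain ⟨y', hy', hy0', hxy', hxy0', hsq', hw'⟩ := hH.exists_traceless_trace_sq hSH hx' hxm'
  have hdx := det_eq_of_isConj hxx'
  obtain ⟨s, hs, hss, hds⟩ : ∃ s ∈ H, IsScal s.val ∧ y.val.det = s.val.det * y'.val.det := by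
    have hscal : ∀ {K L : Subgroup (GL (Fin 2) E)}, IsMatching K L → ∀ y ∈ K, ¬ IsScal y.val →
        y.val.trace = 0 → ∃ h ∈ L, h.val.trace = 0 ∧ ¬ IsScal h.val ∧ h.val.det = y.val.det := by
      intro K L hKL y hy hs hy0
      obtain ⟨h, hh, hyh⟩ := hKL.exists_right y hy
      refine ⟨h, hh, (trace_eq_of_isConj hyh).trans hy0, ?_, det_eq_of_isConj hyh⟩
      rwa [isScal_iff_projOrder_eq_one, ← projOrder_eq_of_isConj hyh,
        ← isScal_iff_projOrder_eq_one]
    obtain ⟨h, hh, hh0, hhs, hhd⟩ := hscal hM y hy (not_isScal_of_not_commute hxy.symm) hy0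
    obtain ⟨g, hg, hg0, hgs, hgd⟩ :=
      hscal hM.symm y' hy' (not_isScal_of_not_commute hxy'.symm) hy0'
    obtain ⟨z, hz, hzs, hzd⟩ := hw' h hh hh0 hhs
    obtain ⟨u, hu, hus, hud⟩ := hw g hg hg0 hgs
    rw [hhd] at hzd
    rw [hgd] at hud
    have hinv : ∀ v : GL (Fin 2) E, IsScal v.val → IsScal (v⁻¹).val := fun v hv => by
      rw [← mem_center_iff_isScal] at hv ⊢
      exact inv_mem hv
    have hdinv : (u⁻¹).val.det * u.val.det = 1 := by
      rw [← Matrix.det_mul, ← Units.val_mul, inv_mul_cancel, Units.val_one, Matrix.det_one]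
    have huH : u⁻¹ ∈ H := hM.scalar_mem _ (G.inv_mem hu) (hinv u hus)
    rcases hzd with hzd | ⟨h4, hzd⟩
    · exact ⟨z, hz, hzs, hzd⟩
    rcases hud with hud | ⟨-, hud⟩
    · refine ⟨u⁻¹, huH, hinv u hus, ?_⟩
      rw [hud, ← mul_assoc, hdinv, one_mul]
    · refine ⟨z * u⁻¹, H.mul_mem hz huH, ?_, ?_⟩
      · rw [← mem_center_iff_isScal] at hzs ⊢
        exact mul_mem hzs (mem_center_iff_isScal.2 (hinv u hus))
      · rw [hzd, hud, Units.val_mul, Matrix.det_mul, hdx, mul_assoc, ← mul_assoc (u⁻¹).val.det,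
          hdinv, one_mul]
  have hneg : (-1 : GL (Fin 2) E) ∈ H := hH.neg_one_mem hx' hxm' hy' hy0' hsq'
  obtain ⟨c, hc⟩ := hss
  have hsy0 : (s * y').val.trace = 0 := by
    rw [Units.val_mul, hc, smul_mul_assoc, one_mul, Matrix.trace_smul, hy0', smul_zero]
  have hsyd : (s * y').val.det = y.val.det := by
    rw [Units.val_mul, Matrix.det_mul, hds]
  have hsyt : (x'.val * (s * y').val).trace ^ 2 = (x.val * y.val).trace ^ 2 := by
    have hsd : s.val.det = c ^ 2 := by
      rw [hc, Matrix.det_smul, Matrix.det_one, Fintype.card_fin, mul_one]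
    rw [hsq, ← hdx, hds, hsd, Units.val_mul, hc, smul_mul_assoc, one_mul, mul_smul_comm,
      Matrix.trace_smul, smul_eq_mul, mul_pow, hsq']
    ring
  obtain ⟨w, hwH, hw0, hwd, hwt⟩ : ∃ w ∈ H, w.val.trace = 0 ∧ w.val.det = y.val.det ∧
      (x'.val * w.val).trace = (x.val * y.val).trace := by
    rcases sq_eq_sq_iff_eq_or_eq_neg.1 hsyt with h | h
    · exact ⟨s * y', H.mul_mem hs hy', hsy0, hsyd, h⟩
    · refine ⟨-1 * (s * y'), H.mul_mem hneg (H.mul_mem hs hy'), ?_, ?_, ?_⟩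
      · rw [neg_one_mul, Units.val_neg, Matrix.trace_neg, hsy0, neg_zero]
      · rw [neg_one_mul, Units.val_neg, Matrix.det_neg, hsyd]
        simp
      · rw [neg_one_mul, Units.val_neg, mul_neg, Matrix.trace_neg, h, neg_neg]
  exact map_conj_eq_of_pair hSG hcard hM.scalar_mem hx hy hx' hwH hxy (trace_eq_of_isConj hxx') hdx
    (hw0.trans hy0.symm) hwd hwt
    fun K hK hs hxK hyK => hG.card_eq_of_le hSG hxm hxy hxy0 hK hs hxK hyK

/-- Matching semisimple groups are conjugate. -/
theorem exists_map_conj_eq [IsAlgClosed E] [Finite G] [Finite H]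
    (hSG : IsSemisimpleGroup G) (hSH : IsSemisimpleGroup H) (hM : IsMatching G H) :
    ∃ P : GL (Fin 2) E, G.map (MulAut.conj P).toMonoidHom = H := by
  rcases classification hSG with hG | ⟨n, hG⟩ | ⟨m, hG⟩ <;>
    rcases classification hSH with hH | ⟨n', hH⟩ | ⟨m', hH⟩
  · refine exists_map_conj_eq_of_isCyclicType hM hG ?_
    obtain ⟨x, hx, hgen⟩ := hG
    obtain ⟨y, hy, hgen'⟩ := hH
    obtain ⟨x', hx', hxx'⟩ := hM.exists_projOrder hx
    obtain ⟨y', hy', hyy'⟩ := hM.symm.exists_projOrder hy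
    rw [card_eq_of_gen hx hgen, card_eq_of_gen hy hgen',
      card_scalars_eq hM.scalar_mem hM.symm.scalar_mem,
      Nat.dvd_antisymm (hxx'.symm.dvd.trans (projOrder_dvd_of_gen hgen' hx'))
        (hyy'.symm.dvd.trans (projOrder_dvd_of_gen hgen hy'))]
  · exact absurd hH (not_isDihedralType_of_isCyclicType hSG hM hG)
  · exact absurd hH (not_isExceptionalType_of_isCyclicType hM hG)
  · exact absurd hG (not_isDihedralType_of_isCyclicType hSH hM.symm hH)
  · obtain rfl := isDihedralType_eq hM hG hH
    exact exists_map_conj_eq_of_isDihedralType hSG hSH hM hG hH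
  · exact absurd hH (not_isExceptionalType_of_isDihedralType hM hG)
  · exact absurd hG (not_isExceptionalType_of_isCyclicType hM.symm hH)
  · exact absurd hG (not_isExceptionalType_of_isDihedralType hM.symm hH)
  · obtain rfl := isExceptionalType_eq hM hG hH
    exact exists_map_conj_eq_of_isExceptionalType hSG hSH hM hG hH

end Exceptional

section Descent

variable {F : Type*} [Field F]

theorem isConj_of_isScal_iff {g h : GL (Fin 2) F} (hs : IsScal g.val ↔ IsScal h.val)
    (ht : g.val.trace = h.val.trace) (hd : g.val.det = h.val.det) : IsConj g h := by
  by_cases hg : IsScal g.val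
  · obtain ⟨a, ha⟩ := hg
    obtain ⟨b, hb⟩ := hs.1 ⟨a, ha⟩
    have hab : a = b := by
      rw [ha, hb] at ht hd
      simp at ht hd
      rcases ht with ht | ht
      · exact ht
      have : (a - b) * (a - b) = 0 := by linear_combination hd + (b ^ 2 - a * b) * ht
      exact sub_eq_zero.1 (mul_self_eq_zero.1 this)
    rw [Units.ext (ha.trans (hab ▸ hb.symm))]
  · exact isConj_of_trace_det hg (fun h => hg (hs.2 h)) ht hd

variable {E : Type*} [Field E] (f : F →+* E)

theorem trace_val_map (g : GL (Fin 2) F) :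
    (Matrix.GeneralLinearGroup.map f g).val.trace = f g.val.trace := by
  simp [Matrix.trace_fin_two]

theorem det_val_map (g : GL (Fin 2) F) :
    (Matrix.GeneralLinearGroup.map f g).val.det = f g.val.det := by
  simp [Matrix.det_fin_two]

theorem isScal_map_iff (g : GL (Fin 2) F) :
    IsScal (Matrix.GeneralLinearGroup.map f g).val ↔ IsScal g.val := by
  simp [isScal_iff, f.injective.eq_iff]

theorem generalLinearGroup_map_injective :
    Function.Injective (Matrix.GeneralLinearGroup.map (n := Fin 2) f) := by
  intro g h hgh
  ext i j
  have h : (Matrix.GeneralLinearGroup.map f g).val i j =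
    (Matrix.GeneralLinearGroup.map f h).val i j := by rw [hgh]
  exact f.injective (by simpa using h)

variable {G H : Subgroup (GL (Fin 2) F)}

theorem IsSemisimpleGroup.map (hG : IsSemisimpleGroup G) :
    IsSemisimpleGroup (G.map (Matrix.GeneralLinearGroup.map f)) := by
  rintro _ ⟨g, hg, rfl⟩ h
  rw [isScal_map_iff]
  rw [trace_val_map, det_val_map] at h
  exact hG g hg (f.injective (by simpa [map_ofNat f 4] using h))

theorem tracelessCard_map :
    tracelessCard (G.map (Matrix.GeneralLinearGroup.map f)) = tracelessCard G :=
  (Nat.card_congr ((G.equivMapOfInjective _ (generalLinearGroup_map_injective f)).toEquiv.subtypeEquiv fun g => by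
    change _ ↔ (Matrix.GeneralLinearGroup.map f g.val).val.trace = 0
    rw [trace_val_map, map_eq_zero])).symm

theorem IsMatching.map (h : IsMatching G H) :
    IsMatching (G.map (Matrix.GeneralLinearGroup.map f))
      (H.map (Matrix.GeneralLinearGroup.map f)) where
  exists_right := by
    rintro _ ⟨g, hg, rfl⟩
    obtain ⟨w, hw, hgw⟩ := h.exists_right g hg
    exact ⟨_, ⟨w, hw, rfl⟩, (Matrix.GeneralLinearGroup.map f).map_isConj hgw⟩
  exists_left := by
    rintro _ ⟨g, hg, rfl⟩
    obtain ⟨w, hw, hgw⟩ := h.exists_left g hg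
    exact ⟨_, ⟨w, hw, rfl⟩, (Matrix.GeneralLinearGroup.map f).map_isConj hgw⟩
  tracelessCard_mul := by
    rw [tracelessCard_map, tracelessCard_map,
      ← Nat.card_congr (G.equivMapOfInjective _ (generalLinearGroup_map_injective f)).toEquiv,
      ← Nat.card_congr (H.equivMapOfInjective _ (generalLinearGroup_map_injective f)).toEquiv]
    exact h.tracelessCard_mul

theorem exists_mulEquiv_of_isSemisimpleGroup [Finite G] [Finite H]
    (hSG : IsSemisimpleGroup G) (hSH : IsSemisimpleGroup H) (hM : IsMatching G H) :
    ∃ e : G ≃* H, ∀ g : G, IsConj g.val (e g).val := by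
  let f := algebraMap F (AlgebraicClosure F)
  let ι := Matrix.GeneralLinearGroup.map (n := Fin 2) f
  let eG := G.equivMapOfInjective ι (generalLinearGroup_map_injective f)
  let eH := H.equivMapOfInjective ι (generalLinearGroup_map_injective f)
  have := Finite.of_equiv _ eG.toEquiv
  have := Finite.of_equiv _ eH.toEquiv
  obtain ⟨P, hP⟩ := exists_map_conj_eq (hSG.map f) (hSH.map f) (hM.map f)
  let eP := (G.map ι).equivMapOfInjective (MulAut.conj P).toMonoidHom (MulAut.conj P).injective
  refine ⟨((eG.trans eP).trans (MulEquiv.subgroupCongr hP)).trans eH.symm, fun g => ?_⟩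
  set h := (((eG.trans eP).trans (MulEquiv.subgroupCongr hP)).trans eH.symm) g
  have key : P * ι g.val * P⁻¹ = ι h.val := by
    have h1 : eH h = (MulEquiv.subgroupCongr hP) (eP (eG g)) :=
      eH.apply_symm_apply _
    exact (congrArg Subtype.val h1).symm
  have hc : IsConj (ι g.val) (ι h.val) := isConj_iff.2 ⟨P, key⟩
  refine isConj_of_isScal_iff ?_ (f.injective ?_) (f.injective ?_)
  · rw [← isScal_map_iff f g.val, ← isScal_map_iff f h.val, isScal_iff_projOrder_eq_one,
      isScal_iff_projOrder_eq_one, projOrder_eq_of_isConj hc]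
  · rw [← trace_val_map, ← trace_val_map]
    exact (trace_eq_of_isConj hc).symm
  · rw [← det_val_map, ← det_val_map]
    exact (det_eq_of_isConj hc).symm

end Descent

section Unipotent

open Matrix.GeneralLinearGroup (upperRightHom)

variable {F : Type*} [Field F]

theorem val_upperRightHom (x : F) : (upperRightHom x).val = !![1, x; 0, 1] := rfl

theorem not_isScal_upperRightHom_one : ¬ IsScal (upperRightHom (1 : F)).val := by
  simp [isScal_iff]

/-- A matrix group which contains all upper triangular unipotent matrices and a matrix that is not
upper triangular contains the special linear group. -/
theorem mem_of_det_eq_one {G : Subgroup (GL (Fin 2) F)} (hU : ∀ x : F, upperRightHom x ∈ G)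
    {g : GL (Fin 2) F} (hg : g ∈ G) (hg0 : g.val 1 0 ≠ 0) {s : GL (Fin 2) F}
    (hs : s.val.det = 1) : s ∈ G := by
  have hdet := det_ne_zero g
  obtain ⟨w, hw, b, c, hbc, hwv⟩ : ∃ w ∈ G, ∃ b c : F, b * c ≠ 0 ∧ w.val = !![0, b; c, 0] := by
    refine ⟨upperRightHom (-(g.val 0 0 / g.val 1 0)) * g * upperRightHom (-(g.val 1 1 / g.val 1 0)),
      G.mul_mem (G.mul_mem (hU _) hg) (hU _), -(g.val.det / g.val 1 0), g.val 1 0, ?_, ?_⟩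
    · rw [neg_mul, div_mul_cancel₀ _ hg0]
      exact neg_ne_zero.2 hdet
    · rw [Units.val_mul, Units.val_mul, val_upperRightHom, val_upperRightHom, Matrix.det_fin_two]
      generalize g.val = A at hg0
      obtain ⟨p, q, r, t, rfl⟩ := exists_entries A
      simp at hg0
      ext i j
      fin_cases i <;> fin_cases j <;> simp [Matrix.mul_apply, Fin.sum_univ_two] <;> field_simp <;>
        ring
  have hL : ∀ y : F, ∃ l ∈ G, l.val = !![1, 0; y, 1] := by
    intro y
    refine ⟨w * upperRightHom (y * b / c) * w⁻¹,
      G.mul_mem (G.mul_mem hw (hU _)) (G.inv_mem hw), ?_⟩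
    rw [Units.val_mul, Units.val_mul, coe_inv_eq, hwv, val_upperRightHom]
    have hb := left_ne_zero_of_mul hbc
    have hc := right_ne_zero_of_mul hbc
    ext i j
    fin_cases i <;> fin_cases j <;>
      simp [Matrix.mul_apply, Fin.sum_univ_two, Matrix.det_fin_two, Matrix.trace_fin_two] <;>
      field_simp
  have key : ∀ s : GL (Fin 2) F, s.val.det = 1 → s.val 1 0 ≠ 0 → s ∈ G := by
    intro s hs hs0
    obtain ⟨l, hl, hlv⟩ := hL (s.val 1 0)
    suffices s = upperRightHom ((s.val 0 0 - 1) / s.val 1 0) * l *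
        upperRightHom ((s.val 1 1 - 1) / s.val 1 0) by
      rw [this]
      exact G.mul_mem (G.mul_mem (hU _) hl) (hU _)
    apply Units.ext
    rw [Units.val_mul, Units.val_mul, hlv, val_upperRightHom, val_upperRightHom]
    generalize s.val = A at hs hs0
    obtain ⟨p, q, r, t, rfl⟩ := exists_entries A
    simp [Matrix.det_fin_two] at hs hs0
    ext i j
    fin_cases i <;> fin_cases j <;> simp [Matrix.mul_apply, Fin.sum_univ_two] <;> field_simp
    · ring
    · linear_combination -hs
    · ring
  by_cases hs0 : s.val 1 0 = 0
  · obtain ⟨l, hl, hlv⟩ := hL 1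
    refine (Subgroup.mul_mem_cancel_left G hl).1 (key _ ?_ ?_)
    · rw [Units.val_mul, Matrix.det_mul, hs, hlv]
      simp
    · rw [Units.val_mul, hlv]
      rw [Matrix.det_fin_two, hs0, mul_zero, sub_zero] at hs
      simpa [Matrix.mul_apply, Fin.sum_univ_two, hs0] using left_ne_zero_of_mul_eq_one hs
  · exact key s hs hs0

/-- `(a, d)` is the diagonal of an element of `G`. -/
def IsDiagonalOf (G : Subgroup (GL (Fin 2) F)) (a d : F) : Prop :=
  ∃ g ∈ G, g.val 0 0 = a ∧ g.val 1 1 = d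

section Borel

variable {G H : Subgroup (GL (Fin 2) F)}

theorem mem_of_isDiagonalOf (hU : ∀ x : F, upperRightHom x ∈ G) (hB : ∀ g ∈ G, g.val 1 0 = 0)
    {g : GL (Fin 2) F} (hg : g.val 1 0 = 0) (hD : IsDiagonalOf G (g.val 0 0) (g.val 1 1)) :
    g ∈ G := by
  obtain ⟨k, hk, hk0, hk1⟩ := hD
  have h0 : g.val 0 0 ≠ 0 := by
    have := det_ne_zero g
    rw [Matrix.det_fin_two, hg, mul_zero, sub_zero] at this
    exact left_ne_zero_of_mul this
  suffices g = k * upperRightHom ((g.val 0 1 - k.val 0 1) / g.val 0 0) by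
    rw [this]
    exact G.mul_mem hk (hU _)
  apply Units.ext
  have hk10 := hB k hk
  rw [Units.val_mul, val_upperRightHom]
  ext i j
  fin_cases i <;> fin_cases j <;> simp [Matrix.mul_apply, Fin.sum_univ_two, hk0, hk1, hk10, hg]
  field_simp
  ring

theorem IsDiagonalOf.mul (hB : ∀ g ∈ G, g.val 1 0 = 0) {a d a' d' : F} (h : IsDiagonalOf G a d)
    (h' : IsDiagonalOf G a' d') : IsDiagonalOf G (a * a') (d * d') := by
  obtain ⟨g, hg, rfl, rfl⟩ := h
  obtain ⟨k, hk, rfl, rfl⟩ := h'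
  refine ⟨g * k, G.mul_mem hg hk, ?_, ?_⟩ <;>
    simp [Matrix.mul_apply, Fin.sum_univ_two, hB g hg, hB k hk]

theorem IsDiagonalOf.of_mul (hB : ∀ g ∈ G, g.val 1 0 = 0) {a d a' d' : F}
    (h : IsDiagonalOf G (a * a') (d * d')) (h' : IsDiagonalOf G a' d') : IsDiagonalOf G a d := by
  obtain ⟨g, hg, hg0, hg1⟩ := h
  obtain ⟨k, hk, rfl, rfl⟩ := h'
  have hdet := det_ne_zero k
  have hk10 := hB k hk
  rw [Matrix.det_fin_two, hk10, mul_zero, sub_zero] at hdet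
  have h0 := left_ne_zero_of_mul hdet
  have h1 := right_ne_zero_of_mul hdet
  refine ⟨g * k⁻¹, G.mul_mem hg (G.inv_mem hk), ?_, ?_⟩ <;>
    rw [Units.val_mul, coe_inv_eq] <;>
    simp [Matrix.mul_apply, Fin.sum_univ_two, Matrix.det_fin_two, Matrix.trace_fin_two, hB g hg,
      hk10, hg0, hg1] <;> field_simp

/-- Every element of `G` has the determinant and trace of some element of `H`, where the identity
corresponds to the identity only. -/
def ClassesIn (G H : Subgroup (GL (Fin 2) F)) : Prop :=
  ∀ g ∈ G, ∃ h ∈ H, h.val.det = g.val.det ∧ h.val.trace = g.val.trace ∧ (h = 1 ↔ g = 1)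

theorem ClassesIn.isDiagonalOf (hC : ClassesIn G H) (hBG : ∀ g ∈ G, g.val 1 0 = 0)
    (hBH : ∀ h ∈ H, h.val 1 0 = 0) {a d : F} (h : IsDiagonalOf G a d) :
    IsDiagonalOf H a d ∨ IsDiagonalOf H d a := by
  obtain ⟨g, hg, rfl, rfl⟩ := h
  obtain ⟨k, hk, hd, ht, -⟩ := hC g hg
  rw [Matrix.det_fin_two, Matrix.det_fin_two, hBG g hg, hBH k hk, mul_zero, mul_zero, sub_zero,
    sub_zero] at hd
  rw [Matrix.trace_fin_two, Matrix.trace_fin_two] at ht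
  have : (k.val 0 0 - g.val 0 0) * (k.val 0 0 - g.val 1 1) = 0 := by
    linear_combination k.val 0 0 * ht - hd
  rcases mul_eq_zero.1 this with h | h
  · exact Or.inl ⟨k, hk, sub_eq_zero.1 h, by linear_combination ht - h⟩
  · exact Or.inr ⟨k, hk, sub_eq_zero.1 h, by linear_combination ht - h⟩

theorem ClassesIn.isDiagonalOf_or (hC : ClassesIn G H) (hBG : ∀ g ∈ G, g.val 1 0 = 0)
    (hBH : ∀ h ∈ H, h.val 1 0 = 0) :
    (∀ a d, IsDiagonalOf G a d → IsDiagonalOf H a d) ∨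
      ∀ a d, IsDiagonalOf G a d → IsDiagonalOf H d a := by
  by_contra! hcon
  obtain ⟨⟨a, d, h1, h1'⟩, a', d', h2, h2'⟩ := hcon
  have h1'' := (hC.isDiagonalOf hBG hBH h1).resolve_left h1'
  have h2'' := (hC.isDiagonalOf hBG hBH h2).resolve_right h2'
  rcases hC.isDiagonalOf hBG hBH (h1.mul hBG h2) with h | h
  · exact h1' (h.of_mul hBH h2'')
  · rw [mul_comm d, mul_comm a] at h
    exact h2' (h.of_mul hBH h1'')

theorem ClassesIn.isDiagonalOf_iff (hGH : ClassesIn G H) (hHG : ClassesIn H G)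
    (hBG : ∀ g ∈ G, g.val 1 0 = 0) (hBH : ∀ h ∈ H, h.val 1 0 = 0) :
    (∀ a d, IsDiagonalOf G a d ↔ IsDiagonalOf H a d) ∨
      ∀ a d, IsDiagonalOf G a d ↔ IsDiagonalOf H d a := by
  rcases hGH.isDiagonalOf_or hBG hBH with h | h <;>
    rcases hHG.isDiagonalOf_or hBH hBG with h' | h'
  · exact Or.inl fun a d => ⟨h a d, h' a d⟩
  · exact Or.inl fun a d => ⟨h a d, fun hd => h' _ _ (h _ _ (h' _ _ hd))⟩
  · exact Or.inl fun a d => ⟨fun hd => h _ _ (h' _ _ (h _ _ hd)), h' a d⟩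
  · exact Or.inr fun a d => ⟨h a d, h' d a⟩

end Borel

/-- The automorphism `g ↦ g / det g` of `GL₂`, whose values are inverse to the adjugates. -/
def divDet : GL (Fin 2) F ≃* GL (Fin 2) F where
  toFun g := ⟨g⁻¹.val.adjugate, g.val.adjugate,
    by rw [← Matrix.adjugate_mul_distrib, Units.mul_inv, Matrix.adjugate_one],
    by rw [← Matrix.adjugate_mul_distrib, Units.inv_mul, Matrix.adjugate_one]⟩
  invFun g := ⟨g⁻¹.val.adjugate, g.val.adjugate,
    by rw [← Matrix.adjugate_mul_distrib, Units.mul_inv, Matrix.adjugate_one],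
    by rw [← Matrix.adjugate_mul_distrib, Units.inv_mul, Matrix.adjugate_one]⟩
  left_inv g := Units.ext (Matrix.adjugate_adjugate _ (by simp) |>.trans (by simp))
  right_inv g := Units.ext (Matrix.adjugate_adjugate _ (by simp) |>.trans (by simp))
  map_mul' g h := Units.ext (by
    change (g * h)⁻¹.val.adjugate = g⁻¹.val.adjugate * h⁻¹.val.adjugate
    rw [_root_.mul_inv_rev, Units.val_mul, Matrix.adjugate_mul_distrib])

theorem val_inv_divDet (g : GL (Fin 2) F) : ((divDet g)⁻¹).val = g.val.adjugate := rfl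

theorem isConj_inv_divDet (g : GL (Fin 2) F) : IsConj g (divDet g)⁻¹ := by
  refine isConj_of_isScal_iff ?_ ?_ ?_ <;> rw [val_inv_divDet]
  · rw [isScal_iff, isScal_iff, Matrix.adjugate_fin_two]
    simp [eq_comm]
  · rw [Matrix.adjugate_fin_two, Matrix.trace_fin_two, Matrix.trace_fin_two]
    simp [add_comm]
  · simp [Matrix.det_adjugate]

end Unipotent

section Prime

open Matrix.GeneralLinearGroup (upperRightHom)

variable {ℓ : ℕ} [Fact ℓ.Prime] {G H : Subgroup (GL2 ℓ)}

theorem upperRightHom_mem (h : upperRightHom (1 : ZMod ℓ) ∈ G) (x : ZMod ℓ) :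
    upperRightHom x ∈ G := by
  rw [← ZMod.natCast_zmod_val x, ← nsmul_one, AddChar.map_nsmul_eq_pow]
  exact G.pow_mem h _

/-- A subgroup of a Borel subgroup realises too few traces in determinant one. -/
theorem exists_entry_ne_zero (hC : ClassesIn G H) (hG : ∀ s : GL2 ℓ, s.val.det = 1 → s ∈ G) :
    ∃ h ∈ H, h.val 1 0 ≠ 0 := by
  by_contra! hB
  have hsurj : Function.Surjective fun a : (ZMod ℓ)ˣ => (a : ZMod ℓ) + (a⁻¹ : (ZMod ℓ)ˣ) := by
    intro τ
    let s : GL2 ℓ := ⟨!![τ, -1; 1, 0], !![0, 1; -1, τ], by simp [Matrix.one_fin_two],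
      by simp [Matrix.one_fin_two]⟩
    obtain ⟨h, hh, hd, ht, -⟩ := hC s (hG s (by simp [s]))
    have hsd : s.val.det = 1 := by simp [s]
    have hst : s.val.trace = τ := by simp [s, Matrix.trace_fin_two]
    rw [hsd, Matrix.det_fin_two, hB h hh, mul_zero, sub_zero] at hd
    rw [hst, Matrix.trace_fin_two] at ht
    exact ⟨⟨h.val 0 0, h.val 1 1, hd, by rw [mul_comm, hd]⟩, ht⟩
  have h1 := Fintype.card_le_of_surjective _ hsurj
  rw [ZMod.card_units, ZMod.card] at h1
  have := (Fact.out : ℓ.Prime).pos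
  omega

theorem le_of_det_eq_one_mem (hC : ClassesIn G H)
    (hH : ∀ s : GL2 ℓ, s.val.det = 1 → s ∈ H) : G ≤ H := by
  intro g hg
  obtain ⟨h, hh, hd, -⟩ := hC g hg
  refine (Subgroup.mul_mem_cancel_right H (H.inv_mem hh)).1 (hH _ ?_)
  rw [Units.val_mul, Matrix.det_mul, ← hd, ← Matrix.det_mul, Units.mul_inv, Matrix.det_one]

theorem locallyConjugate_of_eq (h : G = H) : LocallyConjugate G H ∧ Nonempty (G ≃* H) := by
  subst h
  exact ⟨⟨Equiv.refl _, fun g => IsConj.refl _⟩, ⟨MulEquiv.refl _⟩⟩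

theorem locallyConjugate_of_upperRightHom_mem (hGH : ClassesIn G H)
    (hHG : ClassesIn H G) (hG : upperRightHom 1 ∈ G) (hH : upperRightHom 1 ∈ H) :
    LocallyConjugate G H ∧ Nonempty (G ≃* H) := by
  have hUG := upperRightHom_mem hG
  have hUH := upperRightHom_mem hH
  by_cases hBG : ∀ g ∈ G, g.val 1 0 = 0
  · by_cases hBH : ∀ h ∈ H, h.val 1 0 = 0
    · rcases hGH.isDiagonalOf_iff hHG hBG hBH with h | h
      · refine locallyConjugate_of_eq (le_antisymm (fun g hg => ?_) fun g hg => ?_)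
        · exact mem_of_isDiagonalOf hUH hBH (hBG g hg) ((h _ _).1 ⟨g, hg, rfl, rfl⟩)
        · exact mem_of_isDiagonalOf hUG hBG (hBH g hg) ((h _ _).2 ⟨g, hg, rfl, rfl⟩)
      · have hmap : G.map (divDet (F := ZMod ℓ)).toMonoidHom = H := by
          ext k
          obtain ⟨g, rfl⟩ := (divDet (F := ZMod ℓ)).surjective k
          rw [Subgroup.mem_map_equiv, MulEquiv.symm_apply_apply, ← H.inv_mem_iff]
          have hv : ((divDet g)⁻¹).val = !![g.val 1 1, -g.val 0 1; -g.val 1 0, g.val 0 0] := by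
            rw [val_inv_divDet, Matrix.adjugate_fin_two]
          constructor <;> intro hk
          · refine mem_of_isDiagonalOf hUH hBH ?_ ?_ <;> rw [hv]
            · simpa using hBG g hk
            · exact (h _ _).1 ⟨g, hk, rfl, rfl⟩
          · have h0 := hBH _ hk
            rw [hv] at h0
            exact mem_of_isDiagonalOf hUG hBG (by simpa using h0)
              ((h _ _).2 ⟨_, hk, by rw [hv]; rfl, by rw [hv]; rfl⟩)
        let e := (G.equivMapOfInjective (divDet (F := ZMod ℓ)).toMonoidHom
          divDet.injective).trans (MulEquiv.subgroupCongr hmap)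
        exact ⟨⟨e.toEquiv.trans (Equiv.inv H), fun g => isConj_inv_divDet g.val⟩, ⟨e⟩⟩
    · push Not at hBH
      obtain ⟨h, hh, hh0⟩ := hBH
      obtain ⟨g, hg, hg0⟩ := exists_entry_ne_zero hHG fun s => mem_of_det_eq_one hUH hh hh0
      exact absurd (hBG g hg) hg0
  · push Not at hBG
    obtain ⟨g, hg, hg0⟩ := hBG
    have hSG : ∀ s : GL2 ℓ, s.val.det = 1 → s ∈ G := fun s => mem_of_det_eq_one hUG hg hg0
    obtain ⟨h, hh, hh0⟩ := exists_entry_ne_zero hGH hSG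
    exact locallyConjugate_of_eq (le_antisymm
      (le_of_det_eq_one_mem hGH fun s => mem_of_det_eq_one hUH hh hh0)
      (le_of_det_eq_one_mem hHG hSG))

end Prime

section Main

open Matrix.GeneralLinearGroup (upperRightHom)

theorem isConj_upperRightHom_one {F : Type*} [Field F] {u : GL (Fin 2) F} (hu : u ≠ 1)
    (hd : u.val.det = 1) (ht : u.val.trace = 2) : IsConj u (upperRightHom 1) := by
  have hs : ¬ IsScal u.val := fun hs => by
    refine hu (eq_of_isConj_of_isScal (z := 1) ⟨1, (one_smul _ _).symm⟩
      (isConj_of_isScal_iff ⟨fun _ => hs, fun _ => ⟨1, (one_smul _ _).symm⟩⟩ ?_ ?_))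
    · rw [ht, Units.val_one, Matrix.trace_one]
      simp
    · rw [hd, Units.val_one, Matrix.det_one]
  refine isConj_of_trace_det hs not_isScal_upperRightHom_one ?_ ?_
  · rw [ht, val_upperRightHom, Matrix.trace_fin_two]
    norm_num
  · rw [hd, val_upperRightHom]
    simp

theorem ClassesIn.map_conj {F : Type*} [Field F] {G H : Subgroup (GL (Fin 2) F)}
    (h : ClassesIn G H) (P Q : GL (Fin 2) F) :
    ClassesIn (G.map (MulAut.conj P).toMonoidHom) (H.map (MulAut.conj Q).toMonoidHom) := by
  rintro _ ⟨g, hg, rfl⟩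
  obtain ⟨k, hk, hd, ht, h1⟩ := h g hg
  refine ⟨_, ⟨k, hk, rfl⟩, ?_, ?_, ?_⟩
  · exact (_root_.det_conj Q k).trans (hd.trans (_root_.det_conj P g).symm)
  · exact (trace_conj Q k).trans (ht.trans (trace_conj P g).symm)
  · simpa using h1

theorem IsSemisimpleGroup.isScal_iff {F : Type*} [Field F]
    {G : Subgroup (GL (Fin 2) F)} (hG : IsSemisimpleGroup G) {g : GL (Fin 2) F} (hg : g ∈ G) :
    IsScal g.val ↔ g.val.trace ^ 2 = 4 * g.val.det := by
  refine ⟨?_, hG g hg⟩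
  rintro ⟨c, hc⟩
  rw [hc]
  simp
  ring

variable {ℓ : ℕ} [Fact ℓ.Prime] {G H : Subgroup (GL2 ℓ)}

theorem exists_eq_two_mul_sq {t d : ZMod ℓ} (h : t ^ 2 = 4 * d) : ∃ c, t = 2 * c ∧ d = c ^ 2 := by
  by_cases h2 : (2 : ZMod ℓ) = 0
  · have hℓ : ℓ = 2 := by
      have : ((2 : ℕ) : ZMod ℓ) = 0 := by exact_mod_cast h2
      exact (Nat.prime_dvd_prime_iff_eq Fact.out Nat.prime_two).1
        ((ZMod.natCast_eq_zero_iff _ _).1 this)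
    subst hℓ
    refine ⟨d, ?_, (ZMod.pow_card d).symm⟩
    have : t ^ 2 = 0 := by linear_combination h + 2 * d * h2
    rw [h2, zero_mul, pow_eq_zero_iff two_ne_zero |>.1 this]
  · refine ⟨t / 2, by field_simp, ?_⟩
    field_simp
    linear_combination -h

theorem exists_unipotent_mem (hG : ¬ IsSemisimpleGroup G) :
    ∃ u ∈ G, u ≠ 1 ∧ u.val.det = 1 ∧ u.val.trace = 2 := by
  simp only [IsSemisimpleGroup] at hG
  push Not at hG
  obtain ⟨g, hg, hdisc, hs⟩ := hG
  obtain ⟨c, ht, hd⟩ := exists_eq_two_mul_sq hdisc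
  have hc : c ≠ 0 := by
    rintro rfl
    exact _root_.det_ne_zero g (by simpa using hd)
  set N := g.val - c • 1 with hN
  have hgN : g.val = c • 1 + N := by rw [hN]; abel
  have hNN : N * N = 0 := by
    rw [hN, sub_mul, mul_sub, mul_self_eq, ht, hd]
    simp
    module
  have hpow : ∀ n : ℕ, g.val ^ (n + 1) = c ^ (n + 1) • 1 + ((n + 1 : ℕ) * c ^ n) • N := by
    intro n
    induction n with
    | zero => simpa using hgN
    | succ n ih =>
      rw [pow_succ, ih, hgN]
      simp [add_mul, mul_add, hNN]
      module
  have hgℓ : (g ^ ℓ).val = c • 1 := by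
    have h := hpow (ℓ - 1)
    rw [Nat.sub_add_cancel (Fact.out : ℓ.Prime).one_le] at h
    simpa [ZMod.pow_card] using h
  have hinv : ((g ^ ℓ)⁻¹).val = c⁻¹ • 1 := by
    refine Units.inv_eq_of_mul_eq_one_right ?_
    rw [hgℓ, smul_mul_smul_comm, mul_one, mul_inv_cancel₀ hc, one_smul]
  have hu : (g * (g ^ ℓ)⁻¹).val = c⁻¹ • g.val := by
    rw [Units.val_mul, hinv, mul_smul_comm, mul_one]
  refine ⟨g * (g ^ ℓ)⁻¹, G.mul_mem hg (G.inv_mem (G.pow_mem hg _)), fun h => ?_, ?_, ?_⟩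
  · refine hs ⟨c, ?_⟩
    rw [h] at hu
    rw [← Units.val_one, hu, smul_smul, mul_inv_cancel₀ hc, one_smul]
  · rw [hu, Matrix.det_smul, hd]
    simp
    field_simp
  · rw [hu, Matrix.trace_smul, ht, smul_eq_mul]
    field_simp

theorem dimOne_eq_two_iff {g : GL2 ℓ} : dimOne g = 2 ↔ g = 1 := by
  have h2 : Module.finrank (ZMod ℓ) (Fin 2 → ZMod ℓ) = 2 := by simp
  rw [dimOne]
  constructor
  · intro h
    have := LinearMap.ker_eq_top.1 (Submodule.eq_top_of_finrank_eq (h.trans h2.symm))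
    exact Units.ext (sub_eq_zero.1 ((map_eq_zero_iff _ Matrix.toLin'.injective).1 this))
  · rintro rfl
    rw [mat, Units.val_one, sub_self, map_zero, LinearMap.ker_zero, finrank_top, h2]

theorem classesIn_of_sigSet_eq (h : sigSet G = sigSet H) : ClassesIn G H := by
  intro g hg
  obtain ⟨k, hk, hgk⟩ : sigOf g ∈ sigSet H := h ▸ ⟨g, hg, rfl⟩
  simp only [sigOf, Prod.mk.injEq] at hgk
  exact ⟨k, hk, hgk.1, hgk.2.1, by rw [← dimOne_eq_two_iff, hgk.2.2, dimOne_eq_two_iff]⟩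

theorem LocallyConjugate.of_map_conj {P Q : GL2 ℓ}
    (h : LocallyConjugate (G.map (MulAut.conj P).toMonoidHom) (H.map (MulAut.conj Q).toMonoidHom) ∧
      Nonempty (G.map (MulAut.conj P).toMonoidHom ≃* H.map (MulAut.conj Q).toMonoidHom)) :
    LocallyConjugate G H ∧ Nonempty (G ≃* H) := by
  obtain ⟨⟨f, hf⟩, ⟨e⟩⟩ := h
  let eG := G.equivMapOfInjective (MulAut.conj P).toMonoidHom (MulAut.conj P).injective
  let eH := H.equivMapOfInjective (MulAut.conj Q).toMonoidHom (MulAut.conj Q).injective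
  refine ⟨⟨(eG.toEquiv.trans f).trans eH.symm.toEquiv, fun g => ?_⟩,
    ⟨(eG.trans e).trans eH.symm⟩⟩
  have h1 : IsConj g.val (eG g).val := isConj_iff.2 ⟨P, rfl⟩
  have h2 : IsConj (eH.symm (f (eG g))).val (eH (eH.symm (f (eG g)))).val := isConj_iff.2 ⟨Q, rfl⟩
  rw [eH.apply_symm_apply] at h2
  exact (h1.trans (hf _)).trans h2.symm

theorem isMatching_of_classesIn (hSG : IsSemisimpleGroup G) (hSH : IsSemisimpleGroup H)
    (hGH : ClassesIn G H) (hHG : ClassesIn H G) (hz : zRatio G = zRatio H) :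
    IsMatching G H := by
  have key : ∀ {K L : Subgroup (GL2 ℓ)}, IsSemisimpleGroup K → IsSemisimpleGroup L →
      ClassesIn K L → ∀ g ∈ K, ∃ h ∈ L, IsConj g h := by
    intro K L hK hL h g hg
    obtain ⟨k, hk, hd, ht, -⟩ := h g hg
    refine ⟨k, hk, isConj_of_isScal_iff ?_ ht.symm hd.symm⟩
    rw [hK.isScal_iff hg, hL.isScal_iff hk, hd, ht]
  refine ⟨key hSG hSH hGH, key hSH hSG hHG, ?_⟩
  have hG0 : (Nat.card G : ℚ) ≠ 0 := by exact_mod_cast Nat.card_pos.ne'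
  have hH0 : (Nat.card H : ℚ) ≠ 0 := by exact_mod_cast Nat.card_pos.ne'
  exact_mod_cast (div_eq_div_iff hG0 hH0).1 hz

theorem ClassesIn.exists_unipotent_mem (h : ClassesIn G H)
    (hG : ∃ u ∈ G, u ≠ 1 ∧ u.val.det = 1 ∧ u.val.trace = 2) :
    ∃ u ∈ H, u ≠ 1 ∧ u.val.det = 1 ∧ u.val.trace = 2 := by
  obtain ⟨u, hu, hu1, hd, ht⟩ := hG
  obtain ⟨v, hv, hvd, hvt, hv1⟩ := h u hu
  exact ⟨v, hv, fun h => hu1 (hv1.1 h), hvd.trans hd, hvt.trans ht⟩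

end Main

/-- Let `ℓ` be a prime and let `G` and `H` be subgroups of `GL₂(ℤ/ℓℤ)` with
`sig(G) = sig(H)` and `z(G) = z(H)`.  Then `G` and `H` are locally conjugate in
`GL₂(ℤ/ℓℤ)` and are isomorphic as abstract groups. -/
theorem stmt16 (ℓ : ℕ) [Fact (Nat.Prime ℓ)]
    (G H : Subgroup (GL2 ℓ))
    (hsig : sigSet G = sigSet H)
    (hz : zRatio G = zRatio H) :
    LocallyConjugate G H ∧ Nonempty (G ≃* H) := by
  have hGH := classesIn_of_sigSet_eq hsig
  have hHG := classesIn_of_sigSet_eq hsig.symm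
  by_cases hS : IsSemisimpleGroup G ∧ IsSemisimpleGroup H
  · obtain ⟨e, he⟩ := exists_mulEquiv_of_isSemisimpleGroup hS.1 hS.2
      (isMatching_of_classesIn hS.1 hS.2 hGH hHG hz)
    exact ⟨⟨e.toEquiv, he⟩, ⟨e⟩⟩
  have hU : (∃ u ∈ G, u ≠ 1 ∧ u.val.det = 1 ∧ u.val.trace = 2) ∧
      ∃ u ∈ H, u ≠ 1 ∧ u.val.det = 1 ∧ u.val.trace = 2 := by
    rcases not_and_or.1 hS with h | h
    · exact ⟨exists_unipotent_mem h, hGH.exists_unipotent_mem (exists_unipotent_mem h)⟩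
    · exact ⟨hHG.exists_unipotent_mem (exists_unipotent_mem h), exists_unipotent_mem h⟩
  obtain ⟨⟨u, hu, hu1, hud, hut⟩, v, hv, hv1, hvd, hvt⟩ := hU
  obtain ⟨P, hP⟩ := isConj_iff.1 (isConj_upperRightHom_one hu1 hud hut)
  obtain ⟨Q, hQ⟩ := isConj_iff.1 (isConj_upperRightHom_one hv1 hvd hvt)
  exact LocallyConjugate.of_map_conj (locallyConjugate_of_upperRightHom_mem (hGH.map_conj P Q)
    (hHG.map_conj Q P) ⟨u, hu, hP⟩ ⟨v, hv, hQ⟩)
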